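/- For every integer n ≥ 2, the continuous commutator map c : U(n) × U(n) → U(n), c(x, y) = xyx⁻¹y⁻¹, on the unitary group U(n) of n×n complex matrices is not homotopic (through continuous maps) to the constant map with value the identity matrix; that is, U(n) is not homotopy-abelian. -/

import Mathlib

open scoped Matrix

namespace UnitaryCommutator

/-- Invertible complex matrices, with the topology of units. -/
abbrev G (ι : Type) [Fintype ι] [DecidableEq ι] := (Matrix ι ι ℂ)ˣ

section Basic
variable {ι κ : Type} [Fintype ι] [DecidableEq ι] [Fintype κ] [DecidableEq κ]
variable {X : Type} [TopologicalSpace X]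

theorem inv_val_eq (g : G ι) : ((g⁻¹ : G ι) : Matrix ι ι ℂ) = (g : Matrix ι ι ℂ)⁻¹ := by
  simp [Matrix.coe_units_inv]

theorem isUnit_det (g : G ι) : (g : Matrix ι ι ℂ).det ≠ 0 := by
  have := (Matrix.isUnit_iff_isUnit_det _).1 g.isUnit
  exact this.ne_zero

theorem continuous_G_iff {f : X → G ι} : Continuous f ↔ Continuous fun x => (f x : Matrix ι ι ℂ) := by
  refine ⟨fun h => Units.continuous_val.comp h, fun h => ?_⟩
  rw [Units.continuous_iff]
  refine ⟨h, ?_⟩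
  have : (fun x => ((f x)⁻¹ : G ι).val) =
      fun x => ((f x : Matrix ι ι ℂ).det)⁻¹ • (f x : Matrix ι ι ℂ).adjugate := by
    funext x
    rw [inv_val_eq, Matrix.inv_def, Ring.inverse_eq_inv']
  rw [this]
  exact (h.matrix_det.inv₀ fun x => isUnit_det _).smul h.matrix_adjugate

@[fun_prop]
theorem continuous_G_val {f : X → G ι} (h : Continuous f) :
    Continuous fun x => (f x : Matrix ι ι ℂ) := continuous_G_iff.1 h

/-- Block sum of invertible matrices. -/
def dsum (a : G ι) (b : G κ) : G (ι ⊕ κ) where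
  val := Matrix.fromBlocks a 0 0 b
  inv := Matrix.fromBlocks (a⁻¹ : G ι) 0 0 (b⁻¹ : G κ)
  val_inv := by simp [Matrix.fromBlocks_multiply, ← Units.val_mul, -Matrix.coe_units_inv]
  inv_val := by simp [Matrix.fromBlocks_multiply, ← Units.val_mul, -Matrix.coe_units_inv]

theorem dsum_val (a : G ι) (b : G κ) :
    (dsum a b : Matrix (ι ⊕ κ) (ι ⊕ κ) ℂ) = Matrix.fromBlocks a 0 0 b := rfl

theorem dsum_mul (a a' : G ι) (b b' : G κ) : dsum a b * dsum a' b' = dsum (a * a') (b * b') := by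
  ext1; simp [dsum_val, Matrix.fromBlocks_multiply]

@[simp] theorem dsum_one : dsum (1 : G ι) (1 : G κ) = 1 := by
  ext1; simp [dsum_val]

theorem dsum_inv (a : G ι) (b : G κ) : (dsum a b)⁻¹ = dsum a⁻¹ b⁻¹ := by
  rw [inv_eq_iff_mul_eq_one, dsum_mul]; simp

@[fun_prop]
theorem continuous_dsum {f : X → G ι} {g : X → G κ} (hf : Continuous f) (hg : Continuous g) :
    Continuous fun x => dsum (f x) (g x) := by
  rw [continuous_G_iff]
  exact (continuous_G_val hf).matrix_fromBlocks continuous_const continuous_const (continuous_G_val hg)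

/-- Reindexing of invertible matrices. -/
def reix (e : ι ≃ κ) : G ι ≃* G κ := Units.mapEquiv (Matrix.reindexAlgEquiv ℂ ℂ e).toMulEquiv

theorem reix_val (e : ι ≃ κ) (a : G ι) :
    (reix e a : Matrix κ κ ℂ) = (a : Matrix ι ι ℂ).submatrix e.symm e.symm := rfl

@[fun_prop]
theorem continuous_reix (e : ι ≃ κ) {f : X → G ι} (hf : Continuous f) :
    Continuous fun x => reix e (f x) := by
  rw [continuous_G_iff]
  exact (continuous_G_val hf).matrix_submatrix _ _

/-- Scalar matrices. -/
def scal (ι : Type) [Fintype ι] [DecidableEq ι] : ℂˣ →* G ι := Units.map (Matrix.scalar ι).toMonoidHom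

theorem scal_val (c : ℂˣ) : (scal ι c : Matrix ι ι ℂ) = (c : ℂ) • 1 := by
  simp [scal, Matrix.smul_one_eq_diagonal]

theorem scal_comm (c : ℂˣ) (a : G ι) : scal ι c * a = a * scal ι c := by
  ext1; simp [scal_val]

/-- Scalar matrices with unit-circle entry. -/
noncomputable def cs (ι : Type) [Fintype ι] [DecidableEq ι] : Circle →* G ι := (scal ι).comp Circle.toUnits

theorem cs_val (c : Circle) : (cs ι c : Matrix ι ι ℂ) = (c : ℂ) • 1 := by
  simp [cs, scal_val]

theorem cs_comm (c : Circle) (a : G ι) : cs ι c * a = a * cs ι c := scal_comm _ _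

@[fun_prop]
theorem continuous_cs {f : X → Circle} (hf : Continuous f) : Continuous fun x => cs ι (f x) := by
  rw [continuous_G_iff]
  simp only [cs_val]
  fun_prop

/-- An invertible matrix from a two-sided inverse (or any proof of invertibility). -/
noncomputable def mkG (A : Matrix ι ι ℂ) (h : IsUnit A) : G ι := h.unit

@[simp] theorem mkG_val (A : Matrix ι ι ℂ) (h : IsUnit A) : (mkG A h : Matrix ι ι ℂ) = A := rfl

/-- The rotation of `ι ⊕ ι` by an angle. -/
noncomputable def rot (ι : Type) [Fintype ι] [DecidableEq ι] (x : ℝ) : G (ι ⊕ ι) where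
  val := Matrix.fromBlocks ((Real.cos x : ℂ) • 1) (-(Real.sin x : ℂ) • 1)
    ((Real.sin x : ℂ) • 1) ((Real.cos x : ℂ) • 1)
  inv := Matrix.fromBlocks ((Real.cos x : ℂ) • 1) ((Real.sin x : ℂ) • 1)
    (-(Real.sin x : ℂ) • 1) ((Real.cos x : ℂ) • 1)
  val_inv := by
    have h := Complex.cos_sq_add_sin_sq x
    have h' := Complex.sin_sq_add_cos_sq x
    rw [Matrix.fromBlocks_multiply, ← Matrix.fromBlocks_one]
    congr 1 <;> simp [smul_smul, mul_comm] <;> simp [← add_smul, ← sq, h, h']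
  inv_val := by
    have h := Complex.cos_sq_add_sin_sq x
    have h' := Complex.sin_sq_add_cos_sq x
    rw [Matrix.fromBlocks_multiply, ← Matrix.fromBlocks_one]
    congr 1 <;> simp [smul_smul, mul_comm] <;> simp [← add_smul, ← sq, h, h']

theorem rot_val (x : ℝ) : (rot ι x : Matrix (ι ⊕ ι) (ι ⊕ ι) ℂ) =
    Matrix.fromBlocks ((Real.cos x : ℂ) • 1) (-(Real.sin x : ℂ) • 1)
    ((Real.sin x : ℂ) • 1) ((Real.cos x : ℂ) • 1) := rfl

theorem rot_inv_val (x : ℝ) : ((rot ι x)⁻¹ : Matrix (ι ⊕ ι) (ι ⊕ ι) ℂ) =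
    Matrix.fromBlocks ((Real.cos x : ℂ) • 1) ((Real.sin x : ℂ) • 1)
    (-(Real.sin x : ℂ) • 1) ((Real.cos x : ℂ) • 1) := by
  rw [← inv_val_eq]; rfl

@[simp] theorem rot_zero : rot ι 0 = 1 := by
  ext1; simp [rot_val]

@[fun_prop]
theorem continuous_rot {f : X → ℝ} (hf : Continuous f) : Continuous fun x => rot ι (f x) := by
  rw [continuous_G_iff]
  simp only [rot_val]
  exact Continuous.matrix_fromBlocks (by fun_prop) (by fun_prop) (by fun_prop) (by fun_prop)

theorem rot_conj_half (a b : G ι) :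
    rot ι (Real.pi / 2) * dsum a b * (rot ι (Real.pi / 2))⁻¹ = dsum b a := by
  ext1
  rw [Units.val_mul, Units.val_mul, inv_val_eq, rot_inv_val, rot_val, dsum_val, dsum_val]
  simp [Matrix.fromBlocks_multiply]

theorem rot_comm (x : ℝ) (a : G ι) : rot ι x * dsum a a = dsum a a * rot ι x := by
  ext1
  simp [rot_val, dsum_val, Matrix.fromBlocks_multiply]

end Basic

/-- A homotopy invariant, additive functional on maps into invertible matrices. -/
structure Inv (X : Type) [TopologicalSpace X] where
  val : ∀ {ι : Type} [Fintype ι] [DecidableEq ι], (X → G ι) → ℂ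
  homotopy : ∀ {ι : Type} [Fintype ι] [DecidableEq ι] (F : unitInterval → X → G ι),
    Continuous (fun p : unitInterval × X => F p.1 p.2) → val (F 0) = val (F 1)
  sum : ∀ {ι κ : Type} [Fintype ι] [DecidableEq ι] [Fintype κ] [DecidableEq κ]
    (f : X → G ι) (g : X → G κ), Continuous f → Continuous g →
    val (fun x => dsum (f x) (g x)) = val f + val g
  reindex : ∀ {ι κ : Type} [Fintype ι] [DecidableEq ι] [Fintype κ] [DecidableEq κ]
    (e : ι ≃ κ) (f : X → G ι), Continuous f → val (fun x => reix e (f x)) = val f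
  one : ∀ {ι : Type} [Fintype ι] [DecidableEq ι], val (fun _ => (1 : G ι)) = 0

namespace Inv
variable {X : Type} [TopologicalSpace X] (I : Inv X)
variable {ι κ : Type} [Fintype ι] [DecidableEq ι] [Fintype κ] [DecidableEq κ]

theorem sum_one (f : X → G ι) (hf : Continuous f) :
    I.val (fun x => dsum (f x) (1 : G κ)) = I.val f := by
  rw [I.sum f (fun _ => 1) hf continuous_const, I.one, add_zero]

theorem mul (f g : X → G ι) (hf : Continuous f) (hg : Continuous g) :
    I.val (fun x => f x * g x) = I.val f + I.val g := by
  have h := I.homotopy (fun s x => dsum (f x) (1 : G ι) * (rot ι (Real.pi / 2 * s) *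
    dsum (g x) (1 : G ι) * (rot ι (Real.pi / 2 * s))⁻¹)) (by fun_prop)
  simp only [Set.Icc.coe_zero, Set.Icc.coe_one, mul_zero, mul_one, rot_zero, inv_one, one_mul,
    rot_conj_half, dsum_mul] at h
  rw [← I.sum f g hf hg, ← h, I.sum_one (fun x => f x * g x) (hf.mul hg)]

theorem inv (f : X → G ι) (hf : Continuous f) : I.val (fun x => (f x)⁻¹) = - I.val f := by
  have h := I.mul f (fun x => (f x)⁻¹) hf hf.inv
  simp only [mul_inv_cancel, I.one] at h
  linear_combination -h

theorem conj (f g : X → G ι) (hf : Continuous f) (hg : Continuous g) :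
    I.val (fun x => g x * f x * (g x)⁻¹) = I.val f := by
  rw [I.mul (fun x => g x * f x) (fun x => (g x)⁻¹) (hg.mul hf) hg.inv, I.mul _ _ hg hf, I.inv _ hg]
  ring

theorem pow (f : X → G ι) (hf : Continuous f) (n : ℕ) : I.val (fun x => f x ^ n) = n * I.val f := by
  induction n with
  | zero => simp [I.one]
  | succ k ih =>
    simp only [pow_succ]
    rw [I.mul _ _ (by fun_prop) hf, ih]; push_cast; ring

theorem empty [IsEmpty ι] (f : X → G ι) : I.val f = 0 := by
  rw [← I.one (ι := ι)]; congr; funext x; ext i; exact isEmptyElim i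

end Inv
end UnitaryCommutator

open scoped Matrix

namespace UnitaryCommutator

section Idem
variable {ι κ : Type} [Fintype ι] [DecidableEq ι] [Fintype κ] [DecidableEq κ]
variable {X : Type} [TopologicalSpace X]

/-- The one-parameter group `c ↦ 1 + (c - 1) P` attached to an idempotent `P`. -/
noncomputable def idU (P : Matrix ι ι ℂ) (hP : P * P = P) : Circle →* G ι where
  toFun c :=
    { val := 1 + ((c : ℂ) - 1) • P
      inv := 1 + ((c⁻¹ : Circle) - 1 : ℂ) • P
      val_inv := by
        have : (c : ℂ) ≠ 0 := c.coe_ne_zero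
        simp only [mul_add, add_mul, one_mul, mul_one, smul_mul_smul_comm, hP, Circle.coe_inv]
        rw [add_assoc, ← add_smul, ← add_smul]
        convert add_zero (1 : Matrix ι ι ℂ)
        convert zero_smul ℂ P
        field_simp; ring
      inv_val := by
        have : (c : ℂ) ≠ 0 := c.coe_ne_zero
        simp only [mul_add, add_mul, one_mul, mul_one, smul_mul_smul_comm, hP, Circle.coe_inv]
        rw [add_assoc, ← add_smul, ← add_smul]
        convert add_zero (1 : Matrix ι ι ℂ)
        convert zero_smul ℂ P
        field_simp; ring }
  map_one' := by ext1; simp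
  map_mul' c d := by
    ext1
    simp only [Units.val_mul, mul_add, add_mul, one_mul, mul_one, smul_mul_smul_comm, hP,
      Circle.coe_mul]
    rw [add_assoc, ← add_smul, ← add_smul]
    congr 2; ring

theorem idU_val (P : Matrix ι ι ℂ) (hP : P * P = P) (c : Circle) :
    (idU P hP c : Matrix ι ι ℂ) = 1 + ((c : ℂ) - 1) • P := rfl

@[fun_prop]
theorem continuous_idU {P : X → Matrix ι ι ℂ} {hP : ∀ x, P x * P x = P x} {c : X → Circle}
    (h1 : Continuous P) (h2 : Continuous c) : Continuous fun x => idU (P x) (hP x) (c x) := by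
  rw [continuous_G_iff]
  simp only [idU_val]
  fun_prop

theorem idU_one (c : Circle) : idU (1 : Matrix ι ι ℂ) (one_mul 1) c = cs ι c := by
  ext1
  simp [idU_val, cs_val, sub_smul]

theorem Inv.idem_iso (I : Inv X) (P : X → Matrix ι ι ℂ) (Q : X → Matrix κ κ ℂ)
    (a : X → Matrix ι κ ℂ) (b : X → Matrix κ ι ℂ) (hP : ∀ x, P x * P x = P x)
    (hQ : ∀ x, Q x * Q x = Q x) (ha : Continuous a) (hb : Continuous b)
    (hab : ∀ x, a x * b x = P x) (hba : ∀ x, b x * a x = Q x) (hPa : ∀ x, P x * a x = a x)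
    (hbP : ∀ x, b x * P x = b x) (c : X → Circle) (hc : Continuous c) :
    I.val (fun x => idU (P x) (hP x) (c x)) = I.val (fun x => idU (Q x) (hQ x) (c x)) := by
  have hPc : Continuous P := by
    have : P = fun x => a x * b x := funext fun x => (hab x).symm
    rw [this]; exact ha.matrix_mul hb
  have hQc : Continuous Q := by
    have : Q = fun x => b x * a x := funext fun x => (hba x).symm
    rw [this]; exact hb.matrix_mul ha
  have haQ : ∀ x, a x * Q x = a x := fun x => by rw [← hba, ← Matrix.mul_assoc, hab, hPa]
  have hQb : ∀ x, Q x * b x = b x := fun x => by rw [← hba, Matrix.mul_assoc, hab, hbP]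
  have hS : ∀ x, Matrix.fromBlocks (1 - P x) (a x) (b x) (1 - Q x) *
      Matrix.fromBlocks (1 - P x) (a x) (b x) (1 - Q x) = 1 := fun x => by
    rw [Matrix.fromBlocks_multiply, ← Matrix.fromBlocks_one]
    congr 1
    · rw [hab]; simp [mul_sub, sub_mul, hP]
    · rw [Matrix.sub_mul, Matrix.mul_sub, hPa, haQ]; simp
    · rw [Matrix.sub_mul, Matrix.mul_sub, hQb, hbP]; simp
    · rw [hba]; simp [mul_sub, sub_mul, hQ]
  set S : X → G (ι ⊕ κ) := fun x => ⟨_, _, hS x, hS x⟩ with hSdef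
  have hSc : Continuous S := by
    rw [continuous_G_iff]
    exact Continuous.matrix_fromBlocks (by fun_prop) ha hb (by fun_prop)
  have key : ∀ x, S x * dsum (idU (P x) (hP x) (c x)) 1 * (S x)⁻¹ =
      dsum 1 (idU (Q x) (hQ x) (c x)) := fun x => by
    rw [mul_inv_eq_iff_eq_mul]
    ext1
    simp only [Units.val_mul, dsum_val, hSdef, idU_val, Units.val_one, Matrix.fromBlocks_multiply]
    congr 1
    · simp [mul_add, sub_mul, hP]
    · simp
    · simp [Matrix.mul_add, Matrix.add_mul, hbP, hQb]
    · simp [add_mul, mul_sub, hQ]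
  have h1 := I.conj (fun x => dsum (idU (P x) (hP x) (c x)) (1 : G κ)) S (by fun_prop) hSc
  simp only [key] at h1
  rw [I.sum_one _ (by fun_prop), I.sum _ _ (by fun_prop) (by fun_prop), I.one, zero_add] at h1
  exact h1.symm

end Idem

section Perturb
variable {ι : Type} [Fintype ι] [DecidableEq ι]
variable {X : Type} [TopologicalSpace X] [CompactSpace X]

theorem exists_close_invertible (g : X → G ι) (hg : Continuous g) :
    ∃ ε > 0, ∀ (x : X) (N : Matrix ι ι ℂ), (∀ i j, ‖N i j - (g x : Matrix ι ι ℂ) i j‖ < ε) →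
      IsUnit N := by
  have hopen : IsOpen {p : X × Matrix ι ι ℂ | ((g p.1 : Matrix ι ι ℂ) + p.2).det ≠ 0} := by
    have : Continuous fun p : X × Matrix ι ι ℂ => ((g p.1 : Matrix ι ι ℂ) + p.2).det :=
      Continuous.matrix_det (by fun_prop)
    exact isOpen_ne_fun this continuous_const
  obtain ⟨u, v, hu, hv, hsu, htv, huv⟩ := generalized_tube_lemma
    (isCompact_univ (X := X)) (isCompact_singleton (x := (0 : Matrix ι ι ℂ))) hopen (by
      rintro ⟨x, N⟩ ⟨-, hN⟩
      rw [Set.mem_singleton_iff] at hN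
      subst hN
      simpa using isUnit_det (g x))
  have hv0 : v ∈ nhds (0 : ι → ι → ℂ) := hv.mem_nhds (htv rfl)
  obtain ⟨ε, hε, hball⟩ := Metric.mem_nhds_iff.1 hv0
  refine ⟨ε, hε, fun x N h => ?_⟩
  have hmem : N - (g x : Matrix ι ι ℂ) ∈ v := by
    apply hball
    refine mem_ball_zero_iff.2 ((pi_norm_lt_iff hε).2 fun i => (pi_norm_lt_iff hε).2 fun j => h i j)
  have := @huv (x, N - (g x : Matrix ι ι ℂ)) ⟨hsu trivial, hmem⟩
  rw [Set.mem_ofPred_eq, add_sub_cancel] at this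
  rw [Matrix.isUnit_iff_isUnit_det]
  exact this.isUnit

theorem Inv.close (I : Inv X) (g h : X → G ι) (hg : Continuous g) (hh : Continuous h) (ε : ℝ)
    (hε : ∀ (x : X) (N : Matrix ι ι ℂ), (∀ i j, ‖N i j - (g x : Matrix ι ι ℂ) i j‖ < ε) →
      IsUnit N)
    (hgh : ∀ x i j, ‖(h x : Matrix ι ι ℂ) i j - (g x : Matrix ι ι ℂ) i j‖ < ε) :
    I.val g = I.val h := by
  have hu : ∀ (s : unitInterval) x, IsUnit ((g x : Matrix ι ι ℂ) +
      ((s : ℝ) : ℂ) • ((h x : Matrix ι ι ℂ) - g x)) := fun s x => by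
    apply hε x
    intro i j
    simp only [Matrix.add_apply, Matrix.smul_apply, Matrix.sub_apply, add_sub_cancel_left, smul_eq_mul,
      norm_mul, Complex.norm_real, Real.norm_eq_abs, abs_of_nonneg s.2.1]
    exact (mul_le_of_le_one_left (norm_nonneg _) s.2.2).trans_lt (hgh x i j)
  have := I.homotopy (fun s x => mkG _ (hu s x)) (by
    rw [continuous_G_iff]; simp only [mkG_val]; fun_prop)
  convert this using 2
  · funext x; ext1; simp
  · funext x; ext1; simp

end Perturb

section Linear
variable {ι κ : Type} [Fintype ι] [DecidableEq ι] [Fintype κ] [DecidableEq κ]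
variable {Y : Type} [TopologicalSpace Y]

/-- Matrix polynomials of degree at most `D` in the circle variable. -/
def PolyZ {ι κ : Type} : ℕ → (Circle → Y → Matrix ι κ ℂ) → Prop
  | 0, q => ∃ c : Y → Matrix ι κ ℂ, Continuous c ∧ ∀ z y, q z y = c y
  | D + 1, q => ∃ c : Y → Matrix ι κ ℂ, Continuous c ∧ ∃ r, PolyZ D r ∧
      ∀ z y, q z y = c y + (z : ℂ) • r z y

theorem PolyZ.continuous {D : ℕ} {q : Circle → Y → Matrix ι κ ℂ} (h : PolyZ D q) :
    Continuous fun x : Circle × Y => q x.1 x.2 := by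
  induction D generalizing q with
  | zero => obtain ⟨c, hc, h⟩ := h; simp only [h]; fun_prop
  | succ D ih =>
    obtain ⟨c, hc, r, hr, h⟩ := h
    have := ih hr
    simp only [h]; fun_prop

theorem PolyZ.sum (D : ℕ) (c : ℕ → Y → Matrix ι κ ℂ) (hc : ∀ j, Continuous (c j)) :
    PolyZ D (fun z y => ∑ j ∈ Finset.range (D + 1), (z : ℂ) ^ j • c j y) := by
  induction D generalizing c with
  | zero => exact ⟨c 0, hc 0, fun z y => by simp⟩
  | succ D ih =>
    refine ⟨c 0, hc 0, _, ih (fun j => c (j + 1)) fun j => hc _, fun z y => ?_⟩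
    simp only [Finset.smul_sum]
    rw [Finset.sum_range_succ', add_comm]
    simp [pow_succ', smul_smul]

theorem PolyZ.fromBlocks {D : ℕ} {r : Circle → Y → Matrix ι κ ℂ} (h : PolyZ D r)
    {ι' κ' : Type} (A : Y → Matrix ι' κ' ℂ) (B : Y → Matrix ι' κ ℂ)
    (C : Y → Matrix ι κ' ℂ) (hA : Continuous A) (hB : Continuous B) (hC : Continuous C) :
    PolyZ D (fun z y => Matrix.fromBlocks (A y) (B y) (C y) (r z y)) := by
  induction D generalizing r A B C with
  | zero =>
    obtain ⟨c, hc, h⟩ := h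
    exact ⟨_, hA.matrix_fromBlocks hB hC hc, fun z y => by simp only [h]⟩
  | succ D ih =>
    obtain ⟨c, hc, r', hr', h⟩ := h
    refine ⟨_, hA.matrix_fromBlocks hB hC hc, _, ih hr' (fun _ => 0) (fun _ => 0) (fun _ => 0)
      continuous_const continuous_const continuous_const, fun z y => ?_⟩
    simp [h, Matrix.fromBlocks_smul, Matrix.fromBlocks_add]

/-- Lower unipotent block matrices. -/
def lowU (r : Matrix κ ι ℂ) : G (ι ⊕ κ) where
  val := Matrix.fromBlocks 1 0 r 1
  inv := Matrix.fromBlocks 1 0 (-r) 1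
  val_inv := by simp [Matrix.fromBlocks_multiply]
  inv_val := by simp [Matrix.fromBlocks_multiply]

/-- Upper unipotent block matrices. -/
def upU (r : Matrix ι κ ℂ) : G (ι ⊕ κ) where
  val := Matrix.fromBlocks 1 r 0 1
  inv := Matrix.fromBlocks 1 (-r) 0 1
  val_inv := by simp [Matrix.fromBlocks_multiply]
  inv_val := by simp [Matrix.fromBlocks_multiply]

theorem Inv.lowU_eq {X : Type} [TopologicalSpace X] (I : Inv X) (r : X → Matrix κ ι ℂ)
    (hr : Continuous r) : I.val (fun x => lowU (r x)) = 0 := by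
  have := I.homotopy (fun s x => lowU (((s : ℝ) : ℂ) • r x)) (by
    rw [continuous_G_iff]
    exact Continuous.matrix_fromBlocks (by fun_prop) (by fun_prop) (by fun_prop) (by fun_prop))
  simp only [Set.Icc.coe_zero, Set.Icc.coe_one, Complex.ofReal_one, one_smul] at this
  rw [← this, ← I.one (ι := ι ⊕ κ)]
  congr; funext x; ext1; simp [lowU]

theorem Inv.upU_eq {X : Type} [TopologicalSpace X] (I : Inv X) (r : X → Matrix ι κ ℂ)
    (hr : Continuous r) : I.val (fun x => upU (r x)) = 0 := by
  have := I.homotopy (fun s x => upU (((s : ℝ) : ℂ) • r x)) (by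
    rw [continuous_G_iff]
    exact Continuous.matrix_fromBlocks (by fun_prop) (by fun_prop) (by fun_prop) (by fun_prop))
  simp only [Set.Icc.coe_zero, Set.Icc.coe_one, Complex.ofReal_one, one_smul] at this
  rw [← this, ← I.one (ι := ι ⊕ κ)]
  congr; funext x; ext1; simp [upU]

theorem exists_linear {D : ℕ} (q : Circle → Y → Matrix ι ι ℂ) (h : PolyZ D q)
    (hq : ∀ z y, IsUnit (q z y)) :
    ∃ (κ : Type) (_ : Fintype κ) (_ : DecidableEq κ) (a b : Y → Matrix κ κ ℂ)
      (_ : Continuous a) (_ : Continuous b)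
      (hab : ∀ (z : Circle) y, IsUnit (a y + (z : ℂ) • b y)), ∀ I : Inv (Circle × Y),
      I.val (fun x => mkG (q x.1 x.2) (hq x.1 x.2)) =
        I.val (fun x => mkG (a x.2 + (x.1 : ℂ) • b x.2) (hab x.1 x.2)) := by
  induction D generalizing ι with
  | zero =>
    obtain ⟨c, hc, h⟩ := h
    refine ⟨ι, inferInstance, inferInstance, c, fun _ => 0, hc, continuous_const, fun z y => ?_, fun I => ?_⟩
    · simpa [← h z y] using hq z y
    · congr; funext x; ext1; simp [h]
  | succ D ih =>
    obtain ⟨c, hc, r, hr, h⟩ := h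
    rcases D with _ | D
    · obtain ⟨b, hb, h'⟩ := hr
      refine ⟨ι, inferInstance, inferInstance, c, b, hc, hb, fun z y => ?_, fun I => ?_⟩
      · simpa only [h', h] using hq z y
      · congr; funext x; ext1; simp [h, h']
    obtain ⟨r0, hr0, r1, hr1, h'⟩ := hr
    set q' : Circle → Y → Matrix (ι ⊕ ι) (ι ⊕ ι) ℂ := fun z y =>
      Matrix.fromBlocks (c y) (-(z : ℂ) • 1) (r z y) 1 with hq'
    have e : ∀ z y, Matrix.fromBlocks (q z y) 0 0 1 =
        (upU (ι := ι) (κ := ι) ((z : ℂ) • 1)).val * q' z y *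
        (lowU (ι := ι) (κ := ι) (-(r z y))).val := fun z y => by
      simp [upU, lowU, hq', Matrix.fromBlocks_multiply, h]
    have hq'u : ∀ z y, IsUnit (q' z y) := fun z y => by
      have h1 : IsUnit (Matrix.fromBlocks (q z y) 0 0 (1 : Matrix ι ι ℂ)) :=
        (dsum (mkG _ (hq z y)) 1).isUnit
      rw [e, Units.isUnit_mul_units, Units.isUnit_units_mul] at h1
      exact h1
    have hP : PolyZ (D + 1) q' := by
      refine ⟨fun y => Matrix.fromBlocks (c y) 0 (r0 y) 1, by
        exact hc.matrix_fromBlocks continuous_const hr0 continuous_const, fun z y =>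
        Matrix.fromBlocks 0 (-1) (r1 z y) 0, ?_, fun z y => ?_⟩
      · have h2 := PolyZ.fromBlocks hr1 (fun _ => (-1 : Matrix ι ι ℂ)) (fun _ => (0 : Matrix ι ι ℂ))
          (fun _ => (0 : Matrix ι ι ℂ)) continuous_const continuous_const continuous_const
        clear * - h2
        have : ∀ (D : ℕ) (q : Circle → Y → Matrix (ι ⊕ ι) (ι ⊕ ι) ℂ), PolyZ D q →
            PolyZ D (fun z y => (q z y).submatrix id Sum.swap) := by
          intro D
          induction D with
          | zero =>
            rintro q ⟨c, hc, h⟩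
            exact ⟨_, hc.matrix_submatrix id Sum.swap, fun z y => by simp only [h]⟩
          | succ D ih =>
            rintro q ⟨c, hc, r, hr, h⟩
            exact ⟨_, hc.matrix_submatrix id Sum.swap, _, ih _ hr, fun z y => by simp only [h]; rfl⟩
        have h3 := this _ _ h2
        convert h3 using 3 with z y
        ext i j
        rcases i with i | i <;> rcases j with j | j <;> simp
      · simp [hq', h', Matrix.fromBlocks_smul, Matrix.fromBlocks_add]
    obtain ⟨κ, i1, i2, a, b, ha, hb, hab, H⟩ := ih q' hP hq'u
    refine ⟨κ, i1, i2, a, b, ha, hb, hab, fun I => ?_⟩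
    rw [← H I]
    have hqc : Continuous fun x : Circle × Y => mkG (q x.1 x.2) (hq x.1 x.2) := by
      rw [continuous_G_iff]
      exact PolyZ.continuous (D := D + 2) ⟨c, hc, r, ⟨r0, hr0, r1, hr1, h'⟩, h⟩
    have hq'c : Continuous fun x : Circle × Y => mkG (q' x.1 x.2) (hq'u x.1 x.2) := by
      rw [continuous_G_iff]
      exact PolyZ.continuous hP
    have hrc : Continuous fun x : Circle × Y => r x.1 x.2 :=
      PolyZ.continuous (D := D + 1) ⟨r0, hr0, r1, hr1, h'⟩
    have huc : Continuous fun x : Circle × Y => upU (ι := ι) (κ := ι) ((x.1 : ℂ) • 1) := by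
      rw [continuous_G_iff]
      exact Continuous.matrix_fromBlocks (by fun_prop) (by fun_prop) (by fun_prop) (by fun_prop)
    have hlc : Continuous fun x : Circle × Y => lowU (ι := ι) (κ := ι) (-(r x.1 x.2)) := by
      rw [continuous_G_iff]
      exact Continuous.matrix_fromBlocks (by fun_prop) (by fun_prop) (by fun_prop) (by fun_prop)
    rw [← I.sum_one (κ := ι) _ hqc]
    have : (fun x : Circle × Y => dsum (mkG (q x.1 x.2) (hq x.1 x.2)) (1 : G ι)) = fun x =>
        upU ((x.1 : ℂ) • 1) * mkG (q' x.1 x.2) (hq'u x.1 x.2) * lowU (-(r x.1 x.2)) := by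
      funext x; ext1
      rw [dsum_val, Units.val_mul, Units.val_mul]
      exact e x.1 x.2
    rw [this, I.mul (fun x => upU ((x.1 : ℂ) • 1) * mkG (q' x.1 x.2) (hq'u x.1 x.2)) _
      (huc.mul hq'c) hlc, I.mul _ _ huc hq'c, I.upU_eq _ (by fun_prop), I.lowU_eq _ (by fun_prop)]
    ring

end Linear
end UnitaryCommutator

open scoped Matrix
open Filter Topology

namespace UnitaryCommutator

section Spectral
variable {ι : Type} [Fintype ι] [DecidableEq ι]

/-- Abstract Laurent coefficients of the resolvent `(1 + (z - 1) c)⁻¹`. -/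
structure LaurentData (c : Matrix ι ι ℂ) (R : ℤ → Matrix ι ι ℂ) : Prop where
  comm : ∀ j, c * R j = R j * c
  rec_ne : ∀ j, j ≠ 0 → (1 - c) * R j + c * R (j - 1) = 0
  rec_zero : (1 - c) * R 0 + c * R (-1) = 1
  top : Tendsto (fun k : ℕ => R k) atTop (𝓝 0)
  bot : Tendsto (fun k : ℕ => R (-1 - k)) atTop (𝓝 0)

namespace LaurentData
variable {c : Matrix ι ι ℂ} {R : ℤ → Matrix ι ι ℂ}

theorem const (h : LaurentData c R) (k : ℕ) : c * (1 - c) * (R (-1 - k) * R k) = c * (1 - c) * (R (-1) * R 0) := by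
  induction k with
  | zero => simp
  | succ k ih =>
    rw [← ih]
    have h1 := h.rec_ne (k + 1) (by omega)
    have h2 := h.rec_ne (-1 - k) (by omega)
    have e1 : ((k : ℤ) + 1 - 1) = k := by ring
    have e2 : (-1 - (k : ℤ) - 1) = -1 - ((k + 1 : ℕ) : ℤ) := by push_cast; ring
    rw [e1] at h1
    rw [e2] at h2
    push_cast at h2 ⊢
    have h1' := eq_neg_of_add_eq_zero_left h1
    have h2' := eq_neg_of_add_eq_zero_right h2
    have hc : ∀ j, (1 - c) * R j = R j * (1 - c) := fun j => by
      rw [sub_mul, mul_sub, h.comm]; simp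
    calc c * (1 - c) * (R (-1 - (k + 1)) * R (k + 1))
        = (c * R (-1 - (k + 1))) * ((1 - c) * R (k + 1)) := by
          rw [mul_assoc, ← mul_assoc (1 - c), hc]; simp only [mul_assoc]
      _ = ((1 - c) * R (-1 - k)) * (c * R k) := by rw [h1', h2', neg_mul_neg]
      _ = (1 - c) * c * (R (-1 - k) * R k) := by
          rw [mul_assoc, ← mul_assoc (R _), ← h.comm]; simp only [mul_assoc]
      _ = _ := by rw [show (1 - c) * c = c * (1 - c) by rw [sub_mul, mul_sub]; simp]

theorem idem (h : LaurentData c R) : (c * R (-1)) * (c * R (-1)) = c * R (-1) := by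
  have ht : Tendsto (fun k : ℕ => c * (1 - c) * (R (-1 - k) * R k)) atTop
      (𝓝 (c * (1 - c) * (0 * 0))) := tendsto_const_nhds.mul (h.bot.mul h.top)
  simp only [h.const, mul_zero] at ht
  have h0 := tendsto_nhds_unique tendsto_const_nhds ht
  have h1 : (c * R (-1)) * ((1 - c) * R 0) = 0 := by
    rw [← h0, mul_assoc, ← mul_assoc (R (-1)), mul_sub, mul_one, ← h.comm]
    simp only [mul_assoc, sub_mul, mul_sub, one_mul]
  have h2 := h.rec_zero
  rw [eq_sub_of_add_eq h2, mul_sub, mul_one, sub_eq_zero] at h1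
  exact h1.symm

theorem comm_idem (h : LaurentData c R) : c * (c * R (-1)) = (c * R (-1)) * c := by
  rw [mul_assoc, h.comm]

theorem eig_rec (h : LaurentData c R) (v : ι → ℂ) (ν : ℂ) (hv : c *ᵥ v = ν • v) (j : ℤ) (hj : j ≠ 0) :
    (1 - ν) • R j *ᵥ v + ν • R (j - 1) *ᵥ v = 0 := by
  have := congrArg (· *ᵥ v) (h.rec_ne j hj)
  simp only [Matrix.add_mulVec, Matrix.zero_mulVec, sub_mul, one_mul, Matrix.sub_mulVec, h.comm] at this
  simp only [← Matrix.mulVec_mulVec, hv, Matrix.mulVec_smul] at this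
  rw [sub_smul, one_smul]; exact this

theorem mulVec_idem (h : LaurentData c R) (v : ι → ℂ) (ν : ℂ) (hv : c *ᵥ v = ν • v) :
    (c * R (-1)) *ᵥ v = ν • R (-1) *ᵥ v := by
  rw [h.comm, ← Matrix.mulVec_mulVec, hv, Matrix.mulVec_smul]

theorem norm_lt_of_fix (h : LaurentData c R) (v : ι → ℂ) (ν : ℂ) (hv : c *ᵥ v = ν • v) (hv0 : v ≠ 0)
    (hp : (c * R (-1)) *ᵥ v = v) : ‖1 - ν‖ < ‖ν‖ := by
  rw [h.mulVec_idem v ν hv] at hp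
  have hν : ν ≠ 0 := by rintro rfl; simp at hp; exact hv0 hp.symm
  have key : ∀ k : ℕ, R (-1 - k) *ᵥ v = ((-(1 - ν) / ν) ^ k * ν⁻¹) • v := by
    intro k
    induction k with
    | zero => 
      conv_rhs => rw [← hp]
      simp [smul_smul, hν]
    | succ k ih =>
      have h1 := h.eig_rec v ν hv (-1 - k) (by omega)
      rw [ih] at h1
      have e2 : (-1 - (k : ℤ) - 1) = -1 - ((k + 1 : ℕ) : ℤ) := by push_cast; ring
      rw [e2] at h1
      have h2 := eq_neg_of_add_eq_zero_right h1
      rw [← inv_smul_smul₀ hν (R (-1 - ((k + 1 : ℕ) : ℤ)) *ᵥ v), h2, ← smul_neg]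
      simp only [smul_smul, ← neg_smul, smul_neg]
      congr 1
      rw [pow_succ]
      generalize (-(1 - ν) / ν) ^ k = t
      field_simp
  by_contra hle
  push Not at hle
  have ht : Tendsto (fun k : ℕ => R (-1 - k) *ᵥ v) atTop (𝓝 0) := by
    have hcont : Continuous fun M : Matrix ι ι ℂ => M *ᵥ v := by fun_prop
    have := (hcont.tendsto 0).comp h.bot
    rw [Matrix.zero_mulVec] at this; exact this
  obtain ⟨a, ha⟩ := Function.ne_iff.1 hv0
  have ht2 := ((tendsto_pi_nhds.1 ht) a).norm
  simp only [key, Pi.smul_apply, smul_eq_mul, norm_mul, norm_pow, Pi.zero_apply, norm_zero] at ht2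
  have hge : ∀ k : ℕ, ‖ν⁻¹‖ * ‖v a‖ ≤ ‖-(1 - ν) / ν‖ ^ k * ‖ν⁻¹‖ * ‖v a‖ := fun k => by
    rw [mul_assoc]
    refine le_mul_of_one_le_left (by positivity) (one_le_pow₀ ?_)
    rw [norm_div, norm_neg, le_div_iff₀ (norm_pos_iff.2 hν), one_mul]; exact hle
  have := ge_of_tendsto' ht2 hge
  have hpos : 0 < ‖ν⁻¹‖ * ‖v a‖ := mul_pos (by simpa using hν) (by simpa using ha)
  linarith

theorem norm_lt_of_kill (h : LaurentData c R) (v : ι → ℂ) (ν : ℂ) (hv : c *ᵥ v = ν • v) (hv0 : v ≠ 0)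
    (hp : (c * R (-1)) *ᵥ v = 0) : ‖ν‖ < ‖1 - ν‖ := by
  have h0 : (1 - ν) • R 0 *ᵥ v = v := by
    have := congrArg (· *ᵥ v) (h.rec_zero)
    simp only [Matrix.add_mulVec, hp, sub_mul, one_mul, Matrix.sub_mulVec, h.comm,
      Matrix.one_mulVec] at this
    rw [← h.comm (-1), hp, add_zero, ← Matrix.mulVec_mulVec, hv, Matrix.mulVec_smul] at this
    rw [sub_smul, one_smul]; exact this
  have hν : 1 - ν ≠ 0 := by intro hh; rw [hh] at h0; simp at h0; exact hv0 h0.symm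
  have key : ∀ k : ℕ, R k *ᵥ v = ((-ν / (1 - ν)) ^ k * (1 - ν)⁻¹) • v := by
    intro k
    induction k with
    | zero =>
      conv_rhs => rw [← h0]
      simp [smul_smul, hν]
    | succ k ih =>
      have h1 := h.eig_rec v ν hv (k + 1) (by omega)
      have e1 : ((k : ℤ) + 1 - 1) = k := by ring
      rw [e1, ih] at h1
      have h2 := eq_neg_of_add_eq_zero_left h1
      push_cast
      rw [← inv_smul_smul₀ hν (R ((k : ℤ) + 1) *ᵥ v), h2, ← smul_neg]
      simp only [smul_smul, ← neg_smul, smul_neg]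
      congr 1
      rw [pow_succ]
      generalize (-ν / (1 - ν)) ^ k = t
      field_simp
  by_contra hle
  push Not at hle
  have ht : Tendsto (fun k : ℕ => R k *ᵥ v) atTop (𝓝 0) := by
    have hcont : Continuous fun M : Matrix ι ι ℂ => M *ᵥ v := by fun_prop
    have := (hcont.tendsto 0).comp h.top
    rw [Matrix.zero_mulVec] at this; exact this
  obtain ⟨a, ha⟩ := Function.ne_iff.1 hv0
  have ht2 := ((tendsto_pi_nhds.1 ht) a).norm
  simp only [key, Pi.smul_apply, smul_eq_mul, norm_mul, norm_pow, Pi.zero_apply, norm_zero] at ht2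
  have hge : ∀ k : ℕ, ‖(1 - ν)⁻¹‖ * ‖v a‖ ≤ ‖-ν / (1 - ν)‖ ^ k * ‖(1 - ν)⁻¹‖ * ‖v a‖ := fun k => by
    rw [mul_assoc]
    refine le_mul_of_one_le_left (by positivity) (one_le_pow₀ ?_)
    rw [norm_div, norm_neg, le_div_iff₀ (norm_pos_iff.2 hν), one_mul]; exact hle
  have := ge_of_tendsto' ht2 hge
  have hpos : 0 < ‖(1 - ν)⁻¹‖ * ‖v a‖ := mul_pos (by simpa using hν) (by simpa using ha)
  linarith

theorem re_gt {ν : ℂ} (h : ‖1 - ν‖ < ‖ν‖) : 1 / 2 < ν.re := by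
  have h2 : ‖1 - ν‖ ^ 2 < ‖ν‖ ^ 2 := by gcongr
  simp only [← Complex.normSq_eq_norm_sq, Complex.normSq_apply] at h2
  simp at h2
  nlinarith

theorem re_lt {ν : ℂ} (h : ‖ν‖ < ‖1 - ν‖) : ν.re < 1 / 2 := by
  have h2 : ‖ν‖ ^ 2 < ‖1 - ν‖ ^ 2 := by gcongr
  simp only [← Complex.normSq_eq_norm_sq, Complex.normSq_apply] at h2
  simp at h2
  nlinarith

theorem re_of_circle {z : Circle} {μ : ℂ} (h : 1 + ((z : ℂ) - 1) * μ = 0) : μ.re = 1 / 2 := by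
  have h1 : (z : ℂ) * μ = μ - 1 := by linear_combination h
  have h2 := congrArg (fun x => ‖x‖ ^ 2) h1
  simp only [norm_mul, Circle.norm_coe, one_mul] at h2
  simp only [← Complex.normSq_eq_norm_sq, Complex.normSq_apply] at h2
  simp at h2
  nlinarith

theorem isUnit_path (h : LaurentData c R) (z : Circle) (s : ℝ) (hs0 : 0 ≤ s) (hs1 : s ≤ 1) :
    IsUnit (1 + ((z : ℂ) - 1) • ((1 - s : ℂ) • c + (s : ℂ) • (c * R (-1)))) := by
  rw [Matrix.isUnit_iff_isUnit_det, isUnit_iff_ne_zero]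
  intro hdet
  obtain ⟨v, hv0, hv⟩ := Matrix.exists_mulVec_eq_zero_iff.2 hdet
  set p := c * R (-1) with hp
  set N := 1 + ((z : ℂ) - 1) • ((1 - s : ℂ) • c + (s : ℂ) • p) with hN
  have hpc : c * p = p * c := h.comm_idem
  have hpN : N * p = p * N := by
    simp only [hN, mul_add, add_mul, one_mul, mul_one, Matrix.smul_mul, Matrix.mul_smul, hpc]
  have hpp : p * p = p := h.idem
  have hpv : N *ᵥ (p *ᵥ v) = 0 := by
    rw [Matrix.mulVec_mulVec, hpN, ← Matrix.mulVec_mulVec, hv, Matrix.mulVec_zero]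
  have expand : ∀ w : ι → ℂ, N *ᵥ w = w + ((z : ℂ) - 1) • ((1 - s : ℂ) • c *ᵥ w + (s : ℂ) • p *ᵥ w) := by
    intro w
    simp [hN, Matrix.add_mulVec, Matrix.smul_mulVec]
  -- reduce to a vector on which `p` acts by a scalar `0` or `1`
  have main : ∀ (w : ι → ℂ) (e : ℝ), (e = 0 ∨ e = 1) → p *ᵥ w = (e : ℂ) • w → N *ᵥ w = 0 → w = 0 := by
    intro w e he hpw hNw
    by_contra hw0
    rw [expand, hpw] at hNw
    by_cases hz : (z : ℂ) - 1 = 0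
    · simp [hz] at hNw; exact hw0 hNw
    by_cases hs : (1 - s : ℂ) = 0
    · rw [hs, zero_smul, zero_add, smul_smul, smul_smul] at hNw
      have hs' : (s : ℂ) = 1 := by linear_combination -hs
      rw [hs', mul_one] at hNw
      have h3 : (1 + ((z : ℂ) - 1) * e) • w = 0 := by rw [add_smul, one_smul]; exact hNw
      rw [smul_eq_zero_iff_left hw0] at h3
      rcases he with rfl | rfl
      · simp at h3
      · simp at h3
    have hcw : c *ᵥ w = (-(1 + ((z : ℂ) - 1) * (s * e)) / ((1 - s) * ((z : ℂ) - 1))) • w := by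
      rw [div_eq_inv_mul, mul_smul, eq_inv_smul_iff₀ (mul_ne_zero hs hz), neg_smul, eq_neg_iff_add_eq_zero, ← hNw,
        add_smul, one_smul, smul_add, smul_smul, smul_smul, smul_smul, mul_comm ((z : ℂ) - 1) (1 - s), mul_assoc]
      abel
    set ν := -(1 + ((z : ℂ) - 1) * (s * e)) / ((1 - s) * ((z : ℂ) - 1)) with hν
    have hrel : 1 + ((z : ℂ) - 1) * ((1 - s) * ν + s * e) = 0 := by
      rw [hν]; field_simp; ring
    have hre := re_of_circle hrel
    have hre' : (1 - s) * ν.re + s * e = 1 / 2 := by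
      have : ((1 - s : ℂ) * ν + s * e).re = (1 - s) * ν.re + s * e := by
        rw [show (1 - s : ℂ) = ((1 - s : ℝ) : ℂ) by push_cast; rfl, ← Complex.ofReal_mul,
          Complex.add_re, Complex.re_ofReal_mul, Complex.ofReal_re]
      rw [← this]; exact hre
    have hs1' : 0 < 1 - s := by
      rcases hs1.lt_or_eq with h1 | h1
      · linarith
      · exact absurd (by rw [h1]; simp) hs
    rcases he with rfl | rfl
    · have := re_lt (h.norm_lt_of_kill w ν hcw hw0 (by rw [hpw]; simp))
      nlinarith
    · have := re_gt (h.norm_lt_of_fix w ν hcw hw0 (by rw [hpw]; simp))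
      nlinarith
  have h1 := main (p *ᵥ v) 1 (Or.inr rfl) (by rw [Matrix.mulVec_mulVec, hpp]; simp) hpv
  exact hv0 (main v 0 (Or.inl rfl) (by rw [h1]; simp) hv)

end LaurentData

/-- Fourier coefficients of functions on the circle. -/
noncomputable def fcoef (f : Circle → ℂ) (j : ℤ) : ℂ :=
  ∫ v in (0 : ℝ)..1, (((Real.fourierChar v) ^ (-j) : Circle) : ℂ) * f (Real.fourierChar v)

theorem continuous_fourierChar : Continuous (fun v => Real.fourierChar v) := Real.continuous_fourierChar

theorem fcoef_intble (f : Circle → ℂ) (hf : Continuous f) (j : ℤ) :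
    IntervalIntegrable (fun v => (((Real.fourierChar v) ^ (-j) : Circle) : ℂ) * f (Real.fourierChar v))
      MeasureTheory.volume 0 1 := by
  apply Continuous.intervalIntegrable
  have h1 := continuous_fourierChar
  have h2 : Continuous fun v : ℝ => Real.fourierChar v ^ (-j) := h1.zpow _
  have h3 : Continuous fun z : Circle => (z : ℂ) := by fun_prop
  exact (h3.comp h2).mul (hf.comp h1)

theorem fcoef_sum {α : Type} (s : Finset α) (f : α → Circle → ℂ) (hf : ∀ a, Continuous (f a)) (j : ℤ) :
    fcoef (fun z => ∑ a ∈ s, f a z) j = ∑ a ∈ s, fcoef (f a) j := by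
  simp only [fcoef, Finset.mul_sum]
  exact intervalIntegral.integral_finsetSum fun a _ => fcoef_intble _ (hf a) j

theorem fcoef_add (f g : Circle → ℂ) (hf : Continuous f) (hg : Continuous g) (j : ℤ) :
    fcoef (fun z => f z + g z) j = fcoef f j + fcoef g j := by
  simp only [fcoef, mul_add]
  exact intervalIntegral.integral_add (fcoef_intble _ hf j) (fcoef_intble _ hg j)

theorem fcoef_const_mul (c : ℂ) (f : Circle → ℂ) (j : ℤ) : fcoef (fun z => c * f z) j = c * fcoef f j := by
  simp only [fcoef, mul_left_comm _ c]
  exact intervalIntegral.integral_const_mul _ _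

theorem fcoef_shift (f : Circle → ℂ) (j : ℤ) : fcoef (fun z => (z : ℂ) * f z) j = fcoef f (j - 1) := by
  simp only [fcoef]
  congr; funext v
  rw [← mul_assoc, ← Circle.coe_mul, ← zpow_add_one]
  congr 3; ring

theorem fcoef_const (c : ℂ) (j : ℤ) : fcoef (fun _ => c) j = if j = 0 then c else 0 := by
  split_ifs with h
  · subst h; simp [fcoef]
  · have := fcoef_const_mul c (fun _ => 1) j
    simp only [mul_one] at this
    rw [this]
    convert mul_zero c
    simp only [fcoef, mul_one]
    have hj : (-j : ℂ) * (2 * Real.pi * Complex.I) ≠ 0 := by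
      simp [h, Real.pi_ne_zero]
    have e : ∀ v : ℝ, (((Real.fourierChar v) ^ (-j) : Circle) : ℂ) =
        Complex.exp ((-j : ℂ) * (2 * Real.pi * Complex.I) * v) := fun v => by
      rw [Circle.coe_zpow, Real.fourierChar_apply, ← Complex.exp_int_mul]
      congr 1; push_cast; ring
    simp only [e]
    rw [integral_exp_mul_complex hj]
    have : Complex.exp ((-j : ℂ) * (2 * Real.pi * Complex.I)) = 1 := by
      have := Complex.exp_int_mul_two_pi_mul_I (-j)
      push_cast at this; exact this
    rw [Complex.ofReal_one, Complex.ofReal_zero, mul_one, mul_zero, this, Complex.exp_zero, sub_self, zero_div]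

theorem fcoef_tendsto (f : Circle → ℂ) (u : ℕ → ℤ) (hu : Tendsto u atTop (cocompact ℤ)) :
    Tendsto (fun k => fcoef f (u k)) atTop (𝓝 0) := by
  have h := Real.tendsto_integral_exp_smul_cocompact
    (Set.indicator (Set.Ioc 0 1) fun v => f (Real.fourierChar v))
  have h2 := h.comp (Int.isClosedEmbedding_coe_real.tendsto_cocompact.comp hu)
  refine h2.congr fun k => ?_
  simp only [Function.comp, fcoef]
  rw [intervalIntegral.integral_of_le zero_le_one, ← MeasureTheory.integral_indicator measurableSet_Ioc]
  congr; funext v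
  by_cases hv : v ∈ Set.Ioc (0 : ℝ) 1
  · simp only [Set.indicator_of_mem hv, Circle.smul_def, smul_eq_mul]
    congr 2
    rw [← AddChar.map_zsmul_eq_zpow]
    congr 1
    simp; ring
  · simp [Set.indicator_of_notMem hv]

/-- Entrywise Fourier coefficients of a matrix function on the circle. -/
noncomputable def mfc (r : Circle → Matrix ι ι ℂ) (j : ℤ) : Matrix ι ι ℂ :=
  Matrix.of fun a b => fcoef (fun z => r z a b) j

theorem LaurentData.of_resolvent (c : Matrix ι ι ℂ) (r : Circle → Matrix ι ι ℂ) (hr : Continuous r)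
    (hr1 : ∀ z : Circle, (1 - c) * r z + (z : ℂ) • (c * r z) = 1)
    (hcomm : ∀ z, c * r z = r z * c) : LaurentData c (mfc r) := by
  have hrent : ∀ a b, Continuous fun z => r z a b := fun a b => hr.matrix_elem a b
  have hmc : Continuous fun z : Circle => (z : ℂ) := by fun_prop
  have hlim : ∀ u : ℕ → ℤ, Function.Injective u → Tendsto (fun k => mfc r (u k)) atTop (𝓝 0) := by
    intro u hu
    have hc : Tendsto u atTop (cocompact ℤ) := by
      rw [cocompact_eq_cofinite]
      exact hu.tendsto_cofinite.mono_left Nat.cofinite_eq_atTop.ge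
    have h0 : Tendsto (fun k (a b : ι) => fcoef (fun z => r z a b) (u k)) atTop
        (𝓝 (fun _ _ => 0)) := by
      rw [tendsto_pi_nhds]
      intro a
      rw [tendsto_pi_nhds]
      intro b
      exact fcoef_tendsto (fun z => r z a b) u hc
    exact h0
  have hrec : ∀ j : ℤ, (1 - c) * mfc r j + c * mfc r (j - 1) = if j = 0 then 1 else 0 := fun j => by
    ext a d
    have h1 : ∀ z : Circle, (∑ b, (1 - c) a b * r z b d) + (∑ b, c a b * ((z : ℂ) * r z b d)) =
        (1 : Matrix ι ι ℂ) a d := fun z => by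
      have := congrFun (congrFun (hr1 z) a) d
      simp only [Matrix.add_apply, Matrix.mul_apply, Matrix.smul_apply, smul_eq_mul,
        Finset.mul_sum] at this
      simp only [← this, mul_left_comm]
    have h2 := congrArg (fun f => fcoef f j) (funext h1)
    rw [fcoef_add _ _ (continuous_finsetSum _ fun b _ => by have := hrent b d; fun_prop)
      (continuous_finsetSum _ fun b _ => by have := hrent b d; fun_prop),
      fcoef_sum _ _ (fun b => by have := hrent b d; fun_prop),
      fcoef_sum _ _ (fun b => by have := hrent b d; fun_prop), fcoef_const] at h2
    simp only [fcoef_const_mul, fcoef_shift] at h2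
    simp only [mfc, Matrix.add_apply, Matrix.mul_apply, Matrix.of_apply, h2]
    split_ifs <;> rfl
  refine ⟨fun j => ?_, fun j hj => ?_, ?_, ?_, ?_⟩
  · ext a d
    have h1 : ∀ z, (∑ b, c a b * r z b d) = ∑ b, c b d * r z a b := fun z => by
      have := congrFun (congrFun (hcomm z) a) d
      simp only [Matrix.mul_apply] at this
      simp only [this, mul_comm]
    have h2 := congrArg (fun f => fcoef f j) (funext h1)
    rw [fcoef_sum _ _ (fun b => by have := hrent b d; fun_prop),
      fcoef_sum _ _ (fun b => by have := hrent a b; fun_prop)] at h2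
    simp only [fcoef_const_mul] at h2
    simp only [mfc, Matrix.mul_apply, Matrix.of_apply, h2, mul_comm]
  · simpa [hj] using hrec j
  · simpa using hrec 0
  · exact hlim _ fun x y h => by simpa using h
  · exact hlim _ fun x y h => by simpa using h

/-- The resolvent. -/
noncomputable def resolv {Y : Type} (c : Y → Matrix ι ι ℂ)
    (hu : ∀ (z : Circle) y, IsUnit (1 + ((z : ℂ) - 1) • c y)) (z : Circle) (y : Y) : Matrix ι ι ℂ :=
  ((mkG _ (hu z y))⁻¹ : G ι).val

theorem continuous_resolv {Y : Type} [TopologicalSpace Y] (c : Y → Matrix ι ι ℂ) (hc : Continuous c)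
    (hu : ∀ (z : Circle) y, IsUnit (1 + ((z : ℂ) - 1) • c y)) :
    Continuous fun x : Circle × Y => resolv c hu x.1 x.2 := by
  have : Continuous fun x : Circle × Y => mkG _ (hu x.1 x.2) := by
    rw [continuous_G_iff]; simp only [mkG_val]; fun_prop
  exact continuous_G_val this.inv

theorem resolv_laurent {Y : Type} [TopologicalSpace Y] (c : Y → Matrix ι ι ℂ) (hc : Continuous c)
    (hu : ∀ (z : Circle) y, IsUnit (1 + ((z : ℂ) - 1) • c y)) (y : Y) :
    LaurentData (c y) (mfc fun z => resolv c hu z y) := by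
  have hcont : Continuous fun z => resolv c hu z y := 
    Continuous.comp (g := fun x : Circle × Y => resolv c hu x.1 x.2)
      (f := fun z : Circle => (z, y)) (continuous_resolv c hc hu) (by fun_prop)
  refine .of_resolvent _ _ hcont (fun z => ?_) (fun z => ?_)
  · have h1 : (1 + ((z : ℂ) - 1) • c y) * resolv c hu z y = 1 := (mkG _ (hu z y)).mul_inv
    rw [add_mul, one_mul, Matrix.smul_mul, sub_smul, one_smul] at h1
    rw [sub_mul, one_mul, ← h1]
    abel
  · have h1 : Commute (c y) (mkG _ (hu z y)).val := by
      change c y * (1 + ((z : ℂ) - 1) • c y) = (1 + ((z : ℂ) - 1) • c y) * c y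
      simp [mul_add, add_mul]
    exact h1.units_inv_right

theorem exists_spectral {Y : Type} [TopologicalSpace Y] (c : Y → Matrix ι ι ℂ) (hc : Continuous c)
    (hu : ∀ (z : Circle) y, IsUnit (1 + ((z : ℂ) - 1) • c y)) :
    ∃ R : Y → ℤ → Matrix ι ι ℂ, (∀ j, Continuous fun y => R y j) ∧ ∀ y, LaurentData (c y) (R y) := by
  refine ⟨fun y => mfc fun z => resolv c hu z y, fun j => ?_, resolv_laurent c hc hu⟩
  refine continuous_matrix fun a b => ?_
  simp only [mfc, Matrix.of_apply, fcoef]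
  apply intervalIntegral.continuous_parametric_intervalIntegral_of_continuous'
  have h1 := continuous_fourierChar
  have h2 : Continuous fun p : Y × ℝ => resolv c hu (Real.fourierChar p.2) p.1 :=
    Continuous.comp (g := fun x : Circle × Y => resolv c hu x.1 x.2)
      (f := fun p : Y × ℝ => (Real.fourierChar p.2, p.1))
      (continuous_resolv c hc hu) (by fun_prop)
  have h3 := h2.matrix_elem a b
  have h4 : Continuous fun v : ℝ => Real.fourierChar v ^ (-j) := h1.zpow _
  have h5 : Continuous fun z : Circle => (z : ℂ) := by fun_prop
  have h6 : Continuous fun p : Y × ℝ => ((Real.fourierChar p.2 ^ (-j) : Circle) : ℂ) :=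
    h5.comp (h4.comp continuous_snd)
  exact h6.mul h3

end Spectral
end UnitaryCommutator

open scoped Matrix
open Filter Topology

namespace UnitaryCommutator

section Approx
variable {Y : Type} [TopologicalSpace Y]

/-- Evaluation at a point as a ring homomorphism. -/
noncomputable def evHom (y : Y) : C(Y, ℂ) →+* ℂ where
  toFun f := f y
  map_one' := rfl
  map_mul' _ _ := rfl
  map_zero' := rfl
  map_add' _ _ := rfl

/-- Functions that are Laurent polynomials in the circle variable. -/
noncomputable def laurentAlg (Y : Type) [TopologicalSpace Y] : StarSubalgebra ℂ C(Circle × Y, ℂ) where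
  carrier := {f | ∃ (k : ℕ) (P : Polynomial C(Y, ℂ)), ∀ (z : Circle) (y : Y),
    (z : ℂ) ^ k * f (z, y) = P.eval₂ (evHom y) z}
  mul_mem' := by
    rintro f g ⟨k, P, h⟩ ⟨l, Q, h'⟩
    refine ⟨k + l, P * Q, fun z y => ?_⟩
    rw [Polynomial.eval₂_mul, ← h, ← h', ContinuousMap.mul_apply, pow_add]; ring
  one_mem' := ⟨0, 1, fun z y => by simp⟩
  add_mem' := by
    rintro f g ⟨k, P, h⟩ ⟨l, Q, h'⟩
    refine ⟨k + l, Polynomial.X ^ l * P + Polynomial.X ^ k * Q, fun z y => ?_⟩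
    rw [Polynomial.eval₂_add, Polynomial.eval₂_mul, Polynomial.eval₂_mul, ← h, ← h',
      ContinuousMap.add_apply, pow_add, Polynomial.eval₂_X_pow, Polynomial.eval₂_X_pow]; ring
  zero_mem' := ⟨0, 0, fun z y => by simp⟩
  algebraMap_mem' c := ⟨0, Polynomial.C (algebraMap ℂ _ c), fun z y => by
    rw [Polynomial.eval₂_C, pow_zero, one_mul]; rfl⟩
  star_mem' := by
    rintro f ⟨k, P, h⟩
    refine ⟨P.natDegree, ∑ i ∈ Finset.range (P.natDegree + 1),
      Polynomial.C (star (P.coeff i)) * Polynomial.X ^ (P.natDegree + k - i), fun z y => ?_⟩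
    have h1 := congrArg (starRingEnd ℂ) (h z y)
    rw [Polynomial.eval₂_eq_sum_range, map_mul, map_pow, map_sum] at h1
    have hz : (z : ℂ) * (starRingEnd ℂ) z = 1 := by
      rw [Complex.mul_conj, Circle.normSq_coe]; simp
    have hzp : ∀ n : ℕ, (z : ℂ) ^ n * (starRingEnd ℂ) z ^ n = 1 := fun n => by
      rw [← mul_pow, hz, one_pow]
    rw [ContinuousMap.star_apply, Polynomial.eval₂_finsetSum]
    calc (z : ℂ) ^ P.natDegree * (starRingEnd ℂ) (f (z, y))
        = (z : ℂ) ^ (P.natDegree + k) * ((starRingEnd ℂ) z ^ k * (starRingEnd ℂ) (f (z, y))) := by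
          rw [pow_add]; linear_combination
            (-(z : ℂ) ^ P.natDegree * (starRingEnd ℂ) (f (z, y))) * hzp k
      _ = _ := by
        rw [h1, Finset.mul_sum]
        refine Finset.sum_congr rfl fun i hi => ?_
        have hi' : i ≤ P.natDegree := by simpa [Nat.lt_succ_iff] using hi
        rw [Polynomial.eval₂_mul, Polynomial.eval₂_C, Polynomial.eval₂_X_pow, map_mul, map_pow]
        have e : (z : ℂ) ^ (P.natDegree + k) = z ^ (P.natDegree + k - i) * z ^ i := by
          rw [← pow_add]; congr 1; omega
        rw [e]
        have e2 : (evHom y) (star (P.coeff i)) = (starRingEnd ℂ) ((evHom y) (P.coeff i)) := rfl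
        rw [e2]
        linear_combination ((z : ℂ) ^ (P.natDegree + k - i) *
          (starRingEnd ℂ) ((evHom y) (P.coeff i))) * hzp i

theorem laurentAlg_dense [CompactSpace Y] [T2Space Y] : (laurentAlg Y).topologicalClosure = ⊤ := by
  apply ContinuousMap.starSubalgebra_topologicalClosure_eq_top_of_separatesPoints
  rintro ⟨z, y⟩ ⟨w, x⟩ hne
  by_cases hzw : z = w
  · have hyx : y ≠ x := fun h => hne (by rw [hzw, h])
    obtain ⟨q, hq, hyxq⟩ : ∃ q : Y → ℂ, Continuous q ∧ q y ≠ q x := by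
      obtain ⟨q, hq, h⟩ := separatesPoints_continuous_of_t35Space hyx
      exact ⟨fun y => q y, Complex.continuous_ofReal.comp hq, by simpa using h⟩
    refine ⟨fun p => q p.2, ⟨⟨fun p => q p.2, by fun_prop⟩, ⟨0, Polynomial.C ⟨q, hq⟩, fun z y => ?_⟩, rfl⟩, hyxq⟩
    rw [Polynomial.eval₂_C, pow_zero, one_mul]; rfl
  · refine ⟨fun p => p.1, ⟨⟨fun p => p.1, by fun_prop⟩, ⟨0, Polynomial.X, fun z y => ?_⟩, rfl⟩, ?_⟩
    · simp
    · simpa [Circle.ext_iff] using hzw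

variable {ι : Type} [Fintype ι] [DecidableEq ι]

theorem exists_polyZ [CompactSpace Y] [T2Space Y] (g : Circle × Y → G ι) (hg : Continuous g) :
    ∃ (D k : ℕ) (q : Circle → Y → Matrix ι ι ℂ) (_ : PolyZ D q) (hq : ∀ z y, IsUnit (q z y)),
      ∀ I : Inv (Circle × Y), I.val g = I.val (fun x => mkG (q x.1 x.2) (hq x.1 x.2)) -
        k * I.val (fun x => cs ι x.1) := by
  obtain ⟨ε, hε, H⟩ := exists_close_invertible g hg
  have happ : ∀ a b, ∃ h ∈ laurentAlg Y, ∀ x, ‖h x - (g x : Matrix ι ι ℂ) a b‖ < ε := fun a b => by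
    let f : C(Circle × Y, ℂ) := ⟨fun x => (g x : Matrix ι ι ℂ) a b, (continuous_G_val hg).matrix_elem a b⟩
    have hf : f ∈ (laurentAlg Y).topologicalClosure := by rw [laurentAlg_dense]; trivial
    obtain ⟨h, hh, hd⟩ := Metric.mem_closure_iff.1 hf ε hε
    refine ⟨h, hh, fun x => ?_⟩
    rw [← dist_eq_norm, dist_comm]
    exact (ContinuousMap.dist_apply_le_dist x).trans_lt hd
  choose h hh hhε using happ
  choose k P hP using hh
  set K := ∑ a, ∑ b, k a b with hK
  have hkK : ∀ a b, k a b ≤ K := fun a b =>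
    (Finset.single_le_sum (f := fun b => k a b) (fun _ _ => Nat.zero_le _) (Finset.mem_univ b)).trans
      (Finset.single_le_sum (f := fun a => ∑ b, k a b) (fun _ _ => Nat.zero_le _) (Finset.mem_univ a))
  set Q : ι → ι → Polynomial C(Y, ℂ) := fun a b => Polynomial.X ^ (K - k a b) * P a b with hQ
  set D := ∑ a, ∑ b, (Q a b).natDegree with hD
  have hdD : ∀ a b, (Q a b).natDegree < D + 1 := fun a b => Nat.lt_succ_of_le <|
    (Finset.single_le_sum (f := fun b => (Q a b).natDegree) (fun _ _ => Nat.zero_le _) (Finset.mem_univ b)).trans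
      (Finset.single_le_sum (f := fun a => ∑ b, (Q a b).natDegree) (fun _ _ => Nat.zero_le _) (Finset.mem_univ a))
  set c : ℕ → Y → Matrix ι ι ℂ := fun j y => Matrix.of fun a b => (Q a b).coeff j y with hc
  have hpoly := PolyZ.sum D c (fun j => continuous_matrix fun a b => ((Q a b).coeff j).continuous)
  set q : Circle → Y → Matrix ι ι ℂ := fun z y => ∑ j ∈ Finset.range (D + 1), (z : ℂ) ^ j • c j y with hqd
  have hval : ∀ z y a b, q z y a b = (z : ℂ) ^ K * h a b (z, y) := fun z y a b => by
    have e : (z : ℂ) ^ K * h a b (z, y) = (Q a b).eval₂ (evHom y) z := by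
      rw [hQ, Polynomial.eval₂_mul, Polynomial.eval₂_X_pow, ← hP, ← mul_assoc, ← pow_add,
        Nat.sub_add_cancel (hkK a b)]
    rw [e, Polynomial.eval₂_eq_sum_range' _ (hdD a b), hqd]
    simp only [Matrix.sum_apply, Matrix.smul_apply, hc, Matrix.of_apply, smul_eq_mul]
    exact Finset.sum_congr rfl fun j _ => mul_comm _ _
  have hN : ∀ z y, q z y = (z : ℂ) ^ K • Matrix.of fun a b => h a b (z, y) := fun z y => by
    ext a b; simp [hval]
  have hu : ∀ x : Circle × Y, IsUnit (Matrix.of fun a b => h a b x) := fun x =>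
    H x _ fun a b => hhε a b x
  have hq : ∀ z y, IsUnit (q z y) := fun z y => by
    have h1 : q z y = ((cs ι z) ^ K * mkG _ (hu (z, y)) : G ι).val := by
      rw [hN, Units.val_mul, Units.val_pow_eq_pow_val, cs_val, mkG_val, smul_pow, one_pow, Matrix.smul_mul, one_mul]
    rw [h1]; exact Units.isUnit _
  refine ⟨D, K, q, hpoly, hq, fun I => ?_⟩
  have hhc : Continuous fun x => mkG _ (hu x) := by
    rw [continuous_G_iff]
    exact continuous_matrix fun a b => (h a b).continuous
  have h2 : I.val g = I.val fun x => mkG _ (hu x) := I.close _ _ hg hhc ε H fun x i j => hhε i j x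
  have h3 : (fun x : Circle × Y => mkG (q x.1 x.2) (hq x.1 x.2)) = fun x => (cs ι x.1) ^ K * mkG _ (hu x) := by
    funext x; ext1
    rw [mkG_val, hN, Units.val_mul, Units.val_pow_eq_pow_val, cs_val, mkG_val, smul_pow, one_pow, Matrix.smul_mul, one_mul]
  rw [h3, I.mul _ _ (by fun_prop) hhc, I.pow _ (by fun_prop), h2]
  ring

theorem exists_idempotent [CompactSpace Y] [T2Space Y] (g : Circle × Y → G ι) (hg : Continuous g) :
    ∃ (κ : Type) (_ : Fintype κ) (_ : DecidableEq κ) (p : Y → Matrix κ κ ℂ) (_ : Continuous p)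
      (hp : ∀ y, p y * p y = p y) (k : ℕ), ∀ I : Inv (Circle × Y),
      (∀ {ι : Type} [Fintype ι] [DecidableEq ι] (f : Y → G ι), Continuous f → I.val (fun x => f x.2) = 0) →
      I.val g = I.val (fun x => idU (p x.2) (hp x.2) x.1) - k * I.val (fun x => cs ι x.1) := by
  obtain ⟨D, k, q, hD, hq, H⟩ := exists_polyZ g hg
  obtain ⟨κ, i1, i2, a, b, ha, hb, hab, H2⟩ := exists_linear q hD hq
  have hs : ∀ y, IsUnit (a y + b y) := fun y => by simpa using hab 1 y
  set s : Y → G κ := fun y => mkG _ (hs y) with hsd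
  have hsc : Continuous s := by rw [continuous_G_iff]; exact ha.add hb
  set c : Y → Matrix κ κ ℂ := fun y => ((s y)⁻¹ : G κ).val * b y with hc
  have hcc : Continuous c := (continuous_G_val hsc.inv).mul hb
  have hsi : ∀ y, ((s y)⁻¹ : G κ).val * (a y + b y) = 1 := fun y => (s y).inv_mul
  have hsi' : ∀ y, (a y + b y) * ((s y)⁻¹ : G κ).val = 1 := fun y => (s y).mul_inv
  have hu : ∀ (z : Circle) y, IsUnit (1 + ((z : ℂ) - 1) • c y) := fun z y => by
    have : 1 + ((z : ℂ) - 1) • c y = ((s y)⁻¹ * mkG _ (hab z y) : G κ).val := by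
      rw [Units.val_mul, mkG_val, ← hsi, hc, ← Matrix.mul_smul, ← mul_add, sub_smul, one_smul]
      congr 1; abel
    rw [this]; exact Units.isUnit _
  obtain ⟨R, hR, hL⟩ := exists_spectral c hcc hu
  refine ⟨κ, i1, i2, fun y => c y * R y (-1), hcc.mul (hR _), fun y => (hL y).idem, k, fun I hI => ?_⟩
  rw [H I, H2 I]
  congr 1
  have huc : Continuous fun x : Circle × Y => mkG _ (hu x.1 x.2) := by
    rw [continuous_G_iff]; simp only [mkG_val]; fun_prop
  have e : (fun x : Circle × Y => mkG _ (hab x.1 x.2)) = fun x => s x.2 * mkG _ (hu x.1 x.2) := by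
    funext x; ext1
    rw [Units.val_mul, mkG_val, mkG_val, mkG_val, mul_add, mul_one, Matrix.mul_smul, hc, ← mul_assoc, hsi',
      one_mul, sub_smul, one_smul]
    abel
  rw [e, I.mul _ _ (by fun_prop) huc, hI s hsc, zero_add]
  have hpath : ∀ (t : unitInterval) (x : Circle × Y), IsUnit (1 + ((x.1 : ℂ) - 1) •
      ((1 - (t : ℝ) : ℂ) • c x.2 + ((t : ℝ) : ℂ) • (c x.2 * R x.2 (-1)))) := fun t x =>
    (hL x.2).isUnit_path x.1 t t.2.1 t.2.2
  have hRm := hR (-1)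
  have h := I.homotopy (fun t x => mkG _ (hpath t x)) (by
    rw [continuous_G_iff]; simp only [mkG_val]; fun_prop)
  convert h using 2
  · funext x; ext1; simp
  · funext x; ext1; simp [idU_val]

end Approx
end UnitaryCommutator

open scoped Matrix
open Filter Topology

namespace UnitaryCommutator

section Loop

/-- The exponential parametrisation of the circle. -/
noncomputable def ex (t : ℝ) : Circle := Circle.exp (2 * Real.pi * t)

@[fun_prop]
theorem continuous_ex {W : Type} [TopologicalSpace W] {f : W → ℝ} (hf : Continuous f) :
    Continuous fun w => ex (f w) := by unfold ex; fun_prop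

@[simp] theorem ex_zero : ex 0 = 1 := by simp [ex]

@[simp] theorem ex_one : ex 1 = 1 := by simp [ex]

/-- A section of the exponential parametrisation. -/
noncomputable def tau (c : Circle) : unitInterval :=
  ⟨Int.fract (Complex.arg c / (2 * Real.pi)), Int.fract_nonneg _, (Int.fract_lt_one _).le⟩

theorem tau_lt (c : Circle) : (tau c : ℝ) < 1 := Int.fract_lt_one _

@[simp] theorem ex_tau (c : Circle) : ex (tau c) = c := by
  have h2 : (2 * Real.pi) ≠ 0 := by positivity
  have h : (2 * Real.pi) * (tau c : ℝ) = Complex.arg c - ⌊Complex.arg c / (2 * Real.pi)⌋ * (2 * Real.pi) := by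
    simp only [tau, Int.fract]; field_simp
  rw [ex, h, Circle.exp_sub, Circle.exp_arg]
  have : Circle.exp (⌊Complex.arg c / (2 * Real.pi)⌋ * (2 * Real.pi)) = 1 := by
    rw [Circle.exp_eq_one]
    exact ⟨_, rfl⟩
  rw [this, div_one]

theorem ex_inj {s t : ℝ} (hs : 0 ≤ s) (hs1 : s < 1) (ht : 0 ≤ t) (ht1 : t < 1) (h : ex s = ex t) : s = t := by
  rw [ex, ex, Circle.exp_eq_exp] at h
  obtain ⟨m, hm⟩ := h
  have hm' : s = t + m := by
    have : 0 < 2 * Real.pi := by positivity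
    apply mul_left_cancel₀ this.ne'
    linarith
  have h1 : (m : ℝ) < 1 := by linarith
  have h2 : (-1 : ℝ) < m := by linarith
  have h3 : m < 1 := by exact_mod_cast h1
  have h4 : -1 < m := by exact_mod_cast h2
  have : m = 0 := by omega
  simp [hm', this]

theorem tau_ex (t : unitInterval) : tau (ex t) = t ∨ (t = 1 ∧ tau (ex t) = 0) := by
  rcases t.2.2.lt_or_eq with h | h
  · left
    exact Subtype.ext (ex_inj (tau _).2.1 (tau_lt _) t.2.1 h (ex_tau _))
  · right
    have ht : t = 1 := Subtype.ext h
    refine ⟨ht, Subtype.ext (ex_inj (tau _).2.1 (tau_lt _) le_rfl one_pos ?_)⟩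
    rw [ex_tau, ht]; simp

@[simp] theorem tau_one : tau 1 = 0 := by
  rcases tau_ex 0 with h | h
  · simpa using h
  · exact absurd h.1 (by simp)

theorem continuous_loop {Z T W : Type} [TopologicalSpace Z] [TopologicalSpace T] [TopologicalSpace W]
    (F : unitInterval → Z → T) (hF : Continuous fun p : unitInterval × Z => F p.1 p.2)
    (h01 : ∀ z, F 0 z = F 1 z) {c : W → Circle} (hc : Continuous c) {φ : W → Z} (hφ : Continuous φ) :
    Continuous fun w => F (tau (c w)) (φ w) := by
  have hsurj : Function.Surjective fun t : unitInterval => ex t := fun c => ⟨tau c, ex_tau c⟩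
  have hcont : Continuous fun t : unitInterval => ex t := by fun_prop
  have hq : IsQuotientMap (Prod.map (fun t : unitInterval => ex t) (id : Z → Z)) :=
    ((hcont.isProperMap.prodMap isProperMap_id).isClosedMap).isQuotientMap
      (hcont.prodMap continuous_id) (hsurj.prodMap Function.surjective_id)
  have key : Continuous fun p : Circle × Z => F (tau p.1) p.2 := by
    rw [hq.continuous_iff]
    convert hF using 1
    funext ⟨t, z⟩
    rcases tau_ex t with h | ⟨h, h'⟩
    · simp [h]
    · simp [h', h, h01]
  exact key.comp (hc.prodMk hφ)

end Loop

section Path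
variable {ι κ : Type} [Fintype ι] [DecidableEq ι] [Fintype κ] [DecidableEq κ]

/-- A reparametrisation of the quarter turn which is locally constant near the ends. -/
noncomputable def alpha (t : ℝ) : ℝ := Real.pi / 2 * Real.smoothTransition (3 * t - 1)

@[fun_prop]
theorem continuous_alpha {W : Type} [TopologicalSpace W] {f : W → ℝ} (hf : Continuous f) :
    Continuous fun w => alpha (f w) := by
  unfold alpha
  have := Real.smoothTransition.continuous
  fun_prop

@[simp] theorem alpha_zero : alpha 0 = 0 := by
  rw [alpha, Real.smoothTransition.zero_of_nonpos (by norm_num), mul_zero]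

@[simp] theorem alpha_one : alpha 1 = Real.pi / 2 := by
  rw [alpha, Real.smoothTransition.one_of_one_le (by norm_num), mul_one]

/-- The standard path from `1` to `a ⊕ a⁻¹`. -/
noncomputable def Wh (a : G ι) (t : ℝ) : G (ι ⊕ ι) :=
  dsum a 1 * rot ι (alpha t) * (dsum a 1)⁻¹ * (rot ι (alpha t))⁻¹

@[fun_prop]
theorem continuous_Wh {W : Type} [TopologicalSpace W] {f : W → G ι} {t : W → ℝ} (hf : Continuous f)
    (ht : Continuous t) : Continuous fun w => Wh (f w) (t w) := by
  unfold Wh; fun_prop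

@[simp] theorem Wh_zero (a : G ι) : Wh a 0 = 1 := by simp [Wh]

@[simp] theorem Wh_one_left (t : ℝ) : Wh (1 : G ι) t = 1 := by simp [Wh]

@[simp] theorem Wh_one (a : G ι) : Wh a 1 = dsum a a⁻¹ := by
  rw [Wh, alpha_one, mul_assoc, mul_assoc, ← mul_assoc (rot _ _), dsum_inv, rot_conj_half, dsum_mul]
  simp

theorem reix_dsum_comm (a b : G ι) (c d : G κ) :
    reix (Equiv.sumSumSumComm ι κ ι κ) (dsum (dsum a c) (dsum b d)) = dsum (dsum a b) (dsum c d) := by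
  ext1
  ext i j
  simp only [reix_val, dsum_val, Matrix.reindex_apply, Matrix.submatrix_apply]
  rcases i with (i | i) | (i | i) <;> rcases j with (j | j) | (j | j) <;> simp

theorem reix_rot (x : ℝ) :
    reix (Equiv.sumSumSumComm ι κ ι κ) (rot (ι ⊕ κ) x) = dsum (rot ι x) (rot κ x) := by
  ext1
  ext i j
  simp only [reix_val, dsum_val, rot_val, Matrix.reindex_apply, Matrix.submatrix_apply]
  rcases i with (i | i) | (i | i) <;> rcases j with (j | j) | (j | j) <;> simp [Matrix.one_apply]

theorem reix_Wh (a : G ι) (b : G κ) (t : ℝ) :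
    reix (Equiv.sumSumSumComm ι κ ι κ) (Wh (dsum a b) t) = dsum (Wh a t) (Wh b t) := by
  have h1 : (1 : G (ι ⊕ κ)) = dsum 1 1 := dsum_one.symm
  simp only [Wh, map_mul, map_inv, reix_rot]
  rw [h1, reix_dsum_comm]
  simp only [dsum_inv, dsum_mul]

theorem reix_sumCongr_dsum (e : ι ≃ κ) (a b : G ι) :
    reix (e.sumCongr e) (dsum a b) = dsum (reix e a) (reix e b) := by
  ext1
  ext i j
  simp only [reix_val, dsum_val, Matrix.reindex_apply, Matrix.submatrix_apply]
  rcases i with i | i <;> rcases j with j | j <;> simp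

theorem reix_sumCongr_rot (e : ι ≃ κ) (x : ℝ) : reix (e.sumCongr e) (rot ι x) = rot κ x := by
  ext1
  ext i j
  simp only [reix_val, rot_val, Matrix.reindex_apply, Matrix.submatrix_apply]
  rcases i with i | i <;> rcases j with j | j <;> simp [Matrix.one_apply]

theorem reix_sumCongr_Wh (e : ι ≃ κ) (a : G ι) (t : ℝ) :
    reix (e.sumCongr e) (Wh a t) = Wh (reix e a) t := by
  simp only [Wh, map_mul, map_inv, reix_sumCongr_rot, reix_sumCongr_dsum, map_one]

end Path

/-- The group commutator. -/
def cm {H : Type} [Group H] (a b : H) : H := a * b * a⁻¹ * b⁻¹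

theorem cm_eq_one {H : Type} [Group H] {a b : H} (h : Commute a b) : cm a b = 1 := by
  rw [cm, h.eq]; group

@[simp] theorem cm_one_left {H : Type} [Group H] (b : H) : cm 1 b = 1 := cm_eq_one (Commute.one_left _)

@[simp] theorem cm_one_right {H : Type} [Group H] (b : H) : cm b 1 = 1 := cm_eq_one (Commute.one_right _)

@[fun_prop]
theorem continuous_cm {W ι : Type} [Fintype ι] [DecidableEq ι] [TopologicalSpace W] {f g : W → G ι}
    (hf : Continuous f) (hg : Continuous g) : Continuous fun w => cm (f w) (g w) := by
  unfold cm; fun_prop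

section Paths
variable {ι κ : Type} [Fintype ι] [DecidableEq ι] [Fintype κ] [DecidableEq κ]
variable {Z : Type} [TopologicalSpace Z]

/-- Continuous families of paths issuing from the identity. -/
structure IsPath (W : unitInterval → Z → G ι) : Prop where
  cont : Continuous fun p : unitInterval × Z => W p.1 p.2
  zero : ∀ z, W 0 z = 1

/-- Continuous families of loops based at the identity. -/
structure IsLoop (W : unitInterval → Z → G ι) : Prop extends IsPath W where
  one : ∀ z, W 1 z = 1

theorem IsPath.continuous {W : unitInterval → Z → G ι} (h : IsPath W) {V : Type} [TopologicalSpace V]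
    {s : V → unitInterval} {z : V → Z} (hs : Continuous s) (hz : Continuous z) :
    Continuous fun v => W (s v) (z v) := h.cont.comp (hs.prodMk hz)

theorem IsPath.mul {W V : unitInterval → Z → G ι} (hW : IsPath W) (hV : IsPath V) :
    IsPath fun t z => W t z * V t z := ⟨hW.cont.mul hV.cont, fun z => by simp [hW.zero, hV.zero]⟩

theorem IsPath.inv {W : unitInterval → Z → G ι} (hW : IsPath W) :
    IsPath fun t z => (W t z)⁻¹ := ⟨hW.cont.inv, fun z => by simp [hW.zero]⟩

theorem IsPath.dsum_one {W : unitInterval → Z → G ι} (hW : IsPath W) :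
    IsPath fun t z => dsum (W t z) (1 : G κ) :=
  ⟨continuous_dsum hW.cont continuous_const, fun z => by simp [hW.zero]⟩

theorem IsPath.one_dsum {W : unitInterval → Z → G ι} (hW : IsPath W) :
    IsPath fun t z => dsum (1 : G κ) (W t z) :=
  ⟨continuous_dsum continuous_const hW.cont, fun z => by simp [hW.zero]⟩

theorem IsLoop.conj {W V : unitInterval → Z → G ι} (hW : IsLoop W) (hV : IsPath V) :
    IsLoop fun t z => V t z * W t z * (V t z)⁻¹ :=
  ⟨(hV.mul hW.toIsPath).mul hV.inv, fun z => by simp [hW.one]⟩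

theorem IsPath.comm {W : unitInterval → Z → G ι} (hW : IsPath W) {g : Z → G ι} (hg : Continuous g)
    (h : ∀ z, Commute (W 1 z) (g z)) : IsLoop fun t z => cm (W t z) (g z) := by
  refine ⟨⟨?_, fun z => by simp [hW.zero]⟩, fun z => cm_eq_one (h z)⟩
  have := hW.cont
  fun_prop

theorem IsPath.wh {a : Z → G ι} (ha : Continuous a) : IsPath fun t z => Wh (a z) (t : ℝ) :=
  ⟨by fun_prop, fun z => by simp⟩

variable {Y : Type} [TopologicalSpace Y]

/-- The map on `Circle × (Circle × Y)` attached to a family of loops, in the second circle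
coordinate. -/
noncomputable def lp (F : unitInterval → Circle × Y → G ι) (x : Circle × (Circle × Y)) : G ι :=
  F (tau x.2.1) (x.1, x.2.2)

theorem IsLoop.continuous_lp {F : unitInterval → Circle × Y → G ι} (h : IsLoop F) : Continuous (lp F) :=
  continuous_loop F h.cont (fun z => by rw [h.zero, h.one]) (by fun_prop) (by fun_prop)

theorem Inv.lp_homotopy (I : Inv (Circle × (Circle × Y)))
    (F : unitInterval → unitInterval → Circle × Y → G ι)
    (hF : Continuous fun p : unitInterval × unitInterval × (Circle × Y) => F p.1 p.2.1 p.2.2)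
    (h01 : ∀ s z, F s 0 z = F s 1 z) : I.val (lp (F 0)) = I.val (lp (F 1)) := by
  refine I.homotopy (fun s => lp (F s)) ?_
  exact continuous_loop (fun t (p : unitInterval × (Circle × Y)) => F p.1 t p.2)
    (hF.comp (by fun_prop : Continuous fun q : unitInterval × (unitInterval × (Circle × Y)) => (q.2.1, q.1, q.2.2)))
    (fun p => h01 p.1 p.2)
    (c := fun p : unitInterval × (Circle × (Circle × Y)) => p.2.2.1) (by fun_prop)
    (φ := fun p : unitInterval × (Circle × (Circle × Y)) => (p.1, (p.2.1, p.2.2.2))) (by fun_prop)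

theorem Inv.lp_mul (I : Inv (Circle × (Circle × Y))) {F F' : unitInterval → Circle × Y → G ι}
    (h : IsLoop F) (h' : IsLoop F') :
    I.val (lp fun t z => F t z * F' t z) = I.val (lp F) + I.val (lp F') :=
  I.mul _ _ h.continuous_lp h'.continuous_lp

theorem Inv.lp_conj (I : Inv (Circle × (Circle × Y))) {F V : unitInterval → Circle × Y → G ι}
    (h : IsLoop F) (hV : IsPath V) :
    I.val (lp fun t z => V t z * F t z * (V t z)⁻¹) = I.val (lp F) := by
  have hc1 : Continuous fun p : unitInterval × unitInterval × (Circle × Y) => V (p.1 * p.2.1) p.2.2 :=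
    hV.continuous (by fun_prop) (by fun_prop)
  have hc2 : Continuous fun p : unitInterval × unitInterval × (Circle × Y) => F p.2.1 p.2.2 :=
    h.continuous (by fun_prop) (by fun_prop)
  have := I.lp_homotopy (fun s t z => V (s * t) z * F t z * (V (s * t) z)⁻¹)
    ((hc1.mul hc2).mul hc1.inv)
    (fun s z => by simp [h.zero, h.one])
  simp only [zero_mul, one_mul, hV.zero, inv_one, mul_one] at this
  exact this.symm

theorem Inv.lp_mul_left (I : Inv (Circle × (Circle × Y))) {W V : unitInterval → Circle × Y → G ι}
    {g : Circle × Y → G ι} (hW : IsPath W) (hV : IsPath V) (hg : Continuous g)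
    (hWg : ∀ z, Commute (W 1 z) (g z)) (hVg : ∀ z, Commute (V 1 z) (g z)) :
    I.val (lp fun t z => cm (W t z * V t z) (g z)) =
      I.val (lp fun t z => cm (W t z) (g z)) + I.val (lp fun t z => cm (V t z) (g z)) := by
  have e : (fun t z => cm (W t z * V t z) (g z)) = fun t z =>
      (W t z * cm (V t z) (g z) * (W t z)⁻¹) * cm (W t z) (g z) := by
    funext t z; simp only [cm]; group
  rw [e, I.lp_mul ((hV.comm hg hVg).conj hW) (hW.comm hg hWg), I.lp_conj (hV.comm hg hVg) hW, add_comm]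

theorem Inv.lp_comm_loop (I : Inv (Circle × (Circle × Y))) {W : unitInterval → Circle × Y → G ι}
    {g : Circle × Y → G ι} (hW : IsLoop W) (hg : Continuous g) :
    I.val (lp fun t z => cm (W t z) (g z)) = 0 := by
  have hgc : Continuous fun x : Circle × (Circle × Y) => g (x.1, x.2.2) := by fun_prop
  have := hW.continuous_lp
  have h1 := I.mul (fun x => lp W x * g (x.1, x.2.2) * (lp W x)⁻¹) (fun x => (g (x.1, x.2.2))⁻¹)
    (by fun_prop) (by fun_prop)
  rw [I.conj _ _ hgc this, I.inv _ hgc] at h1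
  simp only [cm]
  rw [add_neg_cancel] at h1
  exact h1

/-- Only the endpoint of the path matters. -/
theorem Inv.lp_path_indep (I : Inv (Circle × (Circle × Y))) {W V : unitInterval → Circle × Y → G ι}
    {g : Circle × Y → G ι} (hW : IsPath W) (hV : IsPath V) (hg : Continuous g)
    (hWV : ∀ z, W 1 z = V 1 z) (hWg : ∀ z, Commute (W 1 z) (g z)) :
    I.val (lp fun t z => cm (W t z) (g z)) = I.val (lp fun t z => cm (V t z) (g z)) := by
  have hL : IsLoop fun t z => (W t z)⁻¹ * V t z := ⟨hW.inv.mul hV, fun z => by simp [hWV]⟩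
  have h := I.lp_mul_left hW hL.toIsPath hg hWg (fun z => by simp [hWV])
  rw [I.lp_comm_loop hL hg, add_zero] at h
  rw [← h]
  simp only [mul_inv_cancel_left]

theorem Inv.lp_mul_right (I : Inv (Circle × (Circle × Y))) {W : unitInterval → Circle × Y → G ι}
    {g g' : Circle × Y → G ι} (hW : IsPath W) (hg : Continuous g) (hg' : Continuous g')
    (hWg : ∀ z, Commute (W 1 z) (g z)) (hWg' : ∀ z, Commute (W 1 z) (g' z)) :
    I.val (lp fun t z => cm (W t z) (g z * g' z)) =
      I.val (lp fun t z => cm (W t z) (g z)) + I.val (lp fun t z => cm (W t z) (g' z)) := by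
  have hgc : Continuous fun x : Circle × (Circle × Y) => g (x.1, x.2.2) := by fun_prop
  have h1 := (hW.comm hg hWg).continuous_lp
  have h2 := (hW.comm hg' hWg').continuous_lp
  have e : (lp fun t z => cm (W t z) (g z * g' z)) = fun x => lp (fun t z => cm (W t z) (g z)) x *
      (g (x.1, x.2.2) * lp (fun t z => cm (W t z) (g' z)) x * (g (x.1, x.2.2))⁻¹) := by
    funext x; simp only [lp, cm]; group
  rw [e, I.mul _ _ h1 (by fun_prop), I.conj _ _ h2 hgc]

end Paths
end UnitaryCommutator

open scoped Matrix
open Filter Topology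

namespace UnitaryCommutator

section Prime
variable {ι κ : Type} [Fintype ι] [DecidableEq ι] [Fintype κ] [DecidableEq κ]
variable {Y : Type} [TopologicalSpace Y]

/-- The pairing of a map commuting with a family `g` against that family. -/
noncomputable def pr (a : Y → G ι) (g : Circle × Y → G ι) (t : unitInterval) (z : Circle × Y) : G (ι ⊕ ι) :=
  cm (Wh (a z.2) t) (dsum (g z) 1)

theorem commute_dsum {a c : G ι} {b d : G κ} (h : Commute a c) (h' : Commute b d) :
    Commute (dsum a b) (dsum c d) := by
  rw [Commute, SemiconjBy, dsum_mul, dsum_mul, h.eq, h'.eq]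

theorem commute_Wh_one {a g : G ι} (h : Commute a g) : Commute (Wh a 1) (dsum g (1 : G ι)) := by
  rw [Wh_one]; exact commute_dsum h (Commute.one_right _)

theorem isPath_wh' {a : Y → G ι} (ha : Continuous a) :
    IsPath fun (t : unitInterval) (z : Circle × Y) => Wh (a z.2) (t : ℝ) :=
  IsPath.wh (a := fun z : Circle × Y => a z.2) (by fun_prop)

theorem pr_loop {a : Y → G ι} {g : Circle × Y → G ι} (ha : Continuous a) (hg : Continuous g)
    (h : ∀ z, Commute (a z.2) (g z)) : IsLoop (pr a g) :=
  (isPath_wh' ha).comm (g := fun z => dsum (g z) 1) (by fun_prop) fun z => commute_Wh_one (h z)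

theorem csY_comm (a : Y → G ι) (z : Circle × Y) : Commute (a z.2) (cs ι z.1) := (cs_comm _ _).symm

theorem Inv.pr_homotopy (I : Inv (Circle × (Circle × Y))) (A : unitInterval → Y → G ι)
    (g : unitInterval → Circle × Y → G ι)
    (hA : Continuous fun p : unitInterval × Y => A p.1 p.2)
    (hg : Continuous fun p : unitInterval × (Circle × Y) => g p.1 p.2)
    (h : ∀ s z, Commute (A s z.2) (g s z)) :
    I.val (lp (pr (A 0) (g 0))) = I.val (lp (pr (A 1) (g 1))) := by
  refine I.lp_homotopy (fun s => pr (A s) (g s)) ?_ fun s z => ?_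
  · have h1 : Continuous fun p : unitInterval × unitInterval × (Circle × Y) => A p.1 p.2.2.2 :=
      hA.comp (by fun_prop : Continuous fun p : unitInterval × unitInterval × (Circle × Y) => (p.1, p.2.2.2))
    have h2 : Continuous fun p : unitInterval × unitInterval × (Circle × Y) => g p.1 p.2.2 :=
      hg.comp (by fun_prop : Continuous fun p : unitInterval × unitInterval × (Circle × Y) => (p.1, p.2.2))
    unfold pr
    fun_prop
  · simp only [pr, Set.Icc.coe_zero, Set.Icc.coe_one, Wh_zero]
    rw [cm_one_left, cm_eq_one (commute_Wh_one (h s z))]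

theorem Inv.pr_mul_right (I : Inv (Circle × (Circle × Y))) {a : Y → G ι} {g g' : Circle × Y → G ι}
    (ha : Continuous a) (hg : Continuous g) (hg' : Continuous g')
    (h : ∀ z, Commute (a z.2) (g z)) (h' : ∀ z, Commute (a z.2) (g' z)) :
    I.val (lp (pr a fun z => g z * g' z)) = I.val (lp (pr a g)) + I.val (lp (pr a g')) := by
  have := I.lp_mul_right (isPath_wh' ha) (g := fun z => dsum (g z) (1 : G ι)) (g' := fun z => dsum (g' z) (1 : G ι))
    (by fun_prop) (by fun_prop) (fun z => commute_Wh_one (h z)) (fun z => commute_Wh_one (h' z))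
  simp only [dsum_mul, mul_one] at this
  exact this

theorem Inv.pr_mul_left (I : Inv (Circle × (Circle × Y))) {a b : Y → G ι} {g : Circle × Y → G ι}
    (ha : Continuous a) (hb : Continuous b) (hg : Continuous g)
    (h : ∀ z, Commute (a z.2) (g z)) (h' : ∀ z, Commute (b z.2) (g z)) (hab : ∀ y, Commute (a y) (b y)) :
    I.val (lp (pr (fun y => a y * b y) g)) = I.val (lp (pr a g)) + I.val (lp (pr b g)) := by
  have := I.lp_mul_left (isPath_wh' ha) (isPath_wh' hb) (g := fun z => dsum (g z) (1 : G ι))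
    (by fun_prop) (fun z => commute_Wh_one (h z)) (fun z => commute_Wh_one (h' z))
  refine Eq.trans ?_ this
  refine I.lp_path_indep (isPath_wh' (a := fun y => a y * b y) (by fun_prop))
    ((isPath_wh' ha).mul (isPath_wh' hb)) (by fun_prop) (fun z => ?_)
    (fun z => commute_Wh_one ((h z).mul_left (h' z)))
  simp only [Set.Icc.coe_one, Wh_one, dsum_mul, mul_inv_rev]
  rw [(hab z.2).inv_inv.symm.eq]

/-- The Bott-type transgression of a functional. -/
noncomputable def Inv.prime (I : Inv (Circle × (Circle × Y))) : Inv Y where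
  val a := I.val (lp (pr a fun z => cs _ z.1))
  homotopy F hF := I.pr_homotopy F (fun _ z => cs _ z.1) hF (by fun_prop) fun s z => (cs_comm _ _).symm
  sum {ι κ} _ _ _ _ f g hf hg := by
    have h1 := pr_loop hf (g := fun z => cs ι z.1) (by fun_prop) (csY_comm f)
    have h2 := pr_loop hg (g := fun z => cs κ z.1) (by fun_prop) (csY_comm g)
    have h3 := pr_loop (a := fun y => dsum (f y) (g y)) (by fun_prop) (g := fun z => cs (ι ⊕ κ) z.1)
      (by fun_prop) (csY_comm fun y => dsum (f y) (g y))
    rw [← I.sum _ _ h1.continuous_lp h2.continuous_lp, ← I.reindex (Equiv.sumSumSumComm ι κ ι κ) _ h3.continuous_lp]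
    congr 1
    funext x
    have e : cs (ι ⊕ κ) x.1 = dsum (cs ι x.1) (cs κ x.1) := by
      ext1; simp [cs_val, dsum_val, ← Matrix.fromBlocks_one, Matrix.fromBlocks_smul]
    have e1 : (1 : G (ι ⊕ κ)) = dsum 1 1 := dsum_one.symm
    simp only [lp, pr, cm, map_mul, map_inv, reix_Wh]
    rw [e, e1, reix_dsum_comm]
    simp only [dsum_inv, dsum_mul]
  reindex {ι κ} _ _ _ _ e f hf := by
    have h1 := pr_loop hf (g := fun z => cs ι z.1) (by fun_prop) (csY_comm f)
    rw [← I.reindex (e.sumCongr e) _ h1.continuous_lp]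
    congr 1
    funext x
    have e : cs κ x.1 = reix e (cs ι x.1) := by
      ext1; ext i j; simp [cs_val, reix_val, Matrix.one_apply]
    simp only [lp, pr, cm, map_mul, map_inv, reix_sumCongr_Wh, reix_sumCongr_dsum, map_one]
    rw [e]
  one := by
    exact (congrArg I.val (by funext x; simp [pr, lp])).trans I.one

theorem Inv.prime_val (I : Inv (Circle × (Circle × Y))) (a : Y → G ι) :
    I.prime.val a = I.val (lp (pr a fun z => cs _ z.1)) := rfl

theorem rotP_aux (p : Matrix ι ι ℂ) {c : ℂ} (hc : c = 1) (d : ℂ) (hd : d = c) :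
    p + d • (1 - p) = 1 := by rw [hd, hc, one_smul, add_sub_cancel]

theorem rotP_aux' (p : Matrix ι ι ℂ) {c : ℂ} (hc : c = 1) (d e : ℂ) (hd : d + e = c) :
    d • (1 - p) + (p + e • (1 - p)) = 1 := by
  rw [add_left_comm, ← add_smul, rotP_aux p hc _ hd]

/-- Rotation in the range of the complement of an idempotent. -/
noncomputable def rotP (p : Matrix ι ι ℂ) (hp : p * p = p) (x : ℝ) : G (ι ⊕ ι) where
  val := Matrix.fromBlocks (p + (Real.cos x : ℂ) • (1 - p)) (-(Real.sin x : ℂ) • (1 - p))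
    ((Real.sin x : ℂ) • (1 - p)) (p + (Real.cos x : ℂ) • (1 - p))
  inv := Matrix.fromBlocks (p + (Real.cos x : ℂ) • (1 - p)) ((Real.sin x : ℂ) • (1 - p))
    (-(Real.sin x : ℂ) • (1 - p)) (p + (Real.cos x : ℂ) • (1 - p))
  val_inv := by
    have h1 : p * (1 - p) = 0 := by rw [mul_sub, hp, mul_one, sub_self]
    have h2 : (1 - p) * p = 0 := by rw [sub_mul, hp, one_mul, sub_self]
    have h3 : (1 - p) * (1 - p) = 1 - p := by rw [mul_sub, h2, mul_one, sub_zero]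
    have hcs : (Real.cos x : ℂ) * Real.cos x + Real.sin x * Real.sin x = 1 := by
      norm_cast; nlinarith [Real.sin_sq_add_cos_sq x]
    rw [Matrix.fromBlocks_multiply, ← Matrix.fromBlocks_one]
    simp only [mul_add, add_mul, smul_mul_smul_comm, hp, h1, h2, h3, Matrix.mul_smul, Matrix.smul_mul,
      smul_zero, add_zero, zero_add, add_assoc, ← add_smul]
    congr 1
    · exact rotP_aux p hcs _ (by ring)
    · rw [show (Real.cos x : ℂ) * Real.sin x + -Real.sin x * Real.cos x = 0 by ring, zero_smul]
    · rw [show (Real.sin x : ℂ) * Real.cos x + Real.cos x * -Real.sin x = 0 by ring, zero_smul]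
    · exact rotP_aux' p hcs _ _ (by ring)
  inv_val := by
    have h1 : p * (1 - p) = 0 := by rw [mul_sub, hp, mul_one, sub_self]
    have h2 : (1 - p) * p = 0 := by rw [sub_mul, hp, one_mul, sub_self]
    have h3 : (1 - p) * (1 - p) = 1 - p := by rw [mul_sub, h2, mul_one, sub_zero]
    have hcs : (Real.cos x : ℂ) * Real.cos x + Real.sin x * Real.sin x = 1 := by
      norm_cast; nlinarith [Real.sin_sq_add_cos_sq x]
    rw [Matrix.fromBlocks_multiply, ← Matrix.fromBlocks_one]
    simp only [mul_add, add_mul, smul_mul_smul_comm, hp, h1, h2, h3, Matrix.mul_smul, Matrix.smul_mul,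
      smul_zero, add_zero, zero_add, add_assoc, ← add_smul]
    congr 1
    · exact rotP_aux p hcs _ (by ring)
    · rw [show (Real.cos x : ℂ) * -Real.sin x + Real.sin x * Real.cos x = 0 by ring, zero_smul]
    · rw [show -(Real.sin x : ℂ) * Real.cos x + Real.cos x * Real.sin x = 0 by ring, zero_smul]
    · exact rotP_aux' p hcs _ _ (by ring)

theorem rotP_val (p : Matrix ι ι ℂ) (hp : p * p = p) (x : ℝ) : (rotP p hp x : Matrix _ _ ℂ) =
    Matrix.fromBlocks (p + (Real.cos x : ℂ) • (1 - p)) (-(Real.sin x : ℂ) • (1 - p))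
    ((Real.sin x : ℂ) • (1 - p)) (p + (Real.cos x : ℂ) • (1 - p)) := rfl

theorem rotP_zero (p : Matrix ι ι ℂ) (hp : p * p = p) : rotP p hp 0 = 1 := by
  ext1; simp [rotP_val]

@[fun_prop]
theorem continuous_rotP {W : Type} [TopologicalSpace W] {p : W → Matrix ι ι ℂ} {hp : ∀ w, p w * p w = p w}
    {x : W → ℝ} (hpc : Continuous p) (hx : Continuous x) : Continuous fun w => rotP (p w) (hp w) (x w) := by
  rw [continuous_G_iff]
  simp only [rotP_val]
  exact Continuous.matrix_fromBlocks (by fun_prop) (by fun_prop) (by fun_prop) (by fun_prop)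

/-- If `b` is the identity on the range of `p`, the pairing of `b` with `1 + (z - 1) p` vanishes. -/
theorem Inv.pr_eq_zero (I : Inv (Circle × (Circle × Y))) {b : Y → G ι} (hb : Continuous b)
    {p : Y → Matrix ι ι ℂ} (hpc : Continuous p) (hp : ∀ y, p y * p y = p y)
    (h1 : ∀ y, (b y : Matrix ι ι ℂ) * p y = p y) (h2 : ∀ y, p y * (b y : Matrix ι ι ℂ) = p y) :
    I.val (lp (pr b fun z => idU (p z.2) (hp z.2) z.1)) = 0 := by
  have hcomm : ∀ z : Circle × Y, Commute (b z.2) (idU (p z.2) (hp z.2) z.1) := fun z => by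
    apply Units.ext
    simp [idU_val, mul_add, add_mul, h1, h2]
  set W : unitInterval → Circle × Y → G (ι ⊕ ι) := fun t z => dsum (b z.2) 1 *
    rotP (p z.2) (hp z.2) (Real.pi / 2 * t) * (dsum (b z.2) 1)⁻¹ * (rotP (p z.2) (hp z.2) (Real.pi / 2 * t))⁻¹ with hWd
  have hW : IsPath W := ⟨by fun_prop, fun z => by simp [hWd, rotP_zero]⟩
  have hW1 : ∀ z, W 1 z = Wh (b z.2) 1 := fun z => by
    have h3 : ((b z.2)⁻¹ : G ι).val * p z.2 = p z.2 := by
      rw [Units.inv_mul_eq_iff_eq_mul, h1]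
    have h4 : p z.2 * ((b z.2)⁻¹ : G ι).val = p z.2 := by
      rw [Units.mul_inv_eq_iff_eq_mul, h2]
    have key : rotP (p z.2) (hp z.2) (Real.pi / 2) * dsum (b z.2)⁻¹ 1 =
        dsum 1 (b z.2)⁻¹ * rotP (p z.2) (hp z.2) (Real.pi / 2) := by
      ext1
      simp [rotP_val, dsum_val, Matrix.fromBlocks_multiply, h3, h4, mul_sub, sub_mul,
        -Matrix.coe_units_inv]
    simp only [hWd, Set.Icc.coe_one, mul_one, Wh_one]
    rw [dsum_inv, inv_one, mul_assoc (dsum _ _) (rotP _ _ _), key, ← mul_assoc, mul_inv_cancel_right, dsum_mul]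
    simp
  have hgc : Continuous fun z : Circle × Y => dsum (idU (p z.2) (hp z.2) z.1) (1 : G ι) := by fun_prop
  rw [show pr b (fun z => idU (p z.2) (hp z.2) z.1) =
    fun (t : unitInterval) (z : Circle × Y) => cm (Wh (b z.2) (t : ℝ)) (dsum (idU (p z.2) (hp z.2) z.1) 1) from rfl]
  rw [← I.lp_path_indep hW (isPath_wh' hb) hgc hW1
    (fun z => by rw [hW1]; exact commute_Wh_one (hcomm z))]
  have hWc : ∀ t z, Commute (W t z) (dsum (idU (p z.2) (hp z.2) z.1) 1) := fun t z => by
    have c1 : Commute (dsum (b z.2) (1 : G ι)) (dsum (idU (p z.2) (hp z.2) z.1) 1) :=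
      commute_dsum (hcomm z) (Commute.one_right _)
    have c2 : Commute (rotP (p z.2) (hp z.2) (Real.pi / 2 * t)) (dsum (idU (p z.2) (hp z.2) z.1) 1) := by
      apply Units.ext
      simp [rotP_val, dsum_val, Matrix.fromBlocks_multiply, idU_val, mul_add, add_mul, mul_sub, sub_mul, hp, add_right_comm]
    exact ((c1.mul_left c2).mul_left c1.inv_left).mul_left c2.inv_left
  simp only [cm_eq_one (hWc _ _)]
  exact I.one

end Prime
end UnitaryCommutator

open scoped Matrix
open Filter Topology

namespace UnitaryCommutator

section Transport
variable {ι : Type} [Fintype ι] [DecidableEq ι]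
variable {Y : Type} [TopologicalSpace Y]

/-- The intertwiner between two idempotents. -/
def twine (P Q : Matrix ι ι ℂ) : Matrix ι ι ℂ := P * Q + (1 - P) * (1 - Q)

theorem twine_self {P : Matrix ι ι ℂ} (hP : P * P = P) : twine P P = 1 := by
  rw [twine, mul_sub, sub_mul, sub_mul, hP]; simp

theorem twine_comm {P Q : Matrix ι ι ℂ} (hP : P * P = P) (hQ : Q * Q = Q) :
    twine P Q * Q = P * twine P Q := by
  have h1 : (1 - Q) * Q = 0 := by rw [sub_mul, hQ, one_mul, sub_self]
  have h2 : P * (1 - P) = 0 := by rw [mul_sub, hP, mul_one, sub_self]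
  rw [twine, add_mul, mul_add, mul_assoc, mul_assoc, h1, ← mul_assoc P P, hP, ← mul_assoc P (1 - P), h2, hQ]
  simp

theorem exists_uniform_twine [CompactSpace Y] (P : unitInterval → Y → Matrix ι ι ℂ)
    (hc : Continuous fun x : unitInterval × Y => P x.1 x.2) (hP : ∀ s y, P s y * P s y = P s y) :
    ∃ δ > 0, ∀ s s' : unitInterval, dist s s' < δ → ∀ y, IsUnit (twine (P s y) (P s' y)) := by
  set S : Set ((unitInterval × unitInterval) × Y) := {x | (twine (P x.1.1 x.2) (P x.1.2 x.2)).det = 0} with hS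
  have hcl : IsClosed S := by
    refine isClosed_eq ?_ continuous_const
    have h1 : Continuous fun x : (unitInterval × unitInterval) × Y => P x.1.1 x.2 :=
      hc.comp (by fun_prop : Continuous fun x : (unitInterval × unitInterval) × Y => (x.1.1, x.2))
    have h2 : Continuous fun x : (unitInterval × unitInterval) × Y => P x.1.2 x.2 :=
      hc.comp (by fun_prop : Continuous fun x : (unitInterval × unitInterval) × Y => (x.1.2, x.2))
    unfold twine
    fun_prop
  have hop : IsOpen (Prod.fst '' S)ᶜ := (isClosedMap_fst_of_compactSpace _ hcl).isOpen_compl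
  have hd : Set.diagonal unitInterval ⊆ (Prod.fst '' S)ᶜ := by
    rintro ⟨s, s'⟩ h ⟨x, hx, hxs⟩
    have h' : s = s' := h
    subst h'
    rcases x with ⟨x1, y⟩
    simp only at hxs
    subst hxs
    simp [hS, twine_self (hP s y)] at hx
  have := hop.mem_nhdsSet.2 hd
  rw [nhdsSet_diagonal_eq_uniformity, Metric.mem_uniformity_dist] at this
  obtain ⟨δ, hδ, h⟩ := this
  refine ⟨δ, hδ, fun s s' hs y => ?_⟩
  rw [Matrix.isUnit_iff_isUnit_det, isUnit_iff_ne_zero]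
  exact fun h0 => h hs ⟨((s, s'), y), h0, rfl⟩

theorem exists_transport [CompactSpace Y] (P : unitInterval → Y → Matrix ι ι ℂ)
    (hc : Continuous fun x : unitInterval × Y => P x.1 x.2) (hP : ∀ s y, P s y * P s y = P s y) :
    ∃ U : unitInterval → Y → G ι, IsPath U ∧ ∀ s y, (U s y : Matrix ι ι ℂ) * P 0 y = P s y * U s y := by
  obtain ⟨δ, hδ, hu⟩ := exists_uniform_twine P hc hP
  obtain ⟨K, hK⟩ := exists_nat_gt (1 / δ)
  have hK0 : (0 : ℝ) < K := lt_trans (by positivity) hK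
  set σ : ℕ → unitInterval → unitInterval := fun k s => s ⊓ Set.projIcc 0 1 zero_le_one ((k : ℝ) / K) with hσ
  have hσc : ∀ k, Continuous (σ k) := fun k => by simp only [hσ]; fun_prop
  have hσ0 : ∀ k, σ k 0 = 0 := fun k => by simp [hσ]
  have hσd : ∀ k s, dist (σ (k + 1) s) (σ k s) < δ := fun k s => by
    have h1 : |(σ (k + 1) s : ℝ) - σ k s| ≤ |((k + 1 : ℕ) : ℝ) / K - (k : ℝ) / K| := by
      simp only [hσ, Set.coe_projIcc, Subtype.coe_inf, unitInterval]
      refine (abs_min_sub_min_le_max _ _ _ _).trans ?_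
      rw [sub_self, abs_zero, max_eq_right (abs_nonneg _)]
      refine (abs_max_sub_max_le_max _ _ _ _).trans ?_
      rw [sub_self, abs_zero, max_eq_right (abs_nonneg _)]
      refine (abs_min_sub_min_le_max _ _ _ _).trans ?_
      rw [sub_self, abs_zero, max_eq_right (abs_nonneg _)]
    have h2 : ((k + 1 : ℕ) : ℝ) / K - (k : ℝ) / K = 1 / K := by push_cast; ring
    rw [h2, abs_of_pos (show (0 : ℝ) < 1 / K by positivity)] at h1
    rw [Subtype.dist_eq, Real.dist_eq]
    refine h1.trans_lt ?_
    rw [div_lt_comm₀ hK0 hδ]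
    exact hK
  have key : ∀ k : ℕ, ∃ U : unitInterval → Y → G ι, IsPath U ∧
      ∀ s y, (U s y : Matrix ι ι ℂ) * P 0 y = P (σ k s) y * U s y := by
    intro k
    induction k with
    | zero => exact ⟨fun _ _ => 1, ⟨continuous_const, fun _ => rfl⟩, fun s y => by simp [hσ]⟩
    | succ k ih =>
      obtain ⟨U, hU, h⟩ := ih
      refine ⟨fun s y => mkG _ (hu (σ (k + 1) s) (σ k s) (hσd k s) y) * U s y, ⟨?_, fun y => ?_⟩, fun s y => ?_⟩
      · refine Continuous.mul (continuous_G_iff.2 ?_) hU.cont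
        simp only [mkG_val]
        have h1 : Continuous fun x : unitInterval × Y => P (σ (k + 1) x.1) x.2 :=
          hc.comp (((hσc _).comp continuous_fst).prodMk continuous_snd)
        have h2 : Continuous fun x : unitInterval × Y => P (σ k x.1) x.2 :=
          hc.comp (((hσc _).comp continuous_fst).prodMk continuous_snd)
        unfold twine
        fun_prop
      · ext1
        simp [hU.zero, mkG_val, hσ0, twine_self (hP 0 y)]
      · rw [Units.val_mul, mkG_val, mul_assoc, h, ← mul_assoc, twine_comm (hP _ _) (hP _ _), mul_assoc]
  obtain ⟨U, hU, h⟩ := key K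
  refine ⟨U, hU, fun s y => ?_⟩
  rw [h]
  have : σ K s = s := by
    simp only [hσ, div_self hK0.ne']
    rw [Set.projIcc_right]
    exact inf_eq_left.2 s.2.2
  rw [this]

/-- The unit `u p + (1 - p)` for a unit `u` commuting with the idempotent `p`. -/
noncomputable def corner (u : G ι) (p : Matrix ι ι ℂ) (hp : p * p = p) (h : (u : Matrix ι ι ℂ) * p = p * u) : G ι where
  val := u * p + (1 - p)
  inv := (u⁻¹ : G ι) * p + (1 - p)
  val_inv := by
    have h' : ((u⁻¹ : G ι) : Matrix ι ι ℂ) * p = p * (u⁻¹ : G ι) := by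
      rw [Units.inv_mul_eq_iff_eq_mul, ← mul_assoc, h, mul_assoc, Units.mul_inv, mul_one]
    have h1 : p * (1 - p) = 0 := by rw [mul_sub, hp, mul_one, sub_self]
    have h2 : (1 - p) * p = 0 := by rw [sub_mul, hp, one_mul, sub_self]
    have h3 : (1 - p) * (1 - p) = 1 - p := by rw [mul_sub, h2, mul_one, sub_zero]
    rw [mul_add, add_mul, add_mul, h3, mul_assoc (u : Matrix ι ι ℂ) p (1 - p), h1, h', ← mul_assoc (1 - p), h2, mul_assoc (u : Matrix ι ι ℂ),
      ← mul_assoc p p, hp, ← h', ← mul_assoc, Units.mul_inv]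
    simp
  inv_val := by
    have h' : ((u⁻¹ : G ι) : Matrix ι ι ℂ) * p = p * (u⁻¹ : G ι) := by
      rw [Units.inv_mul_eq_iff_eq_mul, ← mul_assoc, h, mul_assoc, Units.mul_inv, mul_one]
    have h1 : p * (1 - p) = 0 := by rw [mul_sub, hp, mul_one, sub_self]
    have h2 : (1 - p) * p = 0 := by rw [sub_mul, hp, one_mul, sub_self]
    have h3 : (1 - p) * (1 - p) = 1 - p := by rw [mul_sub, h2, mul_one, sub_zero]
    rw [mul_add, add_mul, add_mul, h3, mul_assoc _ p (1 - p), h1, h, ← mul_assoc (1 - p), h2, mul_assoc _ p (p * _),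
      ← mul_assoc p p, hp, ← h, ← mul_assoc, Units.inv_mul]
    simp

theorem corner_val (u : G ι) (p : Matrix ι ι ℂ) (hp : p * p = p) (h : (u : Matrix ι ι ℂ) * p = p * u) :
    (corner u p hp h : Matrix ι ι ℂ) = u * p + (1 - p) := rfl

theorem Inv.exists_prime [CompactSpace Y] (I : Inv (Circle × (Circle × Y)))
    (ht : ∀ f : Circle × Y → G ι, Continuous f → I.val (fun x => f (x.1, x.2.2)) = 0)
    (p : Circle × Y → Matrix ι ι ℂ) (hpc : Continuous p) (hp : ∀ y, p y * p y = p y) :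
    ∃ a : Y → G ι, Continuous a ∧ I.val (fun x => idU (p x.2) (hp x.2) x.1) = I.prime.val a := by
  obtain ⟨U, hU, hUp⟩ := exists_transport (fun s y => p (ex s, y)) (by fun_prop) (fun _ _ => hp _)
  set p0 : Y → Matrix ι ι ℂ := fun y => p (1, y) with hp0
  have hp0c : Continuous p0 := by fun_prop
  have hp0i : ∀ y, p0 y * p0 y = p0 y := fun y => hp _
  set u : Y → G ι := U 1 with hu
  have huc : Continuous u := hU.continuous continuous_const continuous_id
  have hup : ∀ y, (u y : Matrix ι ι ℂ) * p0 y = p0 y * u y := fun y => by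
    have := hUp 1 y
    simpa [hp0, hu] using this
  set g0 : Circle × Y → G ι := fun z => idU (p0 z.2) (hp0i z.2) z.1 with hg0
  have hg0c : Continuous g0 := by fun_prop
  have hug : ∀ z, Commute (u z.2) (g0 z) := fun z => by
    apply Units.ext; simp [hg0, idU_val, mul_add, add_mul, hup]
  have hUz : IsPath fun (t : unitInterval) (z : Circle × Y) => U t z.2 :=
    ⟨hU.continuous (by fun_prop) (by fun_prop), fun z => hU.zero _⟩
  have hloop : IsLoop fun t (z : Circle × Y) => cm (U t z.2) (g0 z) := hUz.comm hg0c hug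
  have e1 : I.val (fun x => idU (p x.2) (hp x.2) x.1) = I.val (lp fun t (z : Circle × Y) => cm (U t z.2) (g0 z)) := by
    have hg0' : Continuous fun x : Circle × (Circle × Y) => g0 (x.1, x.2.2) := by fun_prop
    have h := I.mul _ _ hloop.continuous_lp hg0'
    rw [ht g0 hg0c, add_zero] at h
    rw [← h]
    congr 1
    funext x
    have hx := hUp (tau x.2.1) x.2.2
    simp only [ex_tau, ex_zero, Set.Icc.coe_zero] at hx
    simp only [lp, cm, inv_mul_cancel_right]
    rw [eq_mul_inv_iff_mul_eq]
    ext1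
    simp [hg0, hp0, idU_val, mul_add, add_mul, hx]
  have e2 : I.val (lp fun t (z : Circle × Y) => cm (U t z.2) (g0 z)) = I.val (lp (pr u g0)) := by
    have hG : Continuous fun z => dsum (g0 z) (1 : G ι) := by fun_prop
    have h1 := hUz.dsum_one (κ := ι)
    have h2 := (isPath_wh' huc).mul (hUz.one_dsum (κ := ι))
    have hend : ∀ z : Circle × Y, dsum (U 1 z.2) (1 : G ι) = Wh (u z.2) ((1 : unitInterval) : ℝ) * dsum 1 (U 1 z.2) := fun z => by
      simp [Wh_one, dsum_mul, hu]
    have hc2 : ∀ t (z : Circle × Y), Commute (dsum (1 : G ι) (U t z.2)) (dsum (g0 z) 1) := fun t z =>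
      commute_dsum (Commute.one_left _) (Commute.one_right _)
    have h3 := I.lp_path_indep h1 h2 hG hend fun z => commute_dsum (hug z) (Commute.one_right _)
    have h4 := I.lp_mul_left (isPath_wh' huc) (hUz.one_dsum (κ := ι)) hG
      (fun z => commute_Wh_one (hug z)) (fun z => hc2 1 z)
    have h5 : I.val (lp fun t (z : Circle × Y) => cm (dsum (1 : G ι) (U t z.2)) (dsum (g0 z) 1)) = 0 := by
      simp only [cm_eq_one (hc2 _ _)]
      exact I.one
    rw [h5, add_zero] at h4
    rw [← I.sum_one (κ := ι) _ hloop.continuous_lp]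
    refine Eq.trans ?_ (h3.trans h4)
    congr 1
    funext x
    simp only [lp, cm]
    simp only [dsum_inv, dsum_mul, inv_one, mul_one]
  have hq : ∀ y, (1 - p0 y) * (1 - p0 y) = 1 - p0 y := fun y => by
    rw [mul_sub, mul_one, sub_mul, one_mul, hp0i, sub_self, sub_zero]
  have huq : ∀ y, (u y : Matrix ι ι ℂ) * (1 - p0 y) = (1 - p0 y) * u y := fun y => by
    rw [mul_sub, sub_mul, hup, mul_one, one_mul]
  have hpq : ∀ y, p0 y * (1 - p0 y) = 0 := fun y => by rw [mul_sub, hp0i, mul_one, sub_self]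
  have hqp : ∀ y, (1 - p0 y) * p0 y = 0 := fun y => by rw [sub_mul, hp0i, one_mul, sub_self]
  set a : Y → G ι := fun y => corner (u y) (p0 y) (hp0i y) (hup y) with ha
  set b : Y → G ι := fun y => corner (u y) (1 - p0 y) (hq y) (huq y) with hb
  have hac : Continuous a := by
    rw [continuous_G_iff]; simp only [ha, corner_val]; fun_prop
  have hbc : Continuous b := by
    rw [continuous_G_iff]; simp only [hb, corner_val]; fun_prop
  have hap : ∀ y, (a y : Matrix ι ι ℂ) * p0 y = p0 y * a y := fun y => by
    simp only [ha, corner_val, add_mul, mul_add, hpq, hqp, mul_assoc, hp0i]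
    rw [← mul_assoc (p0 y), ← hup, mul_assoc, hp0i]
  have haq : ∀ y, (a y : Matrix ι ι ℂ) * (1 - p0 y) = 1 - p0 y := fun y => by
    simp [ha, corner_val, add_mul, mul_assoc, hpq, hq]
  have haq' : ∀ y, (1 - p0 y) * (a y : Matrix ι ι ℂ) = 1 - p0 y := fun y => by
    simp [ha, corner_val, mul_add, hup, ← mul_assoc, hqp, hq]
  have hbp : ∀ y, (b y : Matrix ι ι ℂ) * p0 y = p0 y := fun y => by
    simp [hb, corner_val, add_mul, mul_assoc, hqp, hp0i]
  have hbp' : ∀ y, p0 y * (b y : Matrix ι ι ℂ) = p0 y := fun y => by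
    simp [hb, corner_val, mul_add, huq, ← mul_assoc, hpq, hp0i]
  have hub : ∀ y, u y = a y * b y := fun y => by
    ext1
    have : (b y : Matrix ι ι ℂ) = u y * (1 - p0 y) + p0 y := by simp [hb, corner_val]
    rw [Units.val_mul, this, mul_add, hap, huq, ← mul_assoc, haq]
    simp only [ha, corner_val, mul_add, hpq, hup, ← mul_assoc, hp0i]
    rw [← huq, ← hup]; simp [mul_sub]
  have hab : ∀ y, Commute (a y) (b y) := fun y => by
    have h' : Commute (u y) (a y) := by
      apply Units.ext
      simp only [Units.val_mul, ha, corner_val, mul_add, add_mul]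
      rw [huq, mul_assoc _ (p0 y), ← hup]
    rw [hub y] at h'
    have := (Commute.refl (a y)).inv_left.mul_left h'
    rw [inv_mul_cancel_left] at this
    exact this.symm
  have hag : ∀ z : Circle × Y, Commute (a z.2) (g0 z) := fun z => by
    apply Units.ext; simp [hg0, idU_val, mul_add, add_mul, hap]
  have hbg : ∀ z : Circle × Y, Commute (b z.2) (g0 z) := fun z => by
    apply Units.ext; simp [hg0, idU_val, mul_add, add_mul, hbp, hbp']
  set g1 : Circle × Y → G ι := fun z => idU (1 - p0 z.2) (hq z.2) z.1 with hg1
  have hg1c : Continuous g1 := by fun_prop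
  have hag1 : ∀ z : Circle × Y, Commute (a z.2) (g1 z) := fun z => by
    apply Units.ext; simp [hg1, idU_val, mul_add, add_mul, haq, haq']
  refine ⟨a, hac, ?_⟩
  rw [e1, e2, funext hub, I.pr_mul_left hac hbc hg0c hag hbg hab, I.pr_eq_zero hbc hp0c hp0i hbp hbp',
    add_zero, Inv.prime_val]
  have h1 := I.pr_mul_right hac hg0c hg1c hag hag1
  rw [I.pr_eq_zero hac (p := fun y => 1 - p0 y) (by fun_prop) hq haq haq', add_zero] at h1
  have hgg : (fun z => g0 z * g1 z) = fun z : Circle × Y => cs ι z.1 := by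
    funext z
    ext1
    simp only [hg0, hg1, Units.val_mul, idU_val, cs_val, mul_add, add_mul, smul_mul_smul_comm, hpq, mul_one, one_mul, smul_zero, add_zero]
    rw [add_assoc, ← smul_add, add_sub_cancel, sub_smul, one_smul, add_sub_cancel]
  rw [← h1, hgg]

end Transport
end UnitaryCommutator

open scoped Matrix
open Filter Topology

namespace UnitaryCommutator

section Generation
variable {ι : Type} [Fintype ι] [DecidableEq ι]

theorem exists_rank_factorization (P : Matrix ι ι ℂ) (hP : P * P = P) :
    ∃ (r : ℕ) (a : Matrix ι (Fin r) ℂ) (b : Matrix (Fin r) ι ℂ), a * b = P ∧ b * a = 1 := by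
  set f : (ι → ℂ) →ₗ[ℂ] (ι → ℂ) := Matrix.toLin' P with hf
  have hff : ∀ v, f (f v) = f v := fun v => by
    rw [hf, Matrix.toLin'_apply, Matrix.toLin'_apply, Matrix.mulVec_mulVec, hP]
  let B := Module.finBasis ℂ (LinearMap.range f)
  let S := Pi.basisFun ℂ ι
  refine ⟨_, LinearMap.toMatrix B S (LinearMap.range f).subtype, LinearMap.toMatrix S B f.rangeRestrict, ?_, ?_⟩
  · rw [← LinearMap.toMatrix_comp]
    have : (LinearMap.range f).subtype ∘ₗ f.rangeRestrict = f := by ext; rfl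
    rw [this]
    simp [S, hf, LinearMap.toMatrix_eq_toMatrix']
  · rw [← LinearMap.toMatrix_comp]
    have : f.rangeRestrict ∘ₗ (LinearMap.range f).subtype = LinearMap.id := by
      ext ⟨x, y, rfl⟩ : 2
      simp [hff]
    rw [this, LinearMap.toMatrix_id]

variable {X : Type} [TopologicalSpace X]

theorem Inv.val_cs_fin (I : Inv X) {c : X → Circle} (hc : Continuous c) (r : ℕ) :
    I.val (fun x => cs (Fin r) (c x)) = r * I.val (fun x => cs Unit (c x)) := by
  induction r with
  | zero => simp [I.empty]
  | succ r ih =>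
    let e : Fin r ⊕ Unit ≃ Fin (r + 1) := (Equiv.sumCongr (Equiv.refl _) (Equiv.equivPUnit (Fin 1)).symm).trans finSumFinEquiv
    have h1 := I.sum (fun x => cs (Fin r) (c x)) (fun x => cs Unit (c x)) (by fun_prop) (by fun_prop)
    rw [← I.reindex e _ (by fun_prop)] at h1
    have h2 : ∀ x, reix e (dsum (cs (Fin r) (c x)) (cs Unit (c x))) = cs (Fin (r + 1)) (c x) := fun x => by
      have h3 : dsum (cs (Fin r) (c x)) (cs Unit (c x)) = cs _ (c x) := by
        ext1; simp [cs_val, dsum_val, ← Matrix.fromBlocks_one, Matrix.fromBlocks_smul]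
      rw [h3]; ext1; ext i j; simp [cs_val, reix_val, Matrix.one_apply]
    simp only [h2] at h1
    rw [h1, ih]; push_cast; ring

theorem Inv.exists_rank (I : Inv X) {c : X → Circle} (hc : Continuous c) (P : Matrix ι ι ℂ) (hP : P * P = P) :
    ∃ r : ℕ, I.val (fun x => idU P hP (c x)) = r * I.val (fun x => cs Unit (c x)) := by
  obtain ⟨r, a, b, hab, hba⟩ := exists_rank_factorization P hP
  refine ⟨r, ?_⟩
  rw [← I.val_cs_fin hc r]
  simp only [← idU_one]
  refine I.idem_iso (fun _ => P) (fun _ => 1) (fun _ => a) (fun _ => b) (fun _ => hP) (fun _ => one_mul 1)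
    continuous_const continuous_const (fun _ => hab) (fun _ => hba) (fun _ => ?_) (fun _ => ?_) c hc
  · rw [← hab, Matrix.mul_assoc, hba, Matrix.mul_one]
  · rw [← hab, ← Matrix.mul_assoc, hba, Matrix.one_mul]

theorem Inv.generated_circle (I : Inv (Circle × Unit))
    (h : ∀ {κ : Type} [Fintype κ] [DecidableEq κ] (f : Unit → G κ), I.val (fun x => f x.2) = 0)
    (g : Circle × Unit → G ι) (hg : Continuous g) : ∃ k : ℤ, I.val g = k * I.val fun x => cs Unit x.1 := by
  obtain ⟨κ, _, _, p, hpc, hp, k, hk⟩ := exists_idempotent g hg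
  rw [hk I fun f _ => h f]
  obtain ⟨r, hr⟩ := I.exists_rank (c := fun x => x.1) (by fun_prop) (p ()) (hp ())
  obtain ⟨s, hs⟩ := I.exists_rank (c := fun x => x.1) (by fun_prop) (1 : Matrix ι ι ℂ) (one_mul 1)
  simp only [idU_one] at hs
  refine ⟨r - k * s, ?_⟩
  rw [hs]
  have : (I.val fun x => idU (p x.2) (hp x.2) x.1) = I.val fun x => idU (p ()) (hp ()) x.1 := rfl
  rw [this, hr]
  push_cast; ring

theorem Inv.generated_step {Y : Type} [TopologicalSpace Y] [CompactSpace Y] [T2Space Y]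
    (I : Inv (Circle × (Circle × Y)))
    (hz : ∀ {κ : Type} [Fintype κ] [DecidableEq κ] (f : Circle × Y → G κ), Continuous f →
      I.val (fun x => f x.2) = 0)
    (ht : ∀ {κ : Type} [Fintype κ] [DecidableEq κ] (f : Circle × Y → G κ), Continuous f →
      I.val (fun x => f (x.1, x.2.2)) = 0) {c : ℂ}
    (hgen : ∀ {κ : Type} [Fintype κ] [DecidableEq κ] (a : Y → G κ), Continuous a →
      ∃ k : ℤ, I.prime.val a = k * c)
    (g : Circle × (Circle × Y) → G ι) (hg : Continuous g) : ∃ k : ℤ, I.val g = k * c := by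
  obtain ⟨κ, _, _, p, hpc, hp, k, hk⟩ := exists_idempotent g hg
  rw [hk I fun f hf => hz f hf, ht (fun z => cs ι z.1) (by fun_prop), mul_zero, sub_zero]
  obtain ⟨a, ha, h⟩ := I.exists_prime ht p hpc hp
  rw [h]
  exact hgen a ha

end Generation

/-- The torus of dimension `2 m + 1`. -/
def X : ℕ → Type
  | 0 => Circle × Unit
  | m + 1 => Circle × (Circle × X m)

noncomputable instance topX : ∀ m, TopologicalSpace (X m)
  | 0 => inferInstanceAs (TopologicalSpace (Circle × Unit))
  | m + 1 =>
    have := topX m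
    inferInstanceAs (TopologicalSpace (Circle × (Circle × X m)))

theorem compact_X : ∀ m, CompactSpace (X m)
  | 0 => inferInstanceAs (CompactSpace (Circle × Unit))
  | m + 1 =>
    have := compact_X m
    inferInstanceAs (CompactSpace (Circle × (Circle × X m)))

theorem t2_X : ∀ m, T2Space (X m)
  | 0 => inferInstanceAs (T2Space (Circle × Unit))
  | m + 1 =>
    have := t2_X m
    inferInstanceAs (T2Space (Circle × (Circle × X m)))

instance (m : ℕ) : CompactSpace (X m) := compact_X m

instance (m : ℕ) : T2Space (X m) := t2_X m

/-- The map `f` does not depend on the coordinate with index `j`. -/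
def Ind {T : Type} : ∀ (m _ : ℕ) (_ : X m → T), Prop
  | 0, _, f => ∀ x x', f x = f x'
  | _ + 1, 0, f => ∀ z z' w, f (z, w) = f (z', w)
  | _ + 1, 1, f => ∀ z t t' y, f (z, (t, y)) = f (z, (t', y))
  | m + 1, j + 2, f => ∀ z t, Ind m j fun y => f (z, (t, y))

theorem Ind.comp {T S : Type} (φ : T → S) : ∀ (m j : ℕ) (f : X m → T), Ind m j f → Ind m j fun x => φ (f x)
  | 0, _, _, h => fun x x' => congrArg φ (h x x')
  | _ + 1, 0, _, h => fun z z' w => congrArg φ (h z z' w)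
  | _ + 1, 1, _, h => fun z t t' y => congrArg φ (h z t t' y)
  | m + 1, j + 2, f, h => fun z t => Ind.comp φ m j (fun y => f (z, (t, y))) (h z t)

/-- The functional vanishes on maps independent of one of the coordinates. -/
def Coll (m : ℕ) (I : Inv (X m)) : Prop :=
  ∀ j ≤ 2 * m, ∀ {κ : Type} [Fintype κ] [DecidableEq κ] (f : X m → G κ), Continuous f → Ind m j f → I.val f = 0

/-- Transgression along the first two coordinates. -/
noncomputable def Inv.primeX {m : ℕ} (I : Inv (X (m + 1))) : Inv (X m) :=
  Inv.prime (Y := X m) I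

theorem Coll.primeX {m : ℕ} {I : Inv (X (m + 1))} (h : Coll (m + 1) I) : Coll m I.primeX := by
  intro j hj κ _ _ f hf hi
  refine h (j + 2) (by omega) _ (pr_loop (Y := X m) hf (by fun_prop) (csY_comm f)).continuous_lp ?_
  intro z t
  exact hi.comp (fun a => cm (Wh a (tau t)) (dsum (cs κ z) 1))

/-- The iterated transgression. -/
noncomputable def top : ∀ m, Inv (X m) → ℂ
  | 0, I => I.val fun x : Circle × Unit => cs Unit x.1
  | m + 1, I => top m I.primeX

theorem Coll.generated : ∀ {m : ℕ} {I : Inv (X m)}, Coll m I →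
    ∀ {ι : Type} [Fintype ι] [DecidableEq ι] (g : X m → G ι), Continuous g → ∃ k : ℤ, I.val g = k * top m I
  | 0, I, h, _, _, _, g, hg => Inv.generated_circle I
      (fun f => h 0 le_rfl (fun x : Circle × Unit => f x.2) (by fun_prop) fun _ _ => rfl) g hg
  | m + 1, I, h, _, _, _, g, hg => Inv.generated_step (Y := X m) I
      (fun f hf => h 0 (by omega) (fun x : Circle × (Circle × X m) => f x.2) (by fun_prop) fun _ _ _ => rfl)
      (fun f hf => h 1 (by omega) (fun x : Circle × (Circle × X m) => f (x.1, x.2.2)) (by fun_prop)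
        fun _ _ _ _ => rfl)
      (fun a ha => h.primeX.generated a ha) g hg

end UnitaryCommutator

open scoped Matrix
open Filter Topology

namespace UnitaryCommutator

section Square
variable {ι : Type} [Fintype ι] [DecidableEq ι] {Y : Type} [TopologicalSpace Y]

theorem cm_inv_comm {H : Type} [Group H] (a b : H) : (cm a b)⁻¹ = cm b a := by simp only [cm]; group

theorem commute_Wh_cs (a : G ι) (c : Circle) (t : ℝ) : Commute (Wh (cs ι c) t) (dsum a a) := by
  have h1 : Commute (dsum (cs ι c) 1) (dsum a a) := commute_dsum (cs_comm _ _) (Commute.one_left _)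
  have h2 : Commute (rot ι (alpha t)) (dsum a a) := rot_comm _ _
  exact ((h1.mul_left h2).mul_left h1.inv_left).mul_left h2.inv_left

theorem commute_dsum_cs (c : Circle) (W : G (ι ⊕ ι)) : Commute W (dsum (cs ι c) (cs ι c)) := by
  have : dsum (cs ι c) (cs ι c) = cs (ι ⊕ ι) c := by
    ext1; simp [cs_val, dsum_val, ← Matrix.fromBlocks_one, Matrix.fromBlocks_smul]
  rw [this]
  exact (cs_comm _ _).symm

theorem Inv.lp_square (I : Inv (Circle × (Circle × Y))) {W V : unitInterval → Circle × Y → G ι}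
    (hW : IsPath W) (hV : IsPath V) (h : ∀ z, Commute (W 1 z) (V 1 z)) :
    I.val (lp fun t z => cm (W t z) (V 1 z)) = I.val (lp fun t z => cm (W 1 z) (V t z)) := by
  have h1 := I.lp_homotopy (fun s t z => cm (W t z) (V (t ⊔ unitInterval.symm s) z)) ?_ ?_
  · have h2 := I.lp_homotopy (fun s t z => cm (W (t ⊔ s) z) (V t z)) ?_ ?_
    · simp only [unitInterval.symm_zero, unitInterval.symm_one, show ∀ t : unitInterval, t ⊔ 1 = 1 from fun t => sup_eq_right.2 t.2.2,
        show ∀ t : unitInterval, t ⊔ 0 = t from fun t => sup_eq_left.2 t.2.1] at h1 h2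
      rw [h1, h2]
    · have e1 : Continuous fun p : unitInterval × unitInterval × (Circle × Y) => W (p.2.1 ⊔ p.1) p.2.2 :=
        hW.continuous (by fun_prop) (by fun_prop)
      have e2 : Continuous fun p : unitInterval × unitInterval × (Circle × Y) => V p.2.1 p.2.2 :=
        hV.continuous (by fun_prop) (by fun_prop)
      exact continuous_cm e1 e2
    · intro s z
      have : (1 : unitInterval) ⊔ s = 1 := sup_eq_left.2 s.2.2
      rw [this, hV.zero, cm_one_right, cm_eq_one (h z)]
  · have e1 : Continuous fun p : unitInterval × unitInterval × (Circle × Y) => V (p.2.1 ⊔ unitInterval.symm p.1) p.2.2 :=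
      hV.continuous (by fun_prop) (by fun_prop)
    have e2 : Continuous fun p : unitInterval × unitInterval × (Circle × Y) => W p.2.1 p.2.2 :=
      hW.continuous (by fun_prop) (by fun_prop)
    exact continuous_cm e2 e1
  · intro s z
    have : (1 : unitInterval) ⊔ unitInterval.symm s = 1 := sup_eq_left.2 (unitInterval.symm s).2.2
    rw [this, hW.zero, cm_one_left, cm_eq_one (h z)]

theorem Inv.lp_central (I : Inv (Circle × (Circle × Y))) {W : unitInterval → Circle × Y → G ι}
    {g d : Circle × Y → G ι} (hW : IsPath W) (hg : Continuous g) (hd : Continuous d)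
    (hWg : ∀ z, Commute (W 1 z) (g z)) (hWd : ∀ t z, Commute (W t z) (d z)) :
    I.val (lp fun t z => cm (W t z) (d z * g z)) = I.val (lp fun t z => cm (W t z) (g z)) := by
  rw [I.lp_mul_right hW hd hg (hWd 1) hWg]
  have : I.val (lp fun t z => cm (W t z) (d z)) = 0 := by
    simp only [cm_eq_one (hWd _ _)]
    exact I.one
  rw [this, zero_add]

/-- The loop obtained by spreading `a` along the Bott line. -/
noncomputable def spread (a : Y → G ι) (t : unitInterval) (z : Circle × Y) : G (ι ⊕ ι) :=
  Wh (cs ι z.1) t * dsum (a z.2) 1 * (Wh (cs ι z.1) t)⁻¹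

theorem continuous_spread {a : Y → G ι} (ha : Continuous a) : Continuous (lp (spread a)) := by
  refine continuous_loop (spread a) ?_ (fun z => ?_) (by fun_prop) (by fun_prop)
  · unfold spread; fun_prop
  · simp only [spread, Set.Icc.coe_zero, Set.Icc.coe_one, Wh_zero, Wh_one, one_mul, inv_one, mul_one,
      dsum_inv, inv_inv, dsum_mul, cs_comm]
    simp

theorem Inv.prime_eq_spread (I : Inv (Circle × (Circle × Y)))
    (hz : ∀ f : Y → G (ι ⊕ ι), Continuous f → I.val (fun x => f x.2.2) = 0)
    (a : Y → G ι) (ha : Continuous a) : I.prime.val a = - I.val (lp (spread a)) := by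
  have hWa := isPath_wh' ha
  have hWz : IsPath fun (t : unitInterval) (z : Circle × Y) => Wh (cs ι z.1) (t : ℝ) :=
    IsPath.wh (a := fun z : Circle × Y => cs ι z.1) (by fun_prop)
  have haz : Continuous fun z : Circle × Y => dsum (a z.2) (1 : G ι) := by fun_prop
  have hcz : Continuous fun z : Circle × Y => dsum (cs ι z.1) (1 : G ι) := by fun_prop
  have hsq := I.lp_square hWa hWz fun z => by
    simp only [Set.Icc.coe_one, Wh_one]
    exact commute_dsum (csY_comm a z) (csY_comm a z).inv_inv
  have e1 : I.val (lp fun (t : unitInterval) (z : Circle × Y) => cm (Wh (a z.2) t) (Wh (cs ι z.1) ((1 : unitInterval) : ℝ))) =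
      2 * I.prime.val a := by
    have hc : ∀ z : Circle × Y, Commute (Wh (a z.2) ((1 : unitInterval) : ℝ)) (dsum (cs ι z.1) 1) := fun z =>
      commute_Wh_one (csY_comm a z)
    have h1 := I.lp_central hWa (d := fun z => dsum (cs ι z.1⁻¹) (cs ι z.1⁻¹)) hcz (by fun_prop) hc
      fun t z => commute_dsum_cs _ _
    have h2 := I.lp_mul_right hWa hcz (g' := fun z => dsum (cs ι z.1⁻¹) (cs ι z.1⁻¹) * dsum (cs ι z.1) 1) (by fun_prop)
      hc (fun z => (commute_dsum_cs _ _).mul_right (hc z))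
    rw [h1, ← two_mul] at h2
    rw [Inv.prime_val]
    refine Eq.trans ?_ h2
    simp [dsum_mul]
  have e2 : I.val (lp fun (t : unitInterval) (z : Circle × Y) => cm (Wh (cs ι z.1) t) (Wh (a z.2) ((1 : unitInterval) : ℝ))) =
      2 * I.val (lp (spread a)) := by
    have hc : ∀ z : Circle × Y, Commute (Wh (cs ι z.1) ((1 : unitInterval) : ℝ)) (dsum (a z.2) 1) := fun z =>
      commute_Wh_one (csY_comm a z).symm
    have h1 := I.lp_central hWz (d := fun z => dsum (a z.2)⁻¹ (a z.2)⁻¹) haz (by fun_prop) hc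
      fun t z => commute_Wh_cs _ _ _
    have h2 := I.lp_mul_right hWz haz (g' := fun z => dsum (a z.2)⁻¹ (a z.2)⁻¹ * dsum (a z.2) 1) (by fun_prop)
      hc (fun z => (commute_Wh_cs _ _ _).mul_right (hc z))
    rw [h1, ← two_mul] at h2
    have h3 := I.mul _ (fun x => (dsum (a x.2.2) (1 : G ι))⁻¹) (continuous_spread ha) (by fun_prop)
    rw [hz (fun y => (dsum (a y) (1 : G ι))⁻¹) (by fun_prop), add_zero] at h3
    rw [← h3]
    refine Eq.trans ?_ h2
    simp [dsum_mul]
  rw [e1] at hsq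
  have e3 := I.inv _ (hWz.comm (g := fun z => Wh (a z.2) ((1 : unitInterval) : ℝ)) (by fun_prop) fun z => by
    simp only [Set.Icc.coe_one, Wh_one]
    exact commute_dsum (csY_comm a z).symm (csY_comm a z).symm.inv_inv).continuous_lp
  rw [e2] at e3
  have e4 : (fun x => (lp (fun (t : unitInterval) (z : Circle × Y) => cm (Wh (cs ι z.1) (t : ℝ)) (Wh (a z.2) ((1 : unitInterval) : ℝ))) x)⁻¹) =
      lp fun (t : unitInterval) (z : Circle × Y) => cm (Wh (a z.2) ((1 : unitInterval) : ℝ)) (Wh (cs ι z.1) (t : ℝ)) := by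
    funext x; simp only [lp, cm_inv_comm]
  rw [e4, ← hsq] at e3
  linear_combination e3 / 2

end Square
end UnitaryCommutator

open scoped Matrix
open Filter Topology

namespace UnitaryCommutator

section RankOne
variable {ι κ : Type} [Fintype ι] [DecidableEq ι] [Fintype κ] [DecidableEq κ]

/-- Orthogonal projections onto lines. -/
def RankOne (P : Matrix ι ι ℂ) : Prop := ∃ v : ι → ℂ, star v ⬝ᵥ v = 1 ∧ P = Matrix.vecMulVec v (star v)

theorem RankOne.idem {P : Matrix ι ι ℂ} (h : RankOne P) : P * P = P := by
  obtain ⟨v, hv, rfl⟩ := h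
  rw [Matrix.vecMulVec_mul_vecMulVec, hv]; simp

theorem RankOne.herm {P : Matrix ι ι ℂ} (h : RankOne P) : Pᴴ = P := by
  obtain ⟨v, hv, rfl⟩ := h
  rw [Matrix.conjTranspose_vecMulVec, star_star]

open scoped ComplexOrder in
theorem dotProduct_star_self_ne_zero {v : ι → ℂ} (hv : v ≠ 0) : star v ⬝ᵥ v ≠ 0 := by
  intro h
  exact hv (dotProduct_star_self_eq_zero.1 h)

theorem exists_unit_multiple {v : ι → ℂ} (hv : v ≠ 0) :
    ∃ u : ι → ℂ, star u ⬝ᵥ u = 1 ∧ Matrix.vecMulVec u (star u) = (star v ⬝ᵥ v)⁻¹ • Matrix.vecMulVec v (star v) := by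
  set r : ℝ := ∑ i, ‖v i‖ ^ 2 with hr
  have h1 : star v ⬝ᵥ v = (r : ℂ) := by
    simp only [dotProduct, hr, Pi.star_apply, RCLike.star_def, Complex.conj_mul']
    push_cast; rfl
  have hr0 : 0 ≤ r := Finset.sum_nonneg fun _ _ => by positivity
  have hrn : (r : ℂ) ≠ 0 := by rw [← h1]; exact dotProduct_star_self_ne_zero hv
  have hs : ((Real.sqrt r : ℝ) : ℂ) * (Real.sqrt r : ℝ) = r := by norm_cast; exact Real.mul_self_sqrt hr0
  have hs' : ((Real.sqrt r : ℝ) : ℂ)⁻¹ * ((Real.sqrt r : ℝ) : ℂ)⁻¹ = (r : ℂ)⁻¹ := by rw [← mul_inv, hs]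
  have hst : star (((Real.sqrt r : ℝ) : ℂ)⁻¹ • v) = ((Real.sqrt r : ℝ) : ℂ)⁻¹ • star v := by
    rw [star_smul]; simp
  refine ⟨((Real.sqrt r : ℝ) : ℂ)⁻¹ • v, ?_, ?_⟩
  · rw [hst, smul_dotProduct, dotProduct_smul, h1, smul_smul, hs', smul_eq_mul, inv_mul_cancel₀ hrn]
  · rw [hst, Matrix.smul_vecMulVec, Matrix.vecMulVec_smul, h1, smul_smul, hs']

/-- Compression of a line by a matrix that does not kill it. -/
theorem RankOne.push {X : Type} [TopologicalSpace X] {Q : X → Matrix κ κ ℂ} (hQc : Continuous Q)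
    (μ : Matrix ι κ ℂ) (hQ : ∀ x, ∃ v : κ → ℂ, star v ⬝ᵥ v = 1 ∧ Q x = Matrix.vecMulVec v (star v) ∧ μ *ᵥ v ≠ 0) :
    ∃ (P : X → Matrix ι ι ℂ) (_ : Continuous P) (hP : ∀ x, RankOne (P x)) (hQ' : ∀ x, RankOne (Q x)),
      ∀ (I : Inv X) (c : X → Circle), Continuous c →
        I.val (fun x => idU (P x) (hP x).idem (c x)) = I.val (fun x => idU (Q x) (hQ' x).idem (c x)) := by
  have hQ' : ∀ x, RankOne (Q x) := fun x => by
    obtain ⟨v, h1, h2, _⟩ := hQ x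
    exact ⟨v, h1, h2⟩
  set s : X → ℂ := fun x => (μ * Q x * μᴴ).trace with hs
  have hsc : Continuous s := by fun_prop
  have hv : ∀ x, ∃ v : κ → ℂ, star v ⬝ᵥ v = 1 ∧ Q x = Matrix.vecMulVec v (star v) ∧ μ *ᵥ v ≠ 0 ∧
      s x = star (μ *ᵥ v) ⬝ᵥ (μ *ᵥ v) ∧ μ * Q x * μᴴ = Matrix.vecMulVec (μ *ᵥ v) (star (μ *ᵥ v)) := fun x => by
    obtain ⟨v, h1, h2, h3⟩ := hQ x
    have h4 : μ * Q x * μᴴ = Matrix.vecMulVec (μ *ᵥ v) (star (μ *ᵥ v)) := by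
      rw [h2, Matrix.mul_vecMulVec, Matrix.vecMulVec_mul, Matrix.star_mulVec]
    refine ⟨v, h1, h2, h3, ?_, h4⟩
    simp only [hs]
    rw [h4, Matrix.trace_vecMulVec, dotProduct_comm]
  have hs0 : ∀ x, s x ≠ 0 := fun x => by
    obtain ⟨v, _, _, h3, h4, _⟩ := hv x
    rw [h4]; exact dotProduct_star_self_ne_zero h3
  have hsi : Continuous fun x => (s x)⁻¹ := hsc.inv₀ hs0
  set P : X → Matrix ι ι ℂ := fun x => (s x)⁻¹ • (μ * Q x * μᴴ) with hPd
  have hPc : Continuous P := by fun_prop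
  have hP : ∀ x, RankOne (P x) := fun x => by
    obtain ⟨v, _, _, h3, h4, h5⟩ := hv x
    obtain ⟨u, hu, hu'⟩ := exists_unit_multiple h3
    exact ⟨u, hu, by rw [hu', hPd, ← h4, ← h5]⟩
  have hKQ : ∀ x, Q x * (μᴴ * μ) * Q x = s x • Q x := fun x => by
    obtain ⟨v, h1, h2, h3, h4, h5⟩ := hv x
    rw [h4, h2, Matrix.vecMulVec_mul, Matrix.vecMulVec_mul_vecMulVec, Matrix.star_mulVec, ← Matrix.vecMul_vecMul,
      Matrix.dotProduct_mulVec]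
    rw [Matrix.vecMulVec_smul]
  refine ⟨P, hPc, hP, hQ', fun I c hc => ?_⟩
  have hab : ∀ x, ((s x)⁻¹ • (μ * Q x)) * (Q x * μᴴ) = P x := fun x => by
    simp only [hPd]
    rw [Matrix.smul_mul, Matrix.mul_assoc μ, ← Matrix.mul_assoc (Q x), (hQ' x).idem, Matrix.mul_assoc μ]
  have hba : ∀ x, (Q x * μᴴ) * ((s x)⁻¹ • (μ * Q x)) = Q x := fun x => by
    rw [Matrix.mul_smul, Matrix.mul_assoc, ← Matrix.mul_assoc μᴴ, ← Matrix.mul_assoc, hKQ, inv_smul_smul₀ (hs0 x)]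
  refine I.idem_iso P Q (fun x => (s x)⁻¹ • (μ * Q x)) (fun x => Q x * μᴴ) _ _ (by fun_prop) (by fun_prop) hab hba ?_ ?_ c hc
  · intro x
    rw [← hab, Matrix.mul_assoc, hba, Matrix.smul_mul, Matrix.mul_assoc, (hQ' x).idem]
  · intro x
    rw [← hab, ← Matrix.mul_assoc, hba, ← Matrix.mul_assoc, (hQ' x).idem]

/-- The inverse of the unit is its adjoint. -/
def IsU (W : G ι) : Prop := ((W⁻¹ : G ι) : Matrix ι ι ℂ) = (W : Matrix ι ι ℂ)ᴴ

theorem IsU.mul {W V : G ι} (h : IsU W) (h' : IsU V) : IsU (W * V) := by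
  rw [IsU] at *
  rw [mul_inv_rev, Units.val_mul, Units.val_mul, h, h', Matrix.conjTranspose_mul]

theorem IsU.inv {W : G ι} (h : IsU W) : IsU W⁻¹ := by
  rw [IsU] at *
  rw [inv_inv, h, Matrix.conjTranspose_conjTranspose]

theorem isU_one : IsU (1 : G ι) := by simp [IsU]

theorem isU_cs (c : Circle) : IsU (cs ι c) := by
  rw [IsU, ← map_inv, cs_val, cs_val, Matrix.conjTranspose_smul, Matrix.conjTranspose_one, Circle.coe_inv_eq_conj]
  rfl

theorem isU_dsum {a : G ι} {b : G κ} (ha : IsU a) (hb : IsU b) : IsU (dsum a b) := by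
  rw [IsU] at *
  rw [dsum_inv, dsum_val, dsum_val, ha, hb, Matrix.fromBlocks_conjTranspose]; simp

theorem isU_rot (x : ℝ) : IsU (rot ι x) := by
  rw [IsU, inv_val_eq, rot_inv_val, rot_val, Matrix.fromBlocks_conjTranspose]
  simp only [Matrix.conjTranspose_smul, Matrix.conjTranspose_one, star_neg]
  simp only [RCLike.star_def, Complex.conj_ofReal]

theorem isU_Wh {a : G ι} (ha : IsU a) (t : ℝ) : IsU (Wh a t) :=
  (((isU_dsum ha isU_one).mul (isU_rot _)).mul (isU_dsum ha isU_one).inv).mul (isU_rot _).inv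

theorem Wh_cs_mulVec (c : Circle) (t : ℝ) (v : ι → ℂ) :
    (Wh (cs ι c) t : Matrix (ι ⊕ ι) (ι ⊕ ι) ℂ) *ᵥ Sum.elim v 0 =
      Sum.elim (((Real.cos (alpha t) : ℂ) ^ 2 + c * (Real.sin (alpha t) : ℂ) ^ 2) • v)
      (((Real.cos (alpha t) : ℂ) * Real.sin (alpha t) * ((c⁻¹ : Circle) - 1)) • v) := by
  have h : ((cs ι c)⁻¹ : G ι) = cs ι c⁻¹ := (map_inv _ _).symm
  rw [Wh, dsum_inv, h, inv_one, Units.val_mul, Units.val_mul, Units.val_mul, inv_val_eq, rot_inv_val, rot_val, dsum_val, dsum_val,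
    cs_val, cs_val, Matrix.fromBlocks_multiply, Matrix.fromBlocks_multiply, Matrix.fromBlocks_multiply,
    Matrix.fromBlocks_mulVec]
  have hc : (c : ℂ) ≠ 0 := c.coe_ne_zero
  simp only [Matrix.mulVec_zero, add_zero, Sum.elim_comp_inl, Sum.elim_comp_inr, Units.val_one, mul_one, one_mul,
    Matrix.mul_zero, Matrix.zero_mul, zero_add, smul_mul_smul_comm, ← add_smul, Matrix.smul_mulVec, Matrix.one_mulVec, Circle.coe_inv]
  congr 2
  · field_simp
  · field_simp
    ring

end RankOne

/-- The last circle coordinate. -/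
noncomputable def wc : ∀ m, X m → Circle
  | 0 => fun x : Circle × Unit => x.1
  | m + 1 => fun x : Circle × (Circle × X m) => wc m x.2.2

theorem continuous_wc : ∀ m, Continuous (wc m)
  | 0 => (by fun_prop : Continuous fun x : Circle × Unit => x.1)
  | m + 1 => (continuous_wc m).comp (by fun_prop : Continuous fun x : Circle × (Circle × X m) => x.2.2)

/-- Multiplication of polynomials of degree `1` and `m`, in coordinates. -/
def polyMul (m : ℕ) : Matrix (Fin (m + 1)) (Fin m ⊕ Fin m) ℂ := fun k i =>
  Sum.elim (fun i => if k = Fin.castSucc i then 1 else 0) (fun i => if k = Fin.succ i then 1 else 0) i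

theorem polyMul_ne_zero {m : ℕ} {α β : ℂ} {v : Fin m → ℂ} (hv : v ≠ 0) (h : α ≠ 0 ∨ β ≠ 0) :
    polyMul m *ᵥ Sum.elim (α • v) (β • v) ≠ 0 := by
  intro h0
  have key : (Polynomial.C α + Polynomial.C β * Polynomial.X) * ∑ i : Fin m, Polynomial.C (v i) * Polynomial.X ^ (i : ℕ) =
      ∑ k : Fin (m + 1), Polynomial.C ((polyMul m *ᵥ Sum.elim (α • v) (β • v)) k) * Polynomial.X ^ (k : ℕ) := by
    simp only [Matrix.mulVec, dotProduct, polyMul, Fintype.sum_sum_type, Sum.elim_inl, Sum.elim_inr, map_add, map_sum,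
      add_mul, Finset.sum_mul, Finset.sum_add_distrib, Finset.mul_sum]
    congr 1
    · rw [Finset.sum_comm]
      refine Finset.sum_congr rfl fun i _ => ?_
      rw [Finset.sum_eq_single (Fin.castSucc i)]
      · simp [mul_assoc]
      · intro b _ hb; simp [hb]
      · simp
    · rw [Finset.sum_comm]
      refine Finset.sum_congr rfl fun i _ => ?_
      rw [Finset.sum_eq_single (Fin.succ i)]
      · simp; ring
      · intro b _ hb; simp [hb]
      · simp
  rw [h0] at key
  simp only [Pi.zero_apply, map_zero, zero_mul, Finset.sum_const_zero, mul_eq_zero] at key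
  rcases key with h1 | h1
  · have ha := congrArg (fun p => p.coeff 0) h1
    have hb := congrArg (fun p => p.coeff 1) h1
    simp at ha hb
    simp [ha, hb] at h
  · apply hv
    funext i
    have := congrArg (fun p => p.coeff i) h1
    simp only [Polynomial.finsetSum_coeff, Polynomial.coeff_C_mul_X_pow, Polynomial.coeff_zero] at this
    rw [Finset.sum_eq_single i] at this
    · simpa using this
    · intro b _ hb
      rw [if_neg fun h => hb (Fin.ext h.symm)]
    · simp

/-- The Bott line bundle `1 ⊗ P` on `Circle × Circle`, in families. -/
noncomputable def bottQ {ι Y : Type} [Fintype ι] [DecidableEq ι] (P : Y → Matrix ι ι ℂ) (x : Circle × (Circle × Y)) : Matrix (ι ⊕ ι) (ι ⊕ ι) ℂ :=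
  (Wh (cs ι x.1) (tau x.2.1) : Matrix (ι ⊕ ι) (ι ⊕ ι) ℂ) * Matrix.fromBlocks (P x.2.2) 0 0 0 * (((Wh (cs ι x.1) (tau x.2.1))⁻¹ : G (ι ⊕ ι)) : Matrix (ι ⊕ ι) (ι ⊕ ι) ℂ)

section BottQ
variable {ι : Type} [Fintype ι] [DecidableEq ι] {Y : Type} [TopologicalSpace Y]

theorem continuous_bottQ {P : Y → Matrix ι ι ℂ} (hP : Continuous P) : Continuous (bottQ P) := by
  refine continuous_loop (fun (t : unitInterval) (z : Circle × Y) => (Wh (cs ι z.1) t : Matrix (ι ⊕ ι) (ι ⊕ ι) ℂ) *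
    Matrix.fromBlocks (P z.2) 0 0 0 * (((Wh (cs ι z.1) t)⁻¹ : G (ι ⊕ ι)) : Matrix (ι ⊕ ι) (ι ⊕ ι) ℂ)) ?_ (fun z => ?_) (c := fun x : Circle × (Circle × Y) => x.2.1) (by fun_prop)
    (φ := fun x : Circle × (Circle × Y) => (x.1, x.2.2)) (by fun_prop)
  · have h1 : Continuous fun p : unitInterval × Circle × Y => Wh (cs ι p.2.1) (p.1 : ℝ) := by fun_prop
    have h2 : Continuous fun p : unitInterval × Circle × Y => Matrix.fromBlocks (P p.2.2) (0 : Matrix ι ι ℂ) (0 : Matrix ι ι ℂ) (0 : Matrix ι ι ℂ) :=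
      Continuous.matrix_fromBlocks (by fun_prop) (by fun_prop) (by fun_prop) (by fun_prop)
    exact ((continuous_G_val h1).mul h2).mul (continuous_G_val h1.inv)
  · simp only [Set.Icc.coe_zero, Set.Icc.coe_one, Wh_zero, Wh_one, dsum_inv, ← map_inv, dsum_val, inv_inv, cs_val, Units.val_one, inv_one,
      one_mul, mul_one, Matrix.fromBlocks_multiply]
    simp [smul_smul]

theorem spread_idU {P : Y → Matrix ι ι ℂ} (hP : ∀ y, P y * P y = P y) (hQ : ∀ x, bottQ P x * bottQ P x = bottQ P x) (c : Y → Circle) :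
    lp (spread fun y => idU (P y) (hP y) (c y)) = fun x => idU (bottQ P x) (hQ x) (c x.2.2) := by
  funext x
  ext1
  have : (dsum (idU (P x.2.2) (hP x.2.2) (c x.2.2)) (1 : G ι) : Matrix (ι ⊕ ι) (ι ⊕ ι) ℂ) =
      1 + ((c x.2.2 : ℂ) - 1) • Matrix.fromBlocks (P x.2.2) 0 0 0 := by
    rw [dsum_val, idU_val, Matrix.fromBlocks_smul, ← Matrix.fromBlocks_one, Matrix.fromBlocks_add]; simp
  simp only [lp, spread, Units.val_mul, this, idU_val, bottQ, mul_add, add_mul, mul_one, Units.mul_inv, Matrix.mul_smul, Matrix.smul_mul]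

theorem bottQ_rank {P : Y → Matrix ι ι ℂ} (hP : ∀ y, RankOne (P y)) (x : Circle × (Circle × Y)) :
    ∃ (v : ι → ℂ) (α β : ℂ), v ≠ 0 ∧ (α ≠ 0 ∨ β ≠ 0) ∧ star (Sum.elim (α • v) (β • v)) ⬝ᵥ Sum.elim (α • v) (β • v) = 1 ∧
      bottQ P x = Matrix.vecMulVec (Sum.elim (α • v) (β • v)) (star (Sum.elim (α • v) (β • v))) := by
  obtain ⟨v, hv, hPv⟩ := hP x.2.2
  have hW := Wh_cs_mulVec x.1 (tau x.2.1) v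
  set α := (Real.cos (alpha (tau x.2.1)) : ℂ) ^ 2 + x.1 * (Real.sin (alpha (tau x.2.1)) : ℂ) ^ 2
  set β := (Real.cos (alpha (tau x.2.1)) : ℂ) * Real.sin (alpha (tau x.2.1)) * ((x.1⁻¹ : Circle) - 1)
  have hU : IsU (Wh (cs ι x.1) (tau x.2.1)) := isU_Wh (isU_cs _) _
  have h1 : star (Sum.elim (α • v) (β • v)) ⬝ᵥ Sum.elim (α • v) (β • v) = 1 := by
    rw [← hW, Matrix.star_mulVec, Matrix.dotProduct_mulVec, Matrix.vecMul_vecMul, ← hU, Units.inv_mul, Matrix.vecMul_one]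
    rw [← hv]
    simp [dotProduct]
  refine ⟨v, α, β, ?_, ?_, h1, ?_⟩
  · rintro rfl; simp at hv
  · by_contra! h
    rw [h.1, h.2] at h1
    simp [dotProduct] at h1
  · rw [bottQ, hU, ← hW, Matrix.star_mulVec, ← Matrix.vecMulVec_mul, ← Matrix.mul_vecMulVec]
    congr 2
    rw [hPv]
    ext (i | i) (j | j) <;> simp [Matrix.vecMulVec_apply]

end BottQ

theorem exists_bott (m : ℕ) : ∃ (P : X m → Matrix (Fin (m + 1)) (Fin (m + 1)) ℂ) (_ : Continuous P) (hP : ∀ x, RankOne (P x)),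
    ∀ J : Inv (X m), Coll m J → J.val (fun x => idU (P x) (hP x).idem (wc m x)) = (-1) ^ m * top m J := by
  induction m with
  | zero =>
    have h1 : RankOne (1 : Matrix (Fin (0 + 1)) (Fin (0 + 1)) ℂ) :=
      ⟨1, by simp [dotProduct], by ext i j; simp [Matrix.vecMulVec_apply, Matrix.one_apply, Subsingleton.elim (α := Fin 1) i j]⟩
    refine ⟨fun _ => 1, continuous_const, fun _ => h1, fun J hJ => ?_⟩
    simp only [idU_one]
    rw [J.val_cs_fin (continuous_wc 0)]
    simp [top, wc]
    rfl
  | succ m ih =>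
    obtain ⟨P, hPc, hP, ih⟩ := ih
    obtain ⟨P', hP'c, hP', hQ, h⟩ := RankOne.push (X := Circle × (Circle × X m)) (continuous_bottQ hPc) (polyMul (m + 1)) (fun x => by
      obtain ⟨v, α, β, hv, hαβ, h1, h2⟩ := bottQ_rank hP x
      exact ⟨_, h1, h2, polyMul_ne_zero hv hαβ⟩)
    refine ⟨P', hP'c, hP', fun J hJ => ?_⟩
    have h1 := h J (fun x => wc m x.2.2) ((continuous_wc m).comp (by fun_prop))
    refine h1.trans ?_
    have h2 := Inv.prime_eq_spread (Y := X m) J (fun f hf => hJ 0 (by omega) (fun x : Circle × (Circle × X m) => f x.2.2)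
      (hf.comp (by fun_prop)) fun _ _ _ => rfl) (fun y => idU (P y) (hP y).idem (wc m y)) (continuous_idU hPc (continuous_wc m))
    rw [spread_idU (fun y => (hP y).idem) (fun x => (hQ x).idem)] at h2
    have h3 := ih J.primeX hJ.primeX
    have h4 : J.primeX.val (fun y => idU (P y) (hP y).idem (wc m y)) = Inv.val (Inv.prime (Y := X m) J) (fun y => idU (P y) (hP y).idem (wc m y)) := rfl
    rw [h4, h2] at h3
    rw [top, pow_succ, mul_assoc, mul_comm (-1 : ℂ), ← mul_assoc, ← h3]
    ring

end UnitaryCommutator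

open scoped Matrix
open Filter Topology

namespace UnitaryCommutator

section Unitary
variable {ι : Type} [Fintype ι] [DecidableEq ι]

/-- The inclusion of the unitary group into the invertible matrices. -/
def toG : Matrix.unitaryGroup ι ℂ →* G ι := Unitary.toUnits

@[fun_prop]
theorem continuous_toG {W : Type} [TopologicalSpace W] {f : W → Matrix.unitaryGroup ι ℂ} (hf : Continuous f) :
    Continuous fun w => toG (f w) := by
  rw [continuous_G_iff]
  exact continuous_subtype_val.comp hf

theorem IsU.mem {W : G ι} (h : IsU W) : (W : Matrix ι ι ℂ) ∈ Matrix.unitaryGroup ι ℂ := by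
  rw [Matrix.mem_unitaryGroup_iff, Matrix.star_eq_conjTranspose, ← h, Units.mul_inv]

theorem isU_idU {P : Matrix ι ι ℂ} (hP : RankOne P) (c : Circle) : IsU (idU P hP.idem c) := by
  rw [IsU, ← map_inv, idU_val, idU_val, Circle.coe_inv_eq_conj, Matrix.conjTranspose_add, Matrix.conjTranspose_smul, hP.herm]
  simp

/-- Unitary reflections attached to a line. -/
noncomputable def reflU (P : Matrix ι ι ℂ) (hP : RankOne P) (c : Circle) : Matrix.unitaryGroup ι ℂ :=
  ⟨idU P hP.idem c, (isU_idU hP c).mem⟩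

theorem reflU_pow (P : Matrix ι ι ℂ) (hP : RankOne P) (c : Circle) (n : ℕ) :
    reflU P hP c ^ n = reflU P hP (c ^ n) := by
  apply Subtype.ext
  simp [reflU]

theorem continuous_reflU {W : Type} [TopologicalSpace W] {P : W → Matrix ι ι ℂ} {hP : ∀ x, RankOne (P x)} {c : W → Circle}
    (h1 : Continuous P) (h2 : Continuous c) : Continuous fun x => reflU (P x) (hP x) (c x) :=
  Continuous.subtype_mk (continuous_G_val (continuous_idU h1 h2)) _

/-- Scalar unitary matrices. -/
noncomputable def csU (ι : Type) [Fintype ι] [DecidableEq ι] (c : Circle) : Matrix.unitaryGroup ι ℂ :=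
  ⟨cs ι c, (isU_cs c).mem⟩

theorem toG_csU (c : Circle) : toG (csU ι c) = cs ι c := by ext1; rfl

variable {n : ℕ}

/-- The path of lines from the first coordinate axis to another one. -/
noncomputable def axis (i : Fin (n + 1)) (s : ℝ) : Matrix (Fin (n + 1)) (Fin (n + 1)) ℂ :=
  let v : Fin (n + 1) → ℂ := Pi.single 0 ((1 - s : ℝ) : ℂ) + Pi.single i (s : ℂ)
  (star v ⬝ᵥ v)⁻¹ • Matrix.vecMulVec v (star v)

theorem axis_ne_zero (i : Fin (n + 1)) (s : ℝ) :
    (Pi.single 0 ((1 - s : ℝ) : ℂ) + Pi.single i (s : ℂ) : Fin (n + 1) → ℂ) ≠ 0 := by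
  intro h
  by_cases hi : i = 0
  · subst hi
    have := congrFun h 0
    simp at this
  · have h1 := congrFun h i
    have h2 := congrFun h 0
    simp [hi] at h1
    simp [h1, Ne.symm hi] at h2

theorem axis_rankOne (i : Fin (n + 1)) (s : ℝ) : RankOne (axis i s) := by
  obtain ⟨u, h1, h2⟩ := exists_unit_multiple (axis_ne_zero i s)
  exact ⟨u, h1, h2.symm⟩

theorem continuous_axis (i : Fin (n + 1)) : Continuous (axis i) := by
  have hv : Continuous fun s : ℝ => (Pi.single 0 ((1 - s : ℝ) : ℂ) + Pi.single i (s : ℂ) : Fin (n + 1) → ℂ) := by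
    refine continuous_pi fun j => ?_
    simp only [Pi.add_apply, Pi.single_apply]
    split_ifs <;> fun_prop
  have h1 := (hv.star.dotProduct hv).inv₀ fun s => dotProduct_star_self_ne_zero (axis_ne_zero i s)
  exact h1.smul (hv.matrix_vecMulVec hv.star)

theorem axis_zero (i : Fin (n + 1)) : axis i 0 = axis 0 0 := by simp [axis]

theorem axis_one (i : Fin (n + 1)) : axis i 1 = Matrix.diagonal (Pi.single i 1) := by
  ext j k
  simp only [axis]
  simp [dotProduct, Matrix.vecMulVec_apply, Matrix.diagonal_apply, Pi.single_apply]
  grind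

/-- A homotopy from the power of a reflection to a scalar loop. -/
noncomputable def split (n : ℕ) (s : unitInterval) (c : Circle) : Matrix.unitaryGroup (Fin (n + 1)) ℂ :=
  (List.ofFn fun i => reflU (axis i s) (axis_rankOne i s) c).prod

theorem continuous_split {W : Type} [TopologicalSpace W] {s : W → unitInterval} {c : W → Circle} (hs : Continuous s)
    (hc : Continuous c) : Continuous fun w => split n (s w) (c w) := by
  simp only [split, List.ofFn_eq_map]
  refine continuous_list_prod _ fun i _ => ?_
  exact continuous_reflU ((continuous_axis i).comp (by fun_prop)) hc

theorem split_zero (c : Circle) : split n 0 c = reflU (axis 0 0) (axis_rankOne 0 0) (c ^ (n + 1)) := by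
  have h : ∀ i : Fin (n + 1), reflU (axis i (0 : unitInterval)) (axis_rankOne i (0 : unitInterval)) c =
      reflU (axis 0 0) (axis_rankOne 0 0) c := fun i => by
    simp only [Set.Icc.coe_zero, axis_zero i]
  simp only [split, h]
  rw [List.ofFn_const, List.prod_replicate, reflU_pow]

theorem split_one (c : Circle) : split n 1 c = csU (Fin (n + 1)) c := by
  apply Subtype.ext
  have h : ((split n 1 c : Matrix.unitaryGroup (Fin (n + 1)) ℂ) : Matrix (Fin (n + 1)) (Fin (n + 1)) ℂ) =
      (List.ofFn fun i => Matrix.diagonalRingHom (Fin (n + 1)) ℂ (1 + ((c : ℂ) - 1) • Pi.single i 1)).prod := by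
    rw [split, ← Submonoid.coe_subtype, map_list_prod, List.map_ofFn]
    congr 1
    congr 1
    funext i
    simp only [Function.comp, Submonoid.coe_subtype, reflU, idU_val, Set.Icc.coe_one, axis_one, Matrix.diagonalRingHom_apply]
    ext j k
    by_cases hjk : j = k
    · subst hjk; simp
    · simp [hjk]
  have h' := List.map_ofFn (f := fun i : Fin (n + 1) => (1 + ((c : ℂ) - 1) • Pi.single i 1 : Fin (n + 1) → ℂ))
    (g := Matrix.diagonalRingHom (Fin (n + 1)) ℂ)
  rw [h]
  refine (congrArg List.prod h'.symm).trans ?_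
  rw [← map_list_prod, List.prod_ofFn]
  simp only [csU, cs_val, Matrix.diagonalRingHom_apply]
  rw [Matrix.smul_one_eq_diagonal]
  congr 1
  funext j
  rw [Finset.prod_apply, Finset.prod_eq_single j]
  · simp
  · intro b _ hb
    simp [Pi.single_apply, Ne.symm hb]
  · simp

end Unitary

section Pullback
variable {V W : Type} [TopologicalSpace V] [TopologicalSpace W]

/-- Precomposition with a continuous map. -/
def Inv.comap (I : Inv V) (φ : V → W) (hφ : Continuous φ) : Inv W where
  val f := I.val fun x => f (φ x)
  homotopy F hF := I.homotopy (fun s x => F s (φ x))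
    (hF.comp (by fun_prop : Continuous fun p : unitInterval × V => (p.1, φ p.2)))
  sum f g hf hg := I.sum _ _ (hf.comp hφ) (hg.comp hφ)
  reindex e f hf := I.reindex e _ (hf.comp hφ)
  one := I.one

theorem Inv.val_pow_fst [CompactSpace W] [T2Space W] (I : Inv (Circle × W))
    (hz : ∀ {κ : Type} [Fintype κ] [DecidableEq κ] (f : W → G κ), Continuous f → I.val (fun x => f x.2) = 0)
    {ι : Type} [Fintype ι] [DecidableEq ι] (g : Circle × W → G ι) (hg : Continuous g) (n : ℕ) :
    I.val (fun x => g (x.1 ^ n, x.2)) = n * I.val g := by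
  obtain ⟨κ, _, _, p, hpc, hp, k, hk⟩ := exists_idempotent g hg
  have hφ : Continuous fun x : Circle × W => (x.1 ^ n, x.2) := by fun_prop
  have h1 := hk (I.comap _ hφ) fun f hf => hz f hf
  have h2 := hk I fun f hf => hz f hf
  have e0 : I.val (fun x => g (x.1 ^ n, x.2)) = (I.comap _ hφ).val g := rfl
  have hp1 : Continuous fun x : Circle × W => idU (p x.2) (hp x.2) x.1 :=
    continuous_idU (hpc.comp continuous_snd) continuous_fst
  have e1 : (I.comap _ hφ).val (fun x => idU (p x.2) (hp x.2) x.1) = n * I.val fun x => idU (p x.2) (hp x.2) x.1 := by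
    rw [← I.pow _ hp1]
    simp only [Inv.comap, map_pow]
  have e2 : (I.comap _ hφ).val (fun x => cs ι x.1) = n * I.val fun x => cs ι x.1 := by
    rw [← I.pow _ (by fun_prop)]
    simp only [Inv.comap, map_pow]
  rw [e0, h1, e1, e2, h2]
  ring

end Pullback

section Compare
variable {ι : Type} [Fintype ι] [DecidableEq ι] {Y : Type} [TopologicalSpace Y]
variable (K : unitInterval → Matrix.unitaryGroup ι ℂ × Matrix.unitaryGroup ι ℂ → Matrix.unitaryGroup ι ℂ)

/-- The difference between a null-homotopy of the commutator and the standard stable one. -/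
noncomputable def diffLoop (x : Circle → Matrix.unitaryGroup ι ℂ) (a : Y → Matrix.unitaryGroup ι ℂ) (t : unitInterval)
    (z : Circle × Y) : G (ι ⊕ ι) :=
  (dsum (toG (K t (x z.1, a z.2))) 1)⁻¹ * cm (dsum (toG (x z.1)) 1) (Wh (toG (a z.2)) t)

variable {K}

theorem continuous_diffLoop (hK : Continuous fun p : unitInterval × (Matrix.unitaryGroup ι ℂ × Matrix.unitaryGroup ι ℂ) => K p.1 p.2)
    {W : Type} [TopologicalSpace W] {x : W → Circle → Matrix.unitaryGroup ι ℂ}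
    {a : Y → Matrix.unitaryGroup ι ℂ} (hx : Continuous fun p : W × Circle => x p.1 p.2) (ha : Continuous a) :
    Continuous fun p : W × unitInterval × (Circle × Y) => diffLoop K (x p.1) a p.2.1 p.2.2 := by
  have h1 : Continuous fun p : W × unitInterval × (Circle × Y) => x p.1 p.2.2.1 :=
    hx.comp (by fun_prop : Continuous fun p : W × unitInterval × (Circle × Y) => (p.1, p.2.2.1))
  have h2 : Continuous fun p : W × unitInterval × (Circle × Y) => a p.2.2.2 := by fun_prop
  have h3 : Continuous fun p : W × unitInterval × (Circle × Y) => K p.2.1 (x p.1 p.2.2.1, a p.2.2.2) :=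
    hK.comp ((by fun_prop : Continuous fun p : W × unitInterval × (Circle × Y) => p.2.1).prodMk (h1.prodMk h2))
  unfold diffLoop
  fun_prop

theorem diffLoop_ends (hK0 : ∀ p, K 0 p = 1) (hK1 : ∀ p, K 1 p = cm p.1 p.2)
    (x : Circle → Matrix.unitaryGroup ι ℂ) (a : Y → Matrix.unitaryGroup ι ℂ) (z : Circle × Y) :
    diffLoop K x a 0 z = 1 ∧ diffLoop K x a 1 z = 1 := by
  constructor
  · simp [diffLoop, hK0]
  · simp only [diffLoop, hK1, Set.Icc.coe_one, Wh_one]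
    have : cm (dsum (toG (x z.1)) 1) (dsum (toG (a z.2)) (toG (a z.2))⁻¹) = dsum (toG (cm (x z.1) (a z.2))) 1 := by
      simp only [cm, dsum_inv, dsum_mul, map_mul, map_inv]
      simp
    rw [this, inv_mul_cancel]

theorem isLoop_diffLoop (hK : Continuous fun p : unitInterval × (Matrix.unitaryGroup ι ℂ × Matrix.unitaryGroup ι ℂ) => K p.1 p.2)
    (hK0 : ∀ p, K 0 p = 1) (hK1 : ∀ p, K 1 p = cm p.1 p.2)
    {x : Circle → Matrix.unitaryGroup ι ℂ} {a : Y → Matrix.unitaryGroup ι ℂ} (hx : Continuous x)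
    (ha : Continuous a) : IsLoop (diffLoop K x a) := by
  have h := continuous_diffLoop (W := Unit) (x := fun _ => x) hK (by fun_prop) ha
  have h' : Continuous fun p : unitInterval × (Circle × Y) => diffLoop K x a p.1 p.2 :=
    h.comp (g := fun p : Unit × unitInterval × (Circle × Y) => diffLoop K x a p.2.1 p.2.2)
      (f := fun p : unitInterval × (Circle × Y) => ((), p)) (by fun_prop)
  exact ⟨⟨h',
    fun z => (diffLoop_ends hK0 hK1 x a z).1⟩, fun z => (diffLoop_ends hK0 hK1 x a z).2⟩

theorem val_diffLoop_scalar (hK : Continuous fun p : unitInterval × (Matrix.unitaryGroup ι ℂ × Matrix.unitaryGroup ι ℂ) => K p.1 p.2)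
    (hK0 : ∀ p, K 0 p = 1) (hK1 : ∀ p, K 1 p = cm p.1 p.2)
    (I : Inv (Circle × (Circle × Y))) (hI : ∀ f : Circle × (Circle × Y) → G ι, Continuous f → I.val f = 0)
    {a : Y → Matrix.unitaryGroup ι ℂ} (ha : Continuous a) :
    I.val (lp (diffLoop K (csU ι) a)) = - I.prime.val fun y => toG (a y) := by
  have hcs : Continuous (csU ι) := Continuous.subtype_mk (continuous_G_val (continuous_cs continuous_id)) _
  have hL : IsLoop fun t (z : Circle × Y) => toG (K t (csU ι z.1, a z.2)) := by
    refine ⟨⟨?_, fun z => by simp [hK0]⟩, fun z => ?_⟩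
    · refine continuous_toG (hK.comp (g := fun p : unitInterval × (Matrix.unitaryGroup ι ℂ × Matrix.unitaryGroup ι ℂ) => K p.1 p.2)
        (f := fun p : unitInterval × (Circle × Y) => (p.1, (csU ι p.2.1, a p.2.2))) ?_)
      fun_prop
    · simp only [hK1]
      rw [cm, map_mul, map_mul, map_mul, map_inv, map_inv, toG_csU]
      exact cm_eq_one (cs_comm _ _)
  have h2 := pr_loop (a := fun y => toG (a y)) (by fun_prop) (g := fun z : Circle × Y => cs ι z.1) (by fun_prop) (csY_comm fun y => toG (a y))
  have e : lp (diffLoop K (csU ι) a) = fun x => (dsum (lp (fun t (z : Circle × Y) => toG (K t (csU ι z.1, a z.2))) x) 1)⁻¹ *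
      (lp (pr (fun y => toG (a y)) fun z => cs ι z.1) x)⁻¹ := by
    funext x
    simp only [lp, diffLoop, pr, cm_inv_comm, toG_csU]
  have c1 := hL.continuous_lp
  have c2 := h2.continuous_lp
  rw [e, I.mul _ _ (by fun_prop) (by fun_prop), I.inv _ c2, I.inv _ (by fun_prop), I.sum_one _ c1, hI _ c1, Inv.prime_val]
  ring

end Compare

theorem commutator_not_nullhomotopic_of_inv {m : ℕ} (I : Inv (X (m + 2))) (hI : Coll (m + 2) I)
    (h0 : ∀ f : X (m + 2) → G (Fin (m + 2)), Continuous f → I.val f = 0) (htop : top (m + 2) I ≠ 0)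
    {K : unitInterval → Matrix.unitaryGroup (Fin (m + 2)) ℂ × Matrix.unitaryGroup (Fin (m + 2)) ℂ → Matrix.unitaryGroup (Fin (m + 2)) ℂ}
    (hK : Continuous fun p : unitInterval × (Matrix.unitaryGroup (Fin (m + 2)) ℂ × Matrix.unitaryGroup (Fin (m + 2)) ℂ) => K p.1 p.2)
    (hK0 : ∀ p, K 0 p = 1) (hK1 : ∀ p, K 1 p = cm p.1 p.2) : False := by
  obtain ⟨P, hPc, hP, hb⟩ := exists_bott (m + 1)
  set a : X (m + 1) → Matrix.unitaryGroup (Fin (m + 2)) ℂ := fun y => reflU (P y) (hP y) (wc (m + 1) y)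
  have ha : Continuous a := continuous_reflU hPc (continuous_wc _)
  have h1 := hb I.primeX hI.primeX
  have h2 := val_diffLoop_scalar (Y := X (m + 1)) hK hK0 hK1 I h0 ha
  have h3 : Inv.val (Inv.prime (Y := X (m + 1)) I) (fun y => toG (a y)) = (-1) ^ (m + 1) * top (m + 2) I := by
    refine Eq.trans ?_ h1
    change I.primeX.val _ = _
    congr 1
    funext y
    ext1
    rfl
  have h4 := Inv.lp_homotopy (Y := X (m + 1)) I (fun s => diffLoop K (split (m + 1) s) a)
    (continuous_diffLoop hK (continuous_split continuous_fst continuous_snd) ha)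
    (fun s z => by rw [(diffLoop_ends hK0 hK1 _ _ z).1, (diffLoop_ends hK0 hK1 _ _ z).2])
  set ρ : Circle → Matrix.unitaryGroup (Fin (m + 2)) ℂ := reflU (axis 0 0) (axis_rankOne 0 0)
  have hρ : Continuous ρ := continuous_reflU continuous_const continuous_id
  have h5 : lp (diffLoop K (split (m + 1) 0) a) = fun x => lp (diffLoop K ρ a) (x.1 ^ (m + 2), x.2) := by
    funext x
    simp only [lp, diffLoop, split_zero]
    rfl
  have h6 : split (m + 1) 1 = csU (Fin (m + 2)) := funext split_one
  have hc := (isLoop_diffLoop hK hK0 hK1 hρ ha).continuous_lp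
  have h7 := Inv.val_pow_fst (W := Circle × X (m + 1)) I
    (fun f hf => hI 0 (by omega) (fun x : Circle × (Circle × X (m + 1)) => f x.2) (hf.comp (by fun_prop)) fun _ _ _ => rfl)
    _ hc (m + 2)
  obtain ⟨k, hk⟩ := hI.generated _ hc
  rw [h5, h6] at h4
  have h8 : ((m + 2 : ℕ) : ℂ) * (k * top (m + 2) I) = -((-1) ^ (m + 1) * top (m + 2) I) := by
    rw [← h3, ← hk]
    exact h7.symm.trans (h4.trans h2)
  have h9 : ((m + 2 : ℕ) : ℤ) * k = (-1) ^ m := by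
    have : ((m + 2 : ℕ) : ℂ) * k = (-1) ^ m := by
      apply mul_right_cancel₀ htop
      rw [mul_assoc, h8]; ring
    exact_mod_cast this
  have h10 : IsUnit ((m + 2 : ℕ) : ℤ) := by
    apply isUnit_of_dvd_unit (Dvd.intro k h9)
    exact (isUnit_one.neg).pow m
  rw [Int.isUnit_iff] at h10
  omega

end UnitaryCommutator

open scoped Matrix

namespace UnitaryCommutator

/-- Index type of the fermionic Fock space with `N` modes. -/
def Fock : ℕ → Type
  | 0 => Unit
  | N + 1 => Fock N ⊕ Fock N

instance fintypeFock : ∀ N, Fintype (Fock N)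
  | 0 => inferInstanceAs (Fintype Unit)
  | N + 1 =>
    have := fintypeFock N
    inferInstanceAs (Fintype (Fock N ⊕ Fock N))

instance decEqFock : ∀ N, DecidableEq (Fock N)
  | 0 => inferInstanceAs (DecidableEq Unit)
  | N + 1 =>
    have := decEqFock N
    inferInstanceAs (DecidableEq (Fock N ⊕ Fock N))

/-- The empty state. -/
def lo : ∀ N, Fock N
  | 0 => ()
  | N + 1 => Sum.inl (lo N)

/-- The full state. -/
def hi : ∀ N, Fock N
  | 0 => ()
  | N + 1 => Sum.inr (hi N)

section Fermi
variable (A : Type) [CommRing A]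

/-- Square matrices on Fock space. -/
abbrev FM (N : ℕ) := Matrix (Fock N) (Fock N) A

/-- Block matrices on the Fock space with one more mode. -/
def fblk {N : ℕ} (a b c d : FM A N) : FM A (N + 1) := Matrix.fromBlocks a b c d

variable {A} in
theorem fblk_mul {N : ℕ} (a b c d a' b' c' d' : FM A N) : fblk A a b c d * fblk A a' b' c' d' =
    fblk A (a * a' + b * c') (a * b' + b * d') (c * a' + d * c') (c * b' + d * d') :=
  Matrix.fromBlocks_multiply _ _ _ _ _ _ _ _

variable {A} in
theorem fblk_neg {N : ℕ} (a b c d : FM A N) : -fblk A a b c d = fblk A (-a) (-b) (-c) (-d) :=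
  Matrix.fromBlocks_neg _ _ _ _

/-- Creation operators. -/
def fc : ∀ N, Fin N → FM A N
  | 0 => fun i => i.elim0
  | N + 1 => Fin.cases (fblk A 0 0 1 0) fun i => fblk A (fc N i) 0 0 (-fc N i)

/-- Projections onto the states where a mode is empty. -/
def fp : ∀ N, Fin N → FM A N
  | 0 => fun i => i.elim0
  | N + 1 => Fin.cases (fblk A 1 0 0 0) fun i => fblk A (fp N i) 0 0 (fp N i)

theorem fc_zero (N : ℕ) : fc A (N + 1) 0 = fblk A 0 0 1 0 := rfl
theorem fc_succ (N : ℕ) (i : Fin N) : fc A (N + 1) i.succ = fblk A (fc A N i) 0 0 (-fc A N i) := rfl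
theorem fp_zero (N : ℕ) : fp A (N + 1) 0 = fblk A 1 0 0 0 := rfl
theorem fp_succ (N : ℕ) (i : Fin N) : fp A (N + 1) i.succ = fblk A (fp A N i) 0 0 (fp A N i) := rfl

variable {A}

theorem fblk_map {A' : Type} [CommRing A'] (φ : A →+* A') {N : ℕ} (a b c d : FM A N) :
    (fblk A a b c d).map φ = fblk A' (a.map φ) (b.map φ) (c.map φ) (d.map φ) :=
  Matrix.fromBlocks_map _ _ _ _ _

theorem one_inl_inl {N : ℕ} (x y : Fock N) : (1 : FM A (N + 1)) (Sum.inl x) (Sum.inl y) = (1 : FM A N) x y := by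
  change (1 : Matrix (Fock N ⊕ Fock N) (Fock N ⊕ Fock N) A) (Sum.inl x) (Sum.inl y) = _
  simp [Matrix.one_apply, Sum.inl.injEq]

theorem one_inr_inl {N : ℕ} (x y : Fock N) : (1 : FM A (N + 1)) (Sum.inr x) (Sum.inl y) = 0 :=
  Matrix.one_apply_ne Sum.inr_ne_inl

theorem one_inl_inr {N : ℕ} (x y : Fock N) : (1 : FM A (N + 1)) (Sum.inl x) (Sum.inr y) = 0 :=
  Matrix.one_apply_ne Sum.inl_ne_inr

theorem sum_fm_apply {N : ℕ} {J : Type} (s : Finset J) (f : J → FM A N) (x y : Fock N) :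
    (∑ j ∈ s, f j) x y = ∑ j ∈ s, f j x y := Matrix.sum_apply _ _ _ _

theorem fblk_zero {N : ℕ} : fblk A (0 : FM A N) 0 0 0 = 0 := Matrix.fromBlocks_zero

theorem fc_anticomm : ∀ (N : ℕ) (i j : Fin N), fc A N i * fc A N j = -(fc A N j * fc A N i)
  | 0, i, _ => i.elim0
  | N + 1, i, j => by
    induction i using Fin.cases <;> induction j using Fin.cases
    · simp [fc_zero, fblk_mul, fblk_neg]
    · simp [fc_zero, fc_succ, fblk_mul, fblk_neg]
    · simp [fc_zero, fc_succ, fblk_mul, fblk_neg]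
    · rename_i i j
      rw [fc_succ, fc_succ, fblk_mul, fblk_mul, fblk_neg]
      simp [fc_anticomm N i j]

theorem fc_sq : ∀ (N : ℕ) (i : Fin N), fc A N i * fc A N i = 0
  | 0, i => i.elim0
  | N + 1, i => by
    induction i using Fin.cases
    · simp [fc_zero, fblk_mul, fblk_zero]
    · rename_i i
      simp [fc_succ, fblk_mul, fc_sq N i, fblk_zero]

theorem fp_comm : ∀ (N : ℕ) (i j : Fin N), i ≠ j → fp A N i * fc A N j = fc A N j * fp A N i
  | 0, i, _, _ => i.elim0
  | N + 1, i, j, h => by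
    induction i using Fin.cases <;> induction j using Fin.cases
    · exact absurd rfl h
    · simp [fp_zero, fc_succ, fblk_mul]
    · simp [fc_zero, fp_succ, fblk_mul]
    · rename_i i j
      have := fp_comm N i j fun e => h (by rw [e])
      simp [fp_succ, fc_succ, fblk_mul, this]

theorem fp_hi : ∀ (N : ℕ) (i : Fin N) (e : FM A N) (y : Fock N), (fp A N i * e) (hi N) y = 0 := by
  have key : ∀ (N : ℕ) (i : Fin N) (y : Fock N), fp A N i (hi N) y = 0 := by
    intro N
    induction N with
    | zero => intro i; exact i.elim0
    | succ N ih =>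
      intro i y
      induction i using Fin.cases <;> rcases y with y | y
      · rfl
      · rfl
      · rfl
      · exact ih _ y
  intro N i e y
  simp [Matrix.mul_apply, key]

theorem fp_lo : ∀ (N : ℕ) (i : Fin N) (e : FM A N) (x : Fock N), (e * fp A N i) x (lo N) = e x (lo N) := by
  have key : ∀ (N : ℕ) (i : Fin N) (y : Fock N), fp A N i y (lo N) = (1 : FM A N) y (lo N) := by
    intro N
    induction N with
    | zero => intro i; exact i.elim0
    | succ N ih =>
      intro i y
      induction i using Fin.cases <;> rcases y with y | y
      · exact (one_inl_inl y (lo N)).symm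
      · exact (one_inr_inl y (lo N)).symm
      · exact (ih _ y).trans (one_inl_inl y (lo N)).symm
      · exact (one_inr_inl y (lo N)).symm
  intro N i e x
  have : (e * fp A N i) x (lo N) = (e * 1) x (lo N) := by
    simp only [Matrix.mul_apply, key]
  rw [this, mul_one]

theorem fc_map {A' : Type} [CommRing A'] (φ : A →+* A') : ∀ (N : ℕ) (i : Fin N), (fc A N i).map φ = fc A' N i
  | 0, i => i.elim0
  | N + 1, i => by
    induction i using Fin.cases
    · rw [fc_zero, fc_zero, fblk_map]
      simp
    · rename_i i
      rw [fc_succ, fc_succ, fblk_map, ← fc_map φ N i]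
      congr 1 <;> ext <;> simp

end Fermi

section Theta
variable {A : Type} [CommRing A] {ι κ : Type} [Fintype ι] [DecidableEq ι] [Fintype κ] [DecidableEq κ] {N : ℕ}

/-- The matrix-valued one-form with components `w`. -/
def Th (w : Fin N → Matrix ι ι A) : Matrix ι ι (FM A N) :=
  Matrix.of fun a b => ∑ i, w i a b • fc A N i

/-- The top-degree coefficient of the trace of the top power of a matrix-valued one-form. -/
def dens (w : Fin N → Matrix ι ι A) : A := (Th w ^ N).trace (hi N) (lo N)

theorem Th_map {A' : Type} [CommRing A'] (φ : A →+* A') (w : Fin N → Matrix ι ι A) :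
    Th (fun i => (w i).map φ) = (RingHom.mapMatrix (RingHom.mapMatrix φ)) (Th w) := by
  ext a b x y
  simp [Th, Matrix.sum_apply, ← fc_map φ]

theorem dens_map {A' : Type} [CommRing A'] (φ : A →+* A') (w : Fin N → Matrix ι ι A) :
    dens (fun i => (w i).map φ) = φ (dens w) := by
  rw [dens, Th_map, ← map_pow, dens]
  simp [Matrix.trace, Matrix.sum_apply]

theorem dens_eq_zero (w : Fin N → Matrix ι ι A) (j : Fin N) (hw : w j = 0) : dens w = 0 := by
  have h1 : Commute (Matrix.scalar ι (fp A N j)) (Th w) := by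
    ext1 a b
    simp only [Matrix.scalar_apply, Matrix.diagonal_mul, Matrix.mul_diagonal, Th, Matrix.of_apply, Finset.mul_sum, Finset.sum_mul]
    refine Finset.sum_congr rfl fun i _ => ?_
    by_cases hij : j = i
    · subst hij; simp [hw]
    · rw [mul_smul_comm, smul_mul_assoc, fp_comm N j i hij]
  have h2 := (h1.pow_right N).eq
  have h3 : ∀ a, (fp A N j * (Th w ^ N) a a) = (Th w ^ N) a a * fp A N j := fun a => by
    have := congrFun (congrFun h2 a) a
    simpa [Matrix.scalar_apply, Matrix.diagonal_mul, Matrix.mul_diagonal] using this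
  rw [dens, Matrix.trace, Matrix.sum_apply]
  refine Finset.sum_eq_zero fun a _ => ?_
  rw [Matrix.diag_apply, ← fp_lo N j ((Th w ^ N) a a), ← h3, fp_hi]

theorem dens_dsum (w : Fin N → Matrix ι ι A) (v : Fin N → Matrix κ κ A) :
    dens (fun i => Matrix.fromBlocks (w i) 0 0 (v i)) = dens w + dens v := by
  have h : Th (fun i => Matrix.fromBlocks (w i) 0 0 (v i)) = Matrix.fromBlocks (Th w) 0 0 (Th v) := by
    ext1 a b
    rcases a with a | a <;> rcases b with b | b <;> simp [Th]
  rw [dens, h, Matrix.fromBlocks_diagonal_pow, Matrix.trace, Fintype.sum_sum_type]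
  rfl

theorem dens_reindex (e : ι ≃ κ) (w : Fin N → Matrix ι ι A) :
    dens (fun i => (w i).submatrix e.symm e.symm) = dens w := by
  have h : Th (fun i => (w i).submatrix e.symm e.symm) = Matrix.reindexRingEquiv _ e (Th w) := by
    ext1 a b
    simp [Th]
  rw [dens, h, ← map_pow, dens]
  simp [Matrix.trace]
  exact congrFun (congrFun (Equiv.sum_comp e.symm fun x => (Th w ^ N) x x) _) _

/-- Lower triangular blocks and their upper left corners. -/
def Corner {N : ℕ} (ω : Matrix ι ι (FM A (N + 1))) (ω' : Matrix ι ι (FM A N)) : Prop :=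
  ∀ a b x y, ω a b (Sum.inl x) (Sum.inr y) = 0 ∧ ω a b (Sum.inl x) (Sum.inl y) = ω' a b x y

theorem Corner.mul {ω η : Matrix ι ι (FM A (N + 1))} {ω' η' : Matrix ι ι (FM A N)} (h : Corner ω ω') (h' : Corner η η') :
    Corner (ω * η) (ω' * η') := by
  intro a b x y
  have e : ∀ (p q : FM A (N + 1)) (u v : Fock (N + 1)), (p * q) u v = ∑ z : Fock N, p u (Sum.inl z) * q (Sum.inl z) v +
      ∑ z : Fock N, p u (Sum.inr z) * q (Sum.inr z) v := fun p q u v => Fintype.sum_sum_type _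
  constructor
  · rw [Matrix.mul_apply]
    refine (sum_fm_apply _ _ _ _).trans ?_
    refine Finset.sum_eq_zero fun c _ => (e _ _ _ _).trans ?_
    simp [(h a c x _).1, (h' c b _ y).1]
  · rw [Matrix.mul_apply, Matrix.mul_apply]
    refine ((sum_fm_apply _ _ _ _).trans ?_).trans (sum_fm_apply _ _ _ _).symm
    refine Finset.sum_congr rfl fun c _ => (e _ _ _ _).trans ?_
    simp only [(h a c x _).1, (h a c x _).2, (h' c b _ y).2, zero_mul, Finset.sum_const_zero, add_zero, Matrix.mul_apply]

theorem Corner.pow {ω : Matrix ι ι (FM A (N + 1))} {ω' : Matrix ι ι (FM A N)} (h : Corner ω ω') (k : ℕ) :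
    Corner (ω ^ k) (ω' ^ k) := by
  induction k with
  | zero =>
    intro a b x y
    rw [pow_zero, pow_zero]
    by_cases hab : a = b
    · subst hab
      rw [Matrix.one_apply_eq, Matrix.one_apply_eq]
      exact ⟨one_inl_inr x y, one_inl_inl x y⟩
    · rw [Matrix.one_apply_ne hab, Matrix.one_apply_ne hab]
      exact ⟨rfl, rfl⟩
  | succ k ih => rw [pow_succ, pow_succ]; exact ih.mul h

theorem corner_Th (w : Fin (N + 1) → Matrix ι ι A) : Corner (Th w) (Th fun i => w i.succ) := by
  intro a b x y
  constructor
  · rw [Th, Matrix.of_apply]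
    refine (sum_fm_apply _ _ _ _).trans ?_
    refine Finset.sum_eq_zero fun i _ => ?_
    induction i using Fin.cases
    · exact mul_zero _
    · exact mul_zero _
  · rw [Th, Th, Matrix.of_apply, Matrix.of_apply]
    refine ((sum_fm_apply _ _ _ _).trans ?_).trans (sum_fm_apply _ _ _ _).symm
    rw [Fin.sum_univ_succ]
    have : (w 0 a b • fc A (N + 1) 0) (Sum.inl x) (Sum.inl y) = 0 := mul_zero _
    rw [this, zero_add]
    rfl

theorem fc_zero_mul_apply (e : FM A (N + 1)) (x : Fock N) (v : Fock (N + 1)) :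
    (fc A (N + 1) 0 * e) (Sum.inr x) v = e (Sum.inl x) v := by
  have e1 : (fc A (N + 1) 0 * e) (Sum.inr x) v = ∑ z : Fock N, fc A (N + 1) 0 (Sum.inr x) (Sum.inl z) * e (Sum.inl z) v +
      ∑ z : Fock N, fc A (N + 1) 0 (Sum.inr x) (Sum.inr z) * e (Sum.inr z) v := Fintype.sum_sum_type _
  rw [e1, fc_zero, fblk]
  simp [Matrix.one_apply]

theorem dens_face (w : Fin (N + 1) → Matrix ι ι A) :
    (fc A (N + 1) 0 * (Th w ^ N).trace) (hi (N + 1)) (lo (N + 1)) = dens fun i => w i.succ := by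
  rw [hi, fc_zero_mul_apply, dens, Matrix.trace, Matrix.trace]
  refine ((sum_fm_apply _ _ _ _).trans ?_).trans (sum_fm_apply _ _ _ _).symm
  exact Finset.sum_congr rfl fun a _ => (((corner_Th w).pow N) a a _ _).2

end Theta
end UnitaryCommutator

open scoped Matrix

namespace UnitaryCommutator

section Nilpotent
variable {S ι : Type} [CommRing S] [Fintype ι] [DecidableEq ι]

theorem derivative_charpoly (A : Matrix ι ι S) :
    Polynomial.derivative A.charpoly = (Matrix.charmatrix A).adjugate.trace := by
  have h1 : Polynomial.derivative A.charpoly =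
      ∑ i, ((Matrix.charmatrix A).updateCol i (fun k => Polynomial.derivative (Matrix.charmatrix A k i))).det := by
    simp only [Matrix.charpoly, Matrix.det_apply, Polynomial.derivative_sum]
    rw [Finset.sum_comm]
    refine Finset.sum_congr rfl fun σ _ => ?_
    rw [Polynomial.derivative_smul, Polynomial.derivative_prod_finset, Finset.smul_sum]
    refine Finset.sum_congr rfl fun i _ => ?_
    congr 1
    rw [← Finset.mul_prod_erase Finset.univ _ (Finset.mem_univ i), mul_comm, Matrix.updateCol_self]
    congr 1
    refine Finset.prod_congr rfl fun j hj => ?_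
    rw [Matrix.updateCol_ne (Finset.ne_of_mem_erase hj)]
  rw [h1, Matrix.trace]
  refine Finset.sum_congr rfl fun i _ => ?_
  have h2 : (fun k => Polynomial.derivative (Matrix.charmatrix A k i)) = Pi.single i 1 := by
    funext k
    by_cases h : k = i
    · subst h; simp [Matrix.charmatrix_apply_eq]
    · simp [Matrix.charmatrix_apply_ne _ _ _ h, h]
  rw [h2, ← Matrix.cramer_apply, Matrix.cramer_eq_adjugate_mulVec]
  simp

theorem trace_mul_adjugate_charmatrix (A : Matrix ι ι S) (h : ∀ k, 1 ≤ k → (A ^ k).trace = 0) :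
    (A.map Polynomial.C * (Matrix.charmatrix A).adjugate).trace = 0 := by
  set B := (Matrix.charmatrix A).adjugate with hB
  have hs : Matrix.charmatrix A = (Polynomial.X : Polynomial S) • (1 : Matrix ι ι (Polynomial S)) - A.map Polynomial.C := by
    rw [Matrix.charmatrix, Matrix.smul_one_eq_diagonal]
    rfl
  have hk : ∀ k, Matrix.of (fun i j => (B i j).coeff k) = A * Matrix.of (fun i j => (B i j).coeff (k + 1)) +
      A.charpoly.coeff (k + 1) • (1 : Matrix ι ι S) := by
    intro k
    have h1 := Matrix.mul_adjugate (Matrix.charmatrix A)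
    rw [← hB, ← Matrix.charpoly, hs, Matrix.sub_mul, smul_mul_assoc, Matrix.one_mul] at h1
    ext i j
    have h2 := congrArg (fun p => Polynomial.coeff p (k + 1)) (congrFun (congrFun h1 i) j)
    simp only [Matrix.sub_apply, Matrix.smul_apply, smul_eq_mul, Polynomial.coeff_sub, Polynomial.coeff_X_mul,
      Matrix.mul_apply, Polynomial.finsetSum_coeff, Matrix.map_apply, Polynomial.coeff_C_mul] at h2
    simp only [Matrix.of_apply, Matrix.add_apply, Matrix.mul_apply, Matrix.smul_apply, smul_eq_mul]
    rw [sub_eq_iff_eq_add] at h2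
    rw [h2, add_comm]
    congr 1
    by_cases hij : i = j <;> simp [Matrix.one_apply, hij]
  have hz : ∃ K, ∀ k, K ≤ k → Matrix.of (fun i j => (B i j).coeff k) = 0 := by
    refine ⟨∑ i, ∑ j, ((B i j).natDegree + 1), fun k hk => ?_⟩
    ext i j
    refine Polynomial.coeff_eq_zero_of_natDegree_lt (lt_of_lt_of_le ?_ hk)
    refine lt_of_lt_of_le (Nat.lt_succ_self _) ((Finset.single_le_sum (f := fun j => (B i j).natDegree + 1)
      (fun _ _ => Nat.zero_le _) (Finset.mem_univ j)).trans (Finset.single_le_sum (f := fun i => ∑ j, ((B i j).natDegree + 1))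
      (fun _ _ => Nat.zero_le _) (Finset.mem_univ i)))
  have ht : ∀ m k j, 1 ≤ j → (A ^ j * Matrix.of (fun i j => (B i j).coeff k)).trace =
      (A ^ (j + m) * Matrix.of (fun i j => (B i j).coeff (k + m))).trace := by
    intro m
    induction m with
    | zero => intro k j _; rfl
    | succ m ih =>
      intro k j hj
      rw [ih k j hj, hk (k + m), Matrix.mul_add, Matrix.trace_add, ← Matrix.mul_assoc, ← pow_succ]
      simp [h (j + m) (by omega), add_assoc]
  obtain ⟨K, hK⟩ := hz
  ext k
  have := ht K k 1 le_rfl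
  rw [hK _ (Nat.le_add_left _ _)] at this
  simpa [Matrix.trace, Matrix.mul_apply, Polynomial.finsetSum_coeff] using this

theorem pow_card_eq_zero_of_trace [Algebra ℂ S] (A : Matrix ι ι S) (h : ∀ k, 1 ≤ k → (A ^ k).trace = 0) :
    A ^ Fintype.card ι = 0 := by
  have h1 : Polynomial.X * Polynomial.derivative A.charpoly = (Fintype.card ι : Polynomial S) * A.charpoly := by
    rw [derivative_charpoly]
    have h2 : (Polynomial.X : Polynomial S) • (1 : Matrix ι ι (Polynomial S)) = Matrix.charmatrix A + A.map Polynomial.C := by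
      rw [Matrix.charmatrix, Matrix.smul_one_eq_diagonal]
      exact (sub_add_cancel _ _).symm
    have h3 := congrArg Matrix.trace (Matrix.mul_adjugate (Matrix.charmatrix A))
    rw [← smul_eq_mul, ← Matrix.trace_smul, ← Matrix.one_mul (Matrix.adjugate _), ← smul_mul_assoc, h2,
      Matrix.add_mul, Matrix.trace_add, trace_mul_adjugate_charmatrix A h, add_zero, h3]
    simp [Matrix.charpoly, mul_comm]
  have h2 : ∀ k, k ≠ Fintype.card ι → A.charpoly.coeff k = 0 := by
    intro k hk
    have h4 : (k : S) * A.charpoly.coeff k = (Fintype.card ι : S) * A.charpoly.coeff k := by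
      have := congrArg (fun p => Polynomial.coeff p k) h1
      rcases k with _ | k
      · simpa using this
      · simpa [Polynomial.coeff_X_mul, Polynomial.coeff_derivative, mul_comm] using this
    have h5 : (((k : ℂ) - (Fintype.card ι : ℂ))) • A.charpoly.coeff k = 0 := by
      rw [Algebra.smul_def, map_sub, map_natCast, map_natCast, sub_mul, h4, sub_self]
    have h6 : ((k : ℂ) - (Fintype.card ι : ℂ)) ≠ 0 := sub_ne_zero.2 (by exact_mod_cast hk)
    have := congrArg (fun s => ((k : ℂ) - (Fintype.card ι : ℂ))⁻¹ • s) h5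
    simpa [smul_smul, h6] using this
  have h3 : A.charpoly = Polynomial.X ^ Fintype.card ι := by
    rcases subsingleton_or_nontrivial S with hS | hS
    · exact Subsingleton.elim _ _
    ext k
    rw [Polynomial.coeff_X_pow]
    split_ifs with hk
    · rw [hk, ← Matrix.charpoly_natDegree_eq_dim A]
      exact Matrix.charpoly_monic A
    · exact h2 k hk
  have := Matrix.aeval_self_charpoly A
  rwa [h3, map_pow, Polynomial.aeval_X] at this

end Nilpotent
end UnitaryCommutator

open scoped Matrix

namespace UnitaryCommutator

section Graded
variable {A : Type} [CommRing A] {ι : Type} [Fintype ι] [DecidableEq ι] {N : ℕ}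

theorem fc_mul_Th_pow (w : Fin N → Matrix ι ι A) (i : Fin N) (k : ℕ) (a b : ι) :
    fc A N i * (Th w ^ k) a b = (-1) ^ k * ((Th w ^ k) a b * fc A N i) := by
  induction k generalizing a b with
  | zero =>
    by_cases h : a = b <;> simp [Matrix.one_apply, h]
  | succ k ih =>
    have h1 : ∀ a b, fc A N i * Th w a b = -(Th w a b * fc A N i) := by
      intro a b
      simp only [Th, Matrix.of_apply, Finset.mul_sum, Finset.sum_mul, ← Finset.sum_neg_distrib]
      refine Finset.sum_congr rfl fun j _ => ?_
      rw [mul_smul_comm, smul_mul_assoc, fc_anticomm, smul_neg]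
    rw [pow_succ, Matrix.mul_apply, Finset.mul_sum, Finset.sum_mul, Finset.mul_sum]
    refine Finset.sum_congr rfl fun c _ => ?_
    rw [← mul_assoc, ih, mul_assoc, mul_assoc, h1, pow_succ]
    noncomm_ring

theorem Th_mul_Th_pow (w : Fin N → Matrix ι ι A) (k : ℕ) (a b c d : ι) :
    Th w a b * (Th w ^ k) c d = (-1) ^ k * ((Th w ^ k) c d * Th w a b) := by
  have h : Th w a b = ∑ i, w i a b • fc A N i := rfl
  rw [h, Finset.sum_mul, Finset.mul_sum, Finset.mul_sum]
  refine Finset.sum_congr rfl fun i _ => ?_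
  rw [smul_mul_assoc, fc_mul_Th_pow, mul_smul_comm, mul_smul_comm]

theorem Th_sq_comm (w : Fin N → Matrix ι ι A) (a b c d : ι) :
    Commute ((Th w ^ 2) a b) ((Th w ^ 2) c d) := by
  have h : ∀ e f, Commute ((Th w ^ 2) a b) (Th w e f) := fun e f => by
    have := Th_mul_Th_pow w 2 e f a b
    rw [neg_one_sq, one_mul] at this
    exact this.symm
  rw [show (Th w ^ 2) c d = ∑ e, Th w c e * Th w e d by rw [sq, Matrix.mul_apply]]
  exact Commute.sum_right _ _ _ fun e _ => (h c e).mul_right (h e d)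

theorem trace_Th_pow_even [Algebra ℂ A] (w : Fin N → Matrix ι ι A) (k : ℕ) (hk : 1 ≤ k) :
    (Th w ^ (2 * k)).trace = 0 := by
  obtain ⟨k, rfl⟩ := Nat.exists_eq_add_of_le' hk
  have h : (Th w ^ (2 * (k + 1))).trace = -(Th w ^ (2 * (k + 1))).trace := by
    have e : 2 * (k + 1) = (2 * k + 1) + 1 := by ring
    conv_lhs => rw [e, pow_succ']
    conv_rhs => rw [e, pow_succ]
    simp only [Matrix.trace, Matrix.diag_apply, Matrix.mul_apply]
    rw [Finset.sum_comm, ← Finset.sum_neg_distrib]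
    refine Finset.sum_congr rfl fun a _ => ?_
    rw [← Finset.sum_neg_distrib]
    refine Finset.sum_congr rfl fun b _ => ?_
    rw [Th_mul_Th_pow, pow_succ, pow_mul, neg_one_sq, one_pow, one_mul, neg_one_mul]
  have h2 : (2 : ℂ) • (Th w ^ (2 * (k + 1))).trace = 0 := by
    rw [two_smul]
    nth_rewrite 1 [h]
    exact neg_add_cancel _
  have := congrArg (fun s => (2 : ℂ)⁻¹ • s) h2
  simpa [smul_smul] using this

theorem Th_pow_eq_zero (w : Fin N → Matrix ι ι ℂ) : Th w ^ (2 * Fintype.card ι) = 0 := by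
  let s : Set (FM ℂ N) := Set.range fun p : ι × ι => (Th w ^ 2) p.1 p.2
  have hs : ∀ x ∈ s, ∀ y ∈ s, x * y = y * x := by
    rintro _ ⟨p, rfl⟩ _ ⟨q, rfl⟩
    exact Th_sq_comm w _ _ _ _
  letI : CommRing (Algebra.adjoin ℂ s) := Algebra.adjoinCommRingOfComm ℂ hs
  let T : Matrix ι ι (Algebra.adjoin ℂ s) := Matrix.of fun a b => ⟨(Th w ^ 2) a b, Algebra.subset_adjoin ⟨(a, b), rfl⟩⟩
  let φ : Algebra.adjoin ℂ s →+* FM ℂ N := (Algebra.adjoin ℂ s).subtype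
  have hT : φ.mapMatrix T = Th w ^ 2 := by
    ext1 a b
    rfl
  have hpow : ∀ k, φ.mapMatrix (T ^ k) = Th w ^ (2 * k) := fun k => by
    rw [map_pow, hT, pow_mul]
  have htr : ∀ k, 1 ≤ k → (T ^ k).trace = 0 := fun k hk => by
    apply Subtype.val_injective
    change φ (T ^ k).trace = φ 0
    rw [map_zero, ← trace_Th_pow_even w k hk, ← hpow]
    simp [Matrix.trace]
  rw [← hpow, pow_card_eq_zero_of_trace T htr, map_zero]

theorem dens_eq_zero_of_card (w : Fin N → Matrix ι ι ℂ) (h : 2 * Fintype.card ι ≤ N) : dens w = 0 := by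
  rw [dens, pow_eq_zero_of_le h (Th_pow_eq_zero w)]
  simp

end Graded
end UnitaryCommutator

open scoped Matrix

namespace UnitaryCommutator

section Calculus
variable {M I : Type} [Ring M] [Fintype I]

theorem diff_pow_of_diff (c : I → M) (δ : I → M →+ M) (hL : ∀ i a b, δ i (a * b) = δ i a * b + a * δ i b)
    (h2 : ∀ x : M, x = -x → x = 0)
    (hc : ∀ i j, c i * c j = -(c j * c i)) (hδc : ∀ i j, δ i (c j) = 0) (hδ : ∀ i j a, δ i (δ j a) = δ j (δ i a))
    (g u : M) (hgu : g * u = 1) (hug : u * g = 1) (hcg : ∀ i, Commute (c i) g) (hcu : ∀ i, Commute (c i) u)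
    (hcδ : ∀ i j, Commute (c i) (δ j g)) (k : ℕ) :
    ∑ i, c i * δ i ((∑ j, c j * (u * δ j g)) ^ (2 * k + 1)) = -(∑ j, c j * (u * δ j g)) ^ (2 * k + 2) := by
  generalize hθ : ∑ j, c j * (u * δ j g) = θ
  have hcθ : ∀ i, c i * θ = -(θ * c i) := by
    intro i
    rw [← hθ, Finset.mul_sum, Finset.sum_mul, ← Finset.sum_neg_distrib]
    refine Finset.sum_congr rfl fun j _ => ?_
    rw [← mul_assoc, hc, neg_mul, mul_assoc, ((hcu i).mul_right (hcδ i j)).eq]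
    simp only [mul_assoc]
  have hDg : ∑ i, c i * δ i g = g * θ := by
    rw [← hθ, Finset.mul_sum]
    refine Finset.sum_congr rfl fun j _ => ?_
    rw [← mul_assoc, ← (hcg j).eq, mul_assoc, ← mul_assoc g, hgu, one_mul]
  have hDD : ∑ i, c i * δ i (∑ j, c j * δ j g) = 0 := by
    have e : ∑ i, c i * δ i (∑ j, c j * δ j g) = ∑ i, ∑ j, c i * c j * δ i (δ j g) := by
      refine Finset.sum_congr rfl fun i _ => ?_
      rw [map_sum, Finset.mul_sum]
      refine Finset.sum_congr rfl fun j _ => ?_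
      rw [hL, hδc, zero_mul, zero_add, mul_assoc]
    rw [e]
    apply h2
    conv_lhs => rw [Finset.sum_comm]
    rw [← Finset.sum_neg_distrib]
    refine Finset.sum_congr rfl fun i _ => ?_
    rw [← Finset.sum_neg_distrib]
    refine Finset.sum_congr rfl fun j _ => ?_
    rw [hc, hδ, neg_mul]
  have hodd : ∀ b, ∑ i, c i * δ i (θ * b) = (∑ i, c i * δ i θ) * b - θ * ∑ i, c i * δ i b := by
    intro b
    rw [Finset.sum_mul, Finset.mul_sum, ← Finset.sum_sub_distrib]
    refine Finset.sum_congr rfl fun i _ => ?_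
    rw [hL, mul_add, ← mul_assoc, ← mul_assoc (c i) θ, hcθ]
    noncomm_ring
  have hDθ : ∑ i, c i * δ i θ = -(θ * θ) := by
    have h1 : ∑ i, c i * δ i (g * θ) = (∑ i, c i * δ i g) * θ + g * ∑ i, c i * δ i θ := by
      rw [Finset.sum_mul, Finset.mul_sum, ← Finset.sum_add_distrib]
      refine Finset.sum_congr rfl fun i _ => ?_
      rw [hL, mul_add, ← mul_assoc, ← mul_assoc (c i) g, (hcg i).eq, mul_assoc g]
    have h0 : ∑ i, c i * δ i (g * θ) = 0 := by rw [← hDg]; exact hDD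
    rw [h0, hDg] at h1
    have h3 := congrArg (fun x => u * x) h1
    simp only [mul_zero, mul_add] at h3
    rw [← mul_assoc, ← mul_assoc, hug, one_mul, ← mul_assoc, hug, one_mul] at h3
    exact (eq_neg_of_add_eq_zero_right h3.symm)
  have key : ∀ k, ∑ i, c i * δ i (θ ^ (2 * k)) = 0 ∧ ∑ i, c i * δ i (θ ^ (2 * k + 1)) = -θ ^ (2 * k + 2) := by
    have step : ∀ k, ∑ i, c i * δ i (θ ^ (2 * k)) = 0 → ∑ i, c i * δ i (θ ^ (2 * k + 1)) = -θ ^ (2 * k + 2) := by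
      intro k h
      rw [pow_succ', hodd, h, hDθ, mul_zero, sub_zero, neg_mul, pow_add, sq]
      congr 1
      rw [← sq]
      exact ((Commute.refl θ).pow_pow 2 (2 * k)).eq
    intro k
    induction k with
    | zero =>
      have h0 : ∑ i, c i * δ i (θ ^ (2 * 0)) = 0 := by
        refine Finset.sum_eq_zero fun i _ => ?_
        have := hL i 1 1
        simp only [mul_one, one_mul] at this
        rw [mul_zero, pow_zero, left_eq_add.1 this, mul_zero]
      exact ⟨h0, step 0 h0⟩
    | succ k ih =>
      have h0 : ∑ i, c i * δ i (θ ^ (2 * (k + 1))) = 0 := by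
        rw [show 2 * (k + 1) = (2 * k + 1) + 1 by ring, pow_succ', hodd, ih.2, hDθ, pow_succ θ (2 * k + 1)]
        rw [neg_mul, mul_neg, sub_neg_eq_add, mul_assoc, ← pow_succ, ← pow_succ', ← pow_succ']
        exact neg_add_cancel _
      exact ⟨h0, step _ h0⟩
  exact (key k).2

end Calculus

section Divergence
variable {A : Type} [CommRing A] [Algebra ℂ A] {ι : Type} [Fintype ι] [DecidableEq ι] {N : ℕ}

theorem map_mul_of_leibniz {J R : Type} [Ring R] [Fintype J] (δ : R →+ R) (hL : ∀ a b, δ (a * b) = δ a * b + a * δ b) (a b : Matrix J J R) :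
    (a * b).map δ = a.map δ * b + a * b.map δ := by
  ext i j
  simp [Matrix.mul_apply, hL, Finset.sum_add_distrib]

theorem fc_map_eq_zero (δ : A →+ A) (h : δ 1 = 0) : ∀ (N : ℕ) (i : Fin N), (fc A N i).map δ = 0
  | 0, i => i.elim0
  | N + 1, i => by
    induction i using Fin.cases
    · refine (Matrix.fromBlocks_map _ _ _ _ _).trans ?_
      have : (1 : FM A N).map δ = 0 := by
        ext x y
        by_cases hxy : x = y <;> simp [Matrix.one_apply, hxy, h]
      rw [this, Matrix.map_zero _ (map_zero δ)]
      exact fblk_zero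
    · rename_i i
      refine (Matrix.fromBlocks_map _ _ _ _ _).trans ?_
      have h1 := fc_map_eq_zero δ h N i
      have : (-fc A N i).map δ = 0 := by
        ext x y
        have := congrFun (congrFun h1 x) y
        simpa using this
      rw [this, h1, Matrix.map_zero _ (map_zero δ)]
      exact fblk_zero

/-- Entrywise action of an additive map on matrices. -/
def mapAdd {R J : Type} [AddMonoid R] (δ : R →+ R) : Matrix J J R →+ Matrix J J R where
  toFun a := a.map δ
  map_zero' := by ext; simp
  map_add' a b := by ext; simp

theorem divergence_dens (δ : Fin N → A →+ A) (hL : ∀ i a b, δ i (a * b) = δ i a * b + a * δ i b)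
    (hδ : ∀ i j a, δ i (δ j a) = δ j (δ i a)) (g u : Matrix ι ι A) (hgu : g * u = 1) (hug : u * g = 1) (k : ℕ) :
    ∑ i, δ i ((fc A N i * (Th (fun j => u * g.map (δ j)) ^ (2 * k + 1)).trace) (hi N) (lo N)) = 0 := by
  set w : Fin N → Matrix ι ι A := fun j => u * g.map (δ j) with hw
  let E : Matrix ι ι A →+* Matrix ι ι (FM A N) := (algebraMap A (FM A N)).mapMatrix
  let c : Fin N → Matrix ι ι (FM A N) := fun i => Matrix.scalar ι (fc A N i)
  let Δ : Fin N → Matrix ι ι (FM A N) →+ Matrix ι ι (FM A N) := fun i => mapAdd (mapAdd (δ i))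
  have hfc : ∀ i j, (fc A N j).map (δ i) = 0 := by
    intro i j
    refine fc_map_eq_zero _ ?_ _ _
    have := hL i 1 1
    rw [mul_one, mul_one, one_mul] at this
    exact left_eq_add.1 this
  have hcE : ∀ i m, Commute (c i) (E m) := by
    intro i m
    ext1 a b
    simp only [c, E, Matrix.scalar_apply, Matrix.diagonal_mul, Matrix.mul_diagonal, RingHom.mapMatrix_apply, Matrix.map_apply]
    exact (Algebra.commutes _ _).symm
  have hΔE : ∀ i m, Δ i (E m) = E (m.map (δ i)) := by
    intro i m
    ext a b x y
    change δ i (algebraMap A (FM A N) (m a b) x y) = algebraMap A (FM A N) (δ i (m a b)) x y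
    rw [Matrix.algebraMap_matrix_apply, Matrix.algebraMap_matrix_apply]
    split_ifs
    · rfl
    · exact map_zero _
  have key := diff_pow_of_diff c Δ (fun i a b => map_mul_of_leibniz _ (map_mul_of_leibniz _ (hL i)) a b)
    (fun x hx => by
      have h2 : (2 : ℂ) • x = 0 := by rw [two_smul]; nth_rewrite 1 [hx]; exact neg_add_cancel _
      have := congrArg (fun s => (2 : ℂ)⁻¹ • s) h2
      simpa [smul_smul] using this)
    (fun i j => by rw [← map_mul, ← map_mul, ← map_neg, fc_anticomm])
    (fun i j => by
      ext a b x y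
      change δ i (Matrix.diagonal (fun _ => fc A N j) a b x y) = 0
      by_cases hab : a = b
      · subst hab
        rw [Matrix.diagonal_apply_eq]
        exact congrFun (congrFun (hfc i j) x) y
      · rw [Matrix.diagonal_apply_ne _ hab]
        exact map_zero _)
    (fun i j a => by ext a b x y; exact hδ _ _ _)
    (E g) (E u) (by rw [← map_mul, hgu, map_one]) (by rw [← map_mul, hug, map_one])
    (fun i => hcE i _) (fun i => hcE i _) (fun i j => by rw [hΔE]; exact hcE i _) k
  have hθ : ∑ j, c j * (E u * Δ j (E g)) = Th w := by
    ext1 a b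
    simp only [hΔE, ← map_mul]
    rw [Matrix.sum_apply]
    refine Finset.sum_congr rfl fun j _ => ?_
    simp only [c, Matrix.scalar_apply, Matrix.diagonal_mul, E, RingHom.mapMatrix_apply, Matrix.map_apply]
    exact (Algebra.commutes _ _).symm.trans (Algebra.smul_def (w j a b) (fc A N j)).symm
  rw [hθ] at key
  have h3 := congrArg Matrix.trace key
  rw [Matrix.trace_neg, show 2 * k + 2 = 2 * (k + 1) by ring, trace_Th_pow_even w (k + 1) (by omega), neg_zero,
    Matrix.trace_sum] at h3
  rw [← show (0 : FM A N) (hi N) (lo N) = 0 from rfl, ← h3]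
  refine ((sum_fm_apply _ _ _ _).trans ?_).symm
  refine Finset.sum_congr rfl fun i _ => ?_
  have h5 : (c i * Δ i (Th w ^ (2 * k + 1))).trace = (fc A N i * (Th w ^ (2 * k + 1)).trace).map (δ i) := by
    rw [map_mul_of_leibniz _ (hL i), hfc, zero_mul, zero_add]
    simp only [Matrix.trace, c, Matrix.scalar_apply, Matrix.diag_apply, Matrix.diagonal_mul, ← Finset.mul_sum]
    congr 1
    ext x y
    simp [Δ, mapAdd, sum_fm_apply]
  rw [h5]
  rfl

end Divergence
end UnitaryCommutator

open scoped Matrix ContDiff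

namespace UnitaryCommutator

/-- The algebra of smooth complex functions on a Euclidean space. -/
def smoothRing (N : ℕ) : Subalgebra ℂ ((Fin N → ℝ) → ℂ) where
  carrier := {f | ContDiff ℝ ∞ f}
  mul_mem' {f g} (ha : ContDiff ℝ ∞ f) (hb : ContDiff ℝ ∞ g) := ha.mul hb
  add_mem' {f g} (ha : ContDiff ℝ ∞ f) (hb : ContDiff ℝ ∞ g) := ha.add hb
  algebraMap_mem' c := (contDiff_const : ContDiff ℝ ∞ fun _ : Fin N → ℝ => c)

variable {N : ℕ}

theorem smooth_smoothRing (f : smoothRing N) : ContDiff ℝ ∞ f.1 := f.2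

theorem diff_smoothRing (f : smoothRing N) (x : Fin N → ℝ) : DifferentiableAt ℝ f.1 x :=
  (smooth_smoothRing f).differentiable (by simp) x

/-- Partial derivatives. -/
noncomputable def pd (i : Fin N) (f : (Fin N → ℝ) → ℂ) (x : Fin N → ℝ) : ℂ := fderiv ℝ f x (Pi.single i 1)

/-- Partial derivatives of smooth functions. -/
noncomputable def sd (i : Fin N) : smoothRing N →+ smoothRing N where
  toFun f := ⟨pd i f.1, ((smooth_smoothRing f).fderiv_right (m := ∞) (by exact le_rfl)).clm_apply contDiff_const⟩
  map_zero' := by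
    ext x
    change fderiv ℝ (fun _ => (0 : ℂ)) x _ = 0
    simp
  map_add' f g := by
    ext x
    change fderiv ℝ (f.1 + g.1) x _ = fderiv ℝ f.1 x _ + fderiv ℝ g.1 x _
    rw [fderiv_add (diff_smoothRing f x) (diff_smoothRing g x)]
    rfl

theorem sd_mul (i : Fin N) (f g : smoothRing N) : sd i (f * g) = sd i f * g + f * sd i g := by
  ext x
  change fderiv ℝ (f.1 * g.1) x _ = fderiv ℝ f.1 x _ * g.1 x + f.1 x * fderiv ℝ g.1 x _
  rw [fderiv_mul (diff_smoothRing f x) (diff_smoothRing g x)]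
  simp
  ring

theorem sd_comm (i j : Fin N) (f : smoothRing N) : sd i (sd j f) = sd j (sd i f) := by
  ext x
  have h1 : ContDiff ℝ ∞ (fderiv ℝ f.1) := (smooth_smoothRing f).fderiv_right (m := ∞) (by exact le_rfl)
  have h2 : ∀ i j : Fin N, (sd i (sd j f)).1 x = fderiv ℝ (fderiv ℝ f.1) x (Pi.single i 1) (Pi.single j 1) := by
    intro i j
    change fderiv ℝ (fun y => fderiv ℝ f.1 y (Pi.single j 1)) x _ = _
    rw [fderiv_clm_apply (h1.differentiable (by simp) x) (differentiableAt_const _)]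
    simp
  rw [h2, h2]
  exact ((smooth_smoothRing f).contDiffAt.isSymmSndFDerivAt (by rw [minSmoothness_of_isRCLikeNormedField]; exact WithTop.coe_le_coe.2 le_top)).eq _ _

/-- Evaluation of smooth functions at a point. -/
def evs (x : Fin N → ℝ) : smoothRing N →+* ℂ := (Pi.evalRingHom (fun _ : Fin N → ℝ => ℂ) x).comp (smoothRing N).subtype

section
variable {ι : Type} [Fintype ι] [DecidableEq ι]

/-- The matrix of smooth functions defined by a smooth matrix-valued function. -/
def smat (h : (Fin N → ℝ) → Matrix ι ι ℂ) (hs : ∀ a b, ContDiff ℝ ∞ fun x => h x a b) : Matrix ι ι (smoothRing N) :=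
  Matrix.of fun a b => ⟨fun x => h x a b, hs a b⟩

theorem exists_smat_inv (h : (Fin N → ℝ) → Matrix ι ι ℂ) (hs : ∀ a b, ContDiff ℝ ∞ fun x => h x a b)
    (hu : ∀ x, (h x).det ≠ 0) : ∃ u, smat h hs * u = 1 ∧ u * smat h hs = 1 ∧ ∀ x, u.map (evs x) = (h x)⁻¹ := by
  have he : ∀ x, (evs x).mapMatrix (smat h hs) = h x := fun x => rfl
  have hd : ∀ x, (smat h hs).det.1 x = (h x).det := fun x => (RingHom.map_det (evs x) _).trans (congrArg Matrix.det (he x))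
  have hi : ContDiff ℝ ∞ fun x => ((smat h hs).det.1 x)⁻¹ :=
    ContDiff.inv (smooth_smoothRing _) fun x => by rw [hd]; exact hu x
  let r : smoothRing N := ⟨_, hi⟩
  have hr : r * (smat h hs).det = 1 := by
    ext x
    exact inv_mul_cancel₀ (by rw [hd]; exact hu x)
  have h1 : smat h hs * (r • (smat h hs).adjugate) = 1 := by
    rw [mul_smul_comm, Matrix.mul_adjugate, smul_smul, hr, one_smul]
  refine ⟨r • (smat h hs).adjugate, h1, by rw [smul_mul_assoc, Matrix.adjugate_mul, smul_smul, hr, one_smul], fun x => ?_⟩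
  symm
  apply Matrix.inv_eq_right_inv
  rw [← he x]
  exact (map_mul _ _ _).symm.trans ((congrArg _ h1).trans (map_one _))

/-- The logarithmic derivatives of a matrix-valued function. -/
noncomputable def ld (h : (Fin N → ℝ) → Matrix ι ι ℂ) (x : Fin N → ℝ) (j : Fin N) : Matrix ι ι ℂ :=
  (h x)⁻¹ * Matrix.of fun a b => pd j (fun y => h y a b) x

/-- The components of the transgression form. -/
noncomputable def flux (h : (Fin N → ℝ) → Matrix ι ι ℂ) (d : ℕ) (i : Fin N) (x : Fin N → ℝ) : ℂ :=
  (fc ℂ N i * (Th (ld h x) ^ d).trace) (hi N) (lo N)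

theorem exists_flux (h : (Fin N → ℝ) → Matrix ι ι ℂ) (hs : ∀ a b, ContDiff ℝ ∞ fun x => h x a b)
    (hu : ∀ x, (h x).det ≠ 0) (k : ℕ) : (∀ i, ContDiff ℝ ∞ (flux h (2 * k + 1) i)) ∧
      ∀ x, ∑ i, pd i (flux h (2 * k + 1) i) x = 0 := by
  obtain ⟨u, h1, h2, h3⟩ := exists_smat_inv h hs hu
  have key := divergence_dens (fun i => sd i) sd_mul sd_comm (smat h hs) u h1 h2 k
  set F : Fin N → smoothRing N := fun i =>
    (fc (smoothRing N) N i * (Th (fun j => u * (smat h hs).map (sd j)) ^ (2 * k + 1)).trace) (hi N) (lo N) with hF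
  have e : ∀ i, flux h (2 * k + 1) i = (F i).1 := by
    intro i
    funext x
    have e1 : ∀ j, ld h x j = (u * (smat h hs).map (sd j)).map (evs x) := fun j => by
      rw [Matrix.map_mul, h3]
      rfl
    have e2 : (F i).1 x = evs x (F i) := rfl
    rw [flux, e2, hF, funext e1, Th_map, ← map_pow, ← fc_map (evs x)]
    simp only [Matrix.mul_apply, map_sum, map_mul, Matrix.map_apply]
    refine Finset.sum_congr rfl fun y _ => ?_
    congr 1
    simp only [Matrix.trace]
    refine (sum_fm_apply _ _ _ _).trans ?_
    rw [sum_fm_apply, map_sum]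
    rfl
  refine ⟨fun i => by rw [e]; exact smooth_smoothRing _, fun x => ?_⟩
  have := congrArg (fun f : smoothRing N => f.1 x) key
  simp only [e]
  refine Eq.trans ?_ this
  exact (map_sum (evs x) (fun i => sd i (F i)) Finset.univ).symm

theorem contDiff_dens (h : (Fin N → ℝ) → Matrix ι ι ℂ) (hs : ∀ a b, ContDiff ℝ ∞ fun x => h x a b)
    (hu : ∀ x, (h x).det ≠ 0) : ContDiff ℝ ∞ fun x => dens (ld h x) := by
  obtain ⟨u, h1, h2, h3⟩ := exists_smat_inv h hs hu
  have e : (fun x => dens (ld h x)) = (dens fun j => u * (smat h hs).map (sd j)).1 := by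
    funext x
    have e1 : ∀ j, ld h x j = (u * (smat h hs).map (sd j)).map (evs x) := fun j => by
      rw [Matrix.map_mul, h3]
      rfl
    rw [funext e1, dens_map]
    rfl
  rw [e]
  exact smooth_smoothRing _

end
end UnitaryCommutator

open scoped Matrix ContDiff
open MeasureTheory

namespace UnitaryCommutator

variable {N : ℕ} {ι : Type} [Fintype ι] [DecidableEq ι]

theorem pd_eq_of_line {d : ℕ} {f : (Fin d → ℝ) → ℂ} {f' : (Fin N → ℝ) → ℂ} {x : Fin d → ℝ} {x' : Fin N → ℝ} {i : Fin d} {i' : Fin N}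
    (hf : DifferentiableAt ℝ f x) (hf' : DifferentiableAt ℝ f' x')
    (h : ∀ t : ℝ, f (x + t • Pi.single i 1) = f' (x' + t • Pi.single i' 1)) : pd i f x = pd i' f' x' := by
  rw [pd, pd, ← hf.lineDeriv_eq_fderiv, ← hf'.lineDeriv_eq_fderiv, lineDeriv, lineDeriv]
  exact congrArg (fun g => deriv g (0 : ℝ)) (funext h)

theorem contDiff_cons (s : ℝ) : ContDiff ℝ ∞ fun y : Fin N → ℝ => (Fin.cons s y : Fin (N + 1) → ℝ) := by
  rw [contDiff_pi]
  intro i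
  induction i using Fin.cases
  · exact contDiff_const
  · rename_i i
    exact contDiff_apply ℝ ℝ i

/-- Periodicity in a coordinate. -/
def Per {T : Type} (i : Fin N) (h : (Fin N → ℝ) → T) : Prop := ∀ x, h (x + Pi.single i 1) = h x

theorem Per.flux {h : (Fin N → ℝ) → Matrix ι ι ℂ} {i : Fin N} (hp : Per i h) (d : ℕ) (j : Fin N) : Per i (flux h d j) := by
  intro x
  have : ld h (x + Pi.single i 1) = ld h x := by
    funext j
    rw [ld, ld, hp]
    congr 1
    ext a b
    simp only [Matrix.of_apply, pd]
    rw [← fderiv_comp_add_right]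
    congr 2
    funext y
    exact congrFun (congrFun (hp y) a) b
  rw [UnitaryCommutator.flux, UnitaryCommutator.flux, this]

theorem ld_cons (h : (Fin (N + 1) → ℝ) → Matrix ι ι ℂ) (hs : ∀ a b, ContDiff ℝ ∞ fun x => h x a b) (s : ℝ) (y : Fin N → ℝ) (j : Fin N) :
    ld (fun y => h (Fin.cons s y)) y j = ld h (Fin.cons s y) j.succ := by
  rw [ld, ld]
  congr 1
  ext a b
  refine pd_eq_of_line (((hs a b).comp (contDiff_cons s)).differentiable (by simp) y)
    ((hs a b).differentiable (by simp) _) fun t => ?_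
  congr 2
  funext i
  induction i using Fin.cases
  · simp
  · rename_i i
    simp [Pi.single_apply]

/-- The integral of the density of a matrix-valued function over the unit cube. -/
noncomputable def winding (h : (Fin N → ℝ) → Matrix ι ι ℂ) : ℂ := ∫ x in Set.Icc (0 : Fin N → ℝ) 1, dens (ld h x)

theorem winding_endpoints (k : ℕ) (h : (Fin (2 * k + 1 + 1) → ℝ) → Matrix ι ι ℂ) (hs : ∀ a b, ContDiff ℝ ∞ fun x => h x a b)
    (hu : ∀ x, (h x).det ≠ 0) (hp : ∀ i : Fin (2 * k + 1), Per i.succ h) :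
    winding (fun y => h (Fin.cons 1 y)) = winding (fun y => h (Fin.cons 0 y)) := by
  obtain ⟨h1, h2⟩ := exists_flux h hs hu k
  have key := integral_divergence_of_hasFDerivAt_off_countable' (0 : Fin (2 * k + 1 + 1) → ℝ) 1 zero_le_one
    (flux h (2 * k + 1)) (fun i x => fderiv ℝ (flux h (2 * k + 1) i) x) ∅ Set.countable_empty
    (fun i => (h1 i).continuous.continuousOn) (fun x _ i => ((h1 i).differentiable (by simp) x).hasFDerivAt)
    (by
      have : (fun x => ∑ i, fderiv ℝ (flux h (2 * k + 1) i) x (Pi.single i 1)) = fun _ => 0 := funext h2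
      rw [this]
      exact integrableOn_zero)
  have h3 : (∫ x in Set.Icc (0 : Fin (2 * k + 1 + 1) → ℝ) 1, ∑ i, fderiv ℝ (flux h (2 * k + 1) i) x (Pi.single i 1)) = 0 := by
    have : (fun x => ∑ i, fderiv ℝ (flux h (2 * k + 1) i) x (Pi.single i 1)) = fun _ => 0 := funext h2
    rw [this, integral_zero]
  rw [h3, Fin.sum_univ_succ, Finset.sum_eq_zero, add_zero] at key
  · have h4 : ∀ s y, flux h (2 * k + 1) 0 (Fin.cons s y) = dens (ld (fun y => h (Fin.cons s y)) y) := by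
      intro s y
      rw [flux, dens_face]
      congr 1
      funext j
      exact (ld_cons h hs s y j).symm
    simp only [Fin.insertNth_zero', Pi.one_apply, Pi.zero_apply, h4] at key
    exact sub_eq_zero.1 key.symm
  · intro i _
    rw [sub_eq_zero]
    refine integral_congr_ae (Filter.Eventually.of_forall fun x => ?_)
    have : (i.succ.insertNth ((1 : Fin (2 * k + 1 + 1) → ℝ) i.succ) x : Fin (2 * k + 1 + 1) → ℝ) =
        i.succ.insertNth ((0 : Fin (2 * k + 1 + 1) → ℝ) i.succ) x + Pi.single i.succ 1 := by
      funext j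
      rcases Fin.eq_self_or_eq_succAbove i.succ j with rfl | ⟨j, rfl⟩
      · simp
      · simp [Fin.succAbove_ne]
    change flux h (2 * k + 1) i.succ _ = flux h (2 * k + 1) i.succ _
    rw [this]
    exact (hp i).flux _ _ _

end UnitaryCommutator

open scoped Matrix ContDiff
open Filter Topology MeasureTheory

namespace UnitaryCommutator

section Coordinates

/-- The point of the torus with given coordinates. -/
noncomputable def mkX : ∀ m, (Fin (2 * m + 1) → Circle) → X m
  | 0, c => ((c 0, ()) : Circle × Unit)
  | m + 1, c => ((c 0, (c 1, mkX m fun i => c i.succ.succ)) : Circle × (Circle × X m))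

/-- The coordinates of a point of the torus. -/
noncomputable def crd : ∀ m, X m → Fin (2 * m + 1) → Circle
  | 0 => fun x : Circle × Unit => fun _ => x.1
  | m + 1 => fun x : Circle × (Circle × X m) =>
    (Fin.cons x.1 (Fin.cons x.2.1 (crd m x.2.2)) : Fin (2 * m + 1 + 1 + 1) → Circle)

theorem mkX_crd : ∀ (m : ℕ) (x : X m), mkX m (crd m x) = x
  | 0, _ => rfl
  | m + 1, x => by
    change ((_, (_, mkX m (crd m x.2.2))) : Circle × (Circle × X m)) = x
    rw [mkX_crd m x.2.2]
    rfl

theorem crd_mkX : ∀ (m : ℕ) (c : Fin (2 * m + 1) → Circle), crd m (mkX m c) = c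
  | 0, c => by
    funext i
    rw [show i = 0 from Subsingleton.elim (α := Fin 1) _ _]
    rfl
  | m + 1, c => by
    change (Fin.cons (c 0) (Fin.cons (c 1) (crd m (mkX m fun i => c i.succ.succ))) : Fin (2 * m + 1 + 1 + 1) → Circle) = c
    rw [crd_mkX m]
    funext i
    refine Fin.cases rfl (fun i => ?_) (i : Fin (2 * m + 1 + 1 + 1))
    exact Fin.cases rfl (fun i => rfl) i

theorem continuous_crd : ∀ m, Continuous (crd m)
  | 0 => (by fun_prop : Continuous fun x : Circle × Unit => fun _ : Fin 1 => x.1)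
  | m + 1 => by
    have h := continuous_crd m
    have : Continuous fun x : Circle × (Circle × X m) =>
        (Fin.cons x.1 (Fin.cons x.2.1 (crd m x.2.2)) : Fin (2 * m + 1 + 1 + 1) → Circle) := by fun_prop
    exact this

theorem fin_one_val (m : ℕ) : ((1 : Fin (2 * (m + 1) + 1)) : ℕ) = 1 := by
  rw [Fin.val_one']
  exact Nat.mod_eq_of_lt (by omega)

theorem Ind.update {T : Type} : ∀ (m : ℕ) (j : Fin (2 * m + 1)) (f : X m → T), Ind m j f →
    ∀ (c : Fin (2 * m + 1) → Circle) (z : Circle), f (mkX m (Function.update c j z)) = f (mkX m c)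
  | 0, _, _, h => fun c z => h _ _
  | m + 1, ⟨0, _⟩, f, h => fun c z => by
    change f ((Function.update c 0 z 0, (Function.update c 0 z 1, mkX m fun i => Function.update c 0 z i.succ.succ)) : Circle × (Circle × X m)) = _
    rw [Function.update_of_ne (a := (1 : Fin (2 * (m + 1) + 1))) (by simp [Fin.ext_iff])]
    have : (fun i : Fin (2 * m + 1) => Function.update c 0 z i.succ.succ) = fun i => c i.succ.succ := by
      funext i
      exact Function.update_of_ne (Fin.succ_ne_zero _) _ _
    rw [this]
    exact h _ _ _
  | m + 1, ⟨1, _⟩, f, h => fun c z => by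
    change f ((Function.update c 1 z 0, (Function.update c 1 z 1, mkX m fun i => Function.update c 1 z i.succ.succ)) : Circle × (Circle × X m)) = _
    rw [Function.update_of_ne (a := (0 : Fin (2 * (m + 1) + 1))) (fun h => by
        have := congrArg Fin.val h
        rw [fin_one_val] at this
        simp at this)]
    have : (fun i : Fin (2 * m + 1) => Function.update c 1 z i.succ.succ) = fun i => c i.succ.succ := by
      funext i
      refine Function.update_of_ne (fun h => ?_) _ _
      have := congrArg Fin.val h
      rw [fin_one_val] at this
      simp at this
    rw [this]
    exact h _ _ _ _
  | m + 1, ⟨j + 2, hj⟩, f, h => fun c z => by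
    have hj' : j < 2 * m + 1 := by omega
    change f ((Function.update c _ z 0, (Function.update c _ z 1, mkX m fun i => Function.update c _ z i.succ.succ)) : Circle × (Circle × X m)) = _
    rw [Function.update_of_ne (a := (0 : Fin (2 * (m + 1) + 1))) (by simp [Fin.ext_iff]),
      Function.update_of_ne (a := (1 : Fin (2 * (m + 1) + 1))) (fun h => by
        have := congrArg Fin.val h
        rw [fin_one_val] at this
        simp at this)]
    have : (fun i : Fin (2 * m + 1) => Function.update c ⟨j + 2, hj⟩ z i.succ.succ) =
        Function.update (fun i => c i.succ.succ) ⟨j, hj'⟩ z := by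
      funext i
      by_cases hi : i = ⟨j, hj'⟩
      · subst hi
        rw [Function.update_self]
        exact Function.update_self _ _ _
      · rw [Function.update_of_ne hi, Function.update_of_ne]
        intro h
        apply hi
        have := congrArg Fin.val h
        exact Fin.ext (by simpa using this)
    rw [this]
    exact Ind.update m ⟨j, hj'⟩ _ (h (c 0) (c 1)) _ z

/-- The exponential parametrisation of the torus. -/
noncomputable def En (m : ℕ) (r : Fin (2 * m + 1) → ℝ) : X m := mkX m fun i => ex (r i)

theorem ex_add_one (t : ℝ) : ex (t + 1) = ex t := by
  rw [ex, ex, mul_add, mul_one, Circle.exp_add, Circle.exp_two_pi, mul_one]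

theorem En_period (m : ℕ) (i : Fin (2 * m + 1)) (r : Fin (2 * m + 1) → ℝ) : En m (r + Pi.single i 1) = En m r := by
  rw [En, En]
  congr 1
  funext j
  rw [Pi.add_apply]
  by_cases h : j = i
  · subst h
    rw [Pi.single_eq_same, ex_add_one]
  · rw [Pi.single_eq_of_ne h, add_zero]

theorem contDiff_ex {N : ℕ} {u : (Fin N → ℝ) → ℝ} (hu : ContDiff ℝ ∞ u) : ContDiff ℝ ∞ fun r => (ex (u r) : ℂ) := by
  simp only [ex, Circle.coe_exp]
  exact (((Complex.ofRealCLM.contDiff.comp (contDiff_const.mul hu))).mul contDiff_const).cexp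

end Coordinates

section Approximation
variable {ι : Type} [Fintype ι] [DecidableEq ι] {m : ℕ}

/-- Smooth matrix-valued functions on the torus. -/
def Smooth {κ κ' : Type} (h : X m → Matrix κ κ' ℂ) : Prop := ∀ a b, ContDiff ℝ ∞ fun r => h (En m r) a b

/-- The algebra of smooth functions on the torus. -/
noncomputable def smoothAlg (m : ℕ) : StarSubalgebra ℂ C(X m, ℂ) where
  carrier := {f | ContDiff ℝ ∞ fun r => f (En m r)}
  mul_mem' {f g} (ha : ContDiff ℝ ∞ _) (hb : ContDiff ℝ ∞ _) := ha.mul hb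
  add_mem' {f g} (ha : ContDiff ℝ ∞ _) (hb : ContDiff ℝ ∞ _) := ha.add hb
  algebraMap_mem' c := (contDiff_const : ContDiff ℝ ∞ fun _ : Fin (2 * m + 1) → ℝ => c)
  star_mem' {f} (ha : ContDiff ℝ ∞ _) := Complex.conjCLE.contDiff.comp ha

theorem smoothAlg_dense (m : ℕ) : (smoothAlg m).topologicalClosure = ⊤ := by
  apply ContinuousMap.starSubalgebra_topologicalClosure_eq_top_of_separatesPoints
  intro x y hne
  obtain ⟨i, hi⟩ : ∃ i, crd m x i ≠ crd m y i := by
    by_contra! h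
    apply hne
    rw [← mkX_crd m x, ← mkX_crd m y, funext h]
  refine ⟨fun x => crd m x i, ⟨⟨fun x => crd m x i, ?_⟩, ?_, rfl⟩, ?_⟩
  · have := continuous_crd m
    fun_prop
  · change ContDiff ℝ ∞ fun r => (crd m (En m r) i : ℂ)
    simp only [En, crd_mkX]
    exact contDiff_ex (contDiff_apply ℝ ℝ i)
  · simpa [Circle.ext_iff] using hi

theorem exists_smooth_function (g : X m → ℂ) (hg : Continuous g) (ε : ℝ) (hε : 0 < ε) :
    ∃ f : X m → ℂ, (ContDiff ℝ ∞ fun r => f (En m r)) ∧ ∀ x, ‖f x - g x‖ < ε := by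
  have h : (⟨g, hg⟩ : C(X m, ℂ)) ∈ (smoothAlg m).topologicalClosure := by
    rw [smoothAlg_dense]; trivial
  rw [← SetLike.mem_coe, StarSubalgebra.topologicalClosure_coe, Metric.mem_closure_iff] at h
  obtain ⟨f, hf, hd⟩ := h ε hε
  refine ⟨f, hf, fun x => ?_⟩
  rw [← dist_eq_norm, dist_comm]
  exact (ContinuousMap.dist_apply_le_dist (f := ⟨g, hg⟩) (g := f) x).trans_lt hd

theorem exists_smooth (g : X m → Matrix ι ι ℂ) (hg : Continuous g) (ε : ℝ) (hε : 0 < ε) :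
    ∃ h : X m → Matrix ι ι ℂ, Smooth h ∧ ∀ x i j, ‖h x i j - g x i j‖ < ε := by
  have : ∀ i j, ∃ f : X m → ℂ, (ContDiff ℝ ∞ fun r => f (En m r)) ∧ ∀ x, ‖f x - g x i j‖ < ε :=
    fun i j => exists_smooth_function _ (by fun_prop) ε hε
  choose f hf hd using this
  exact ⟨fun x => Matrix.of fun i j => f i j x, fun i j => hf i j, fun x i j => hd i j x⟩

end Approximation

end UnitaryCommutator

open scoped Matrix ContDiff
open Filter Topology MeasureTheory

namespace UnitaryCommutator

section Value
variable {ι κ : Type} [Fintype ι] [DecidableEq ι] [Fintype κ] [DecidableEq κ] {m : ℕ}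

/-- The winding of a smooth matrix-valued function on the torus. -/
noncomputable def wind (h : X m → Matrix ι ι ℂ) : ℂ := winding fun r => h (En m r)

theorem det_ne_zero_of_isUnit {A : Matrix ι ι ℂ} (h : IsUnit A) : A.det ≠ 0 :=
  ((Matrix.isUnit_iff_isUnit_det _).1 h).ne_zero

theorem wind_path (h0 h1 : X m → Matrix ι ι ℂ) (hs0 : Smooth h0) (hs1 : Smooth h1)
    (hu : ∀ s : ℝ, 0 ≤ s → s ≤ 1 → ∀ x, IsUnit (h0 x + (s : ℂ) • (h1 x - h0 x))) : wind h0 = wind h1 := by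
  have key := winding_endpoints (ι := ι) m
    (fun p => h0 (En m (Fin.tail p)) + ((Real.smoothTransition (p 0) : ℝ) : ℂ) • (h1 (En m (Fin.tail p)) - h0 (En m (Fin.tail p))))
    ?_ ?_ ?_
  · simp only [Fin.cons_zero, Fin.tail_cons, Real.smoothTransition.one, Real.smoothTransition.zero, Complex.ofReal_one,
      Complex.ofReal_zero, one_smul, zero_smul, add_zero, add_sub_cancel] at key
    exact key.symm
  · intro a b
    have ht : ContDiff ℝ ∞ fun p : Fin (2 * m + 1 + 1) → ℝ => (Fin.tail p : Fin (2 * m + 1) → ℝ) := by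
      rw [contDiff_pi]
      exact fun i => contDiff_apply ℝ ℝ i.succ
    have e0 := (hs0 a b).comp ht
    have e1 := (hs1 a b).comp ht
    have e2 : ContDiff ℝ ∞ fun p : Fin (2 * m + 1 + 1) → ℝ => ((Real.smoothTransition (p 0) : ℝ) : ℂ) :=
      Complex.ofRealCLM.contDiff.comp (Real.smoothTransition.contDiff.comp (contDiff_apply ℝ ℝ 0))
    exact e0.add (e2.mul (e1.sub e0))
  · exact fun p => det_ne_zero_of_isUnit (hu _ (Real.smoothTransition.nonneg _) (Real.smoothTransition.le_one _) _)
  · intro i p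
    have h2 : Fin.tail (p + Pi.single i.succ 1) = Fin.tail p + Pi.single i 1 := by
      funext j
      simp [Fin.tail, Pi.single_apply]
    have h3 : (p + Pi.single i.succ 1 : Fin (2 * m + 1 + 1) → ℝ) 0 = p 0 := by
      simp
    simp only [h2, h3, En_period]

/-- All smooth functions close to `f` are invertible with winding `c`. -/
def HasVal (f : X m → G ι) (c : ℂ) : Prop :=
  ∃ ε > 0, ∀ h : X m → Matrix ι ι ℂ, Smooth h → (∀ x i j, ‖h x i j - (f x : Matrix ι ι ℂ) i j‖ < ε) →
    (∀ x, IsUnit (h x)) ∧ wind h = c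

theorem exists_hasVal (f : X m → G ι) (hf : Continuous f) : ∃ c, HasVal f c := by
  obtain ⟨ε, hε, hu⟩ := exists_close_invertible f hf
  obtain ⟨h0, hs0, hd0⟩ := exists_smooth _ (continuous_G_val hf) ε hε
  refine ⟨wind h0, ε, hε, fun h hs hd => ⟨fun x => hu x _ (hd x), ?_⟩⟩
  refine wind_path h h0 hs hs0 fun s h0s hs1 x => hu x _ fun i j => ?_
  have : (h x + (s : ℂ) • (h0 x - h x)) i j - (f x : Matrix ι ι ℂ) i j =
      ((1 - s : ℝ) : ℂ) * (h x i j - (f x : Matrix ι ι ℂ) i j) + (s : ℂ) * (h0 x i j - (f x : Matrix ι ι ℂ) i j) := by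
    simp only [Matrix.add_apply, Matrix.smul_apply, Matrix.sub_apply, smul_eq_mul]
    push_cast
    ring
  rw [this]
  refine (norm_add_le _ _).trans_lt ?_
  rw [norm_mul, norm_mul, Complex.norm_real, Complex.norm_real, Real.norm_of_nonneg h0s, Real.norm_of_nonneg (by linarith)]
  rcases hs1.eq_or_lt with rfl | hs1
  · simpa using hd0 x i j
  · nlinarith [hd x i j, hd0 x i j, mul_lt_mul_of_pos_left (hd x i j) (sub_pos.2 hs1), mul_le_mul_of_nonneg_left (hd0 x i j).le h0s]

theorem HasVal.witness {f : X m → G ι} {c : ℂ} (hf : Continuous f) (h : HasVal f c) (δ : ℝ) (hδ : 0 < δ) :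
    ∃ g : X m → Matrix ι ι ℂ, Smooth g ∧ (∀ x i j, ‖g x i j - (f x : Matrix ι ι ℂ) i j‖ < δ) ∧ (∀ x, IsUnit (g x)) ∧ wind g = c := by
  obtain ⟨ε, hε, h⟩ := h
  obtain ⟨g, hg, hd⟩ := exists_smooth _ (continuous_G_val hf) (min ε δ) (lt_min hε hδ)
  have := h g hg fun x i j => (hd x i j).trans_le (min_le_left _ _)
  exact ⟨g, hg, fun x i j => (hd x i j).trans_le (min_le_right _ _), this⟩

theorem HasVal.unique {f : X m → G ι} {c d : ℂ} (hf : Continuous f) (h : HasVal f c) (h' : HasVal f d) : c = d := by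
  obtain ⟨ε, hε, h⟩ := h
  obtain ⟨g, hg, hd, -, rfl⟩ := h'.witness hf ε hε
  exact (h g hg hd).2.symm

open Classical in
/-- The winding of a continuous map. -/
noncomputable def windVal (f : X m → G ι) : ℂ := if h : ∃ c, HasVal f c then h.choose else 0

theorem hasVal_windVal (f : X m → G ι) (hf : Continuous f) : HasVal f (windVal f) := by
  have h := exists_hasVal f hf
  rw [windVal, dif_pos h]
  exact h.choose_spec

theorem HasVal.eq {f : X m → G ι} {c : ℂ} (hf : Continuous f) (h : HasVal f c) : windVal f = c :=
  (hasVal_windVal f hf).unique hf h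

theorem windVal_smooth (f : X m → G ι) (hf : Continuous f) (hs : Smooth fun x => (f x : Matrix ι ι ℂ)) :
    windVal f = wind fun x => (f x : Matrix ι ι ℂ) := by
  obtain ⟨ε, hε, h⟩ := hasVal_windVal f hf
  exact (h _ hs fun x i j => by simpa using hε).2.symm

theorem windVal_homotopy (F : unitInterval → X m → G ι) (hF : Continuous fun p : unitInterval × X m => F p.1 p.2) :
    windVal (F 0) = windVal (F 1) := by
  have hF' := continuous_G_val hF
  have hs : ∀ s, Continuous (F s) := fun s => hF.comp (by fun_prop : Continuous fun x : X m => (s, x))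
  have : IsLocallyConstant fun s => windVal (F s) := by
    rw [IsLocallyConstant.iff_eventually_eq]
    intro s
    obtain ⟨ε, hε, h⟩ := hasVal_windVal (F s) (hs s)
    let Φ : C(unitInterval × X m, ι → ι → ℂ) := ⟨fun p => (F p.1 p.2 : Matrix ι ι ℂ), hF'⟩
    have h1 : ∀ᶠ t in 𝓝 s, dist (Φ.curry t) (Φ.curry s) < ε / 2 :=
      (Φ.curry.continuous.tendsto s).eventually (Metric.ball_mem_nhds _ (half_pos hε))
    filter_upwards [h1] with t ht
    refine HasVal.eq (hs t) ⟨ε / 2, half_pos hε, fun g hg hd => h g hg fun x i j => ?_⟩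
    have h2 : ‖(F t x : Matrix ι ι ℂ) i j - (F s x : Matrix ι ι ℂ) i j‖ < ε / 2 := by
      rw [← dist_eq_norm]
      exact ((dist_le_pi_dist _ _ j).trans (dist_le_pi_dist _ _ i)).trans_lt
        ((ContinuousMap.dist_apply_le_dist (f := Φ.curry t) (g := Φ.curry s) x).trans_lt ht)
    have h3 := norm_add_le (g x i j - (F t x : Matrix ι ι ℂ) i j) ((F t x : Matrix ι ι ℂ) i j - (F s x : Matrix ι ι ℂ) i j)
    rw [sub_add_sub_cancel] at h3
    linarith [hd x i j]
  exact this.apply_eq_of_isPreconnected isPreconnected_univ trivial trivial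

theorem ld_fromBlocks {N : ℕ} (u : (Fin N → ℝ) → Matrix ι ι ℂ) (v : (Fin N → ℝ) → Matrix κ κ ℂ)
    (hu : ∀ x, IsUnit (u x)) (hv : ∀ x, IsUnit (v x)) (x : Fin N → ℝ) (j : Fin N) :
    ld (fun x => Matrix.fromBlocks (u x) 0 0 (v x)) x j = Matrix.fromBlocks (ld u x j) 0 0 (ld v x j) := by
  have h1 : (Matrix.fromBlocks (u x) 0 0 (v x))⁻¹ = Matrix.fromBlocks (u x)⁻¹ 0 0 (v x)⁻¹ := by
    apply Matrix.inv_eq_left_inv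
    rw [Matrix.fromBlocks_multiply]
    simp [Matrix.nonsing_inv_mul _ ((Matrix.isUnit_iff_isUnit_det _).1 (hu x)),
      Matrix.nonsing_inv_mul _ ((Matrix.isUnit_iff_isUnit_det _).1 (hv x))]
  have h2 : (Matrix.of fun a b => pd j (fun y => Matrix.fromBlocks (u y) 0 0 (v y) a b) x) =
      Matrix.fromBlocks (Matrix.of fun a b => pd j (fun y => u y a b) x) 0 0 (Matrix.of fun a b => pd j (fun y => v y a b) x) := by
    ext (a | a) (b | b)
    · rfl
    · simp [pd]
    · simp [pd]
    · rfl
  rw [ld, h1, h2, Matrix.fromBlocks_multiply]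
  simp [ld]

theorem ld_submatrix {N : ℕ} (e : ι ≃ κ) (u : (Fin N → ℝ) → Matrix ι ι ℂ) (x : Fin N → ℝ) (j : Fin N) :
    ld (fun x => (u x).submatrix e.symm e.symm) x j = (ld u x j).submatrix e.symm e.symm := by
  rw [ld, ld, Matrix.inv_submatrix_equiv, ← Matrix.submatrix_mul_equiv _ _ _ e.symm]
  rfl

theorem ld_eq_zero {N : ℕ} (u : (Fin N → ℝ) → Matrix ι ι ℂ) (j : Fin N) (hs : ∀ a b, ContDiff ℝ ∞ fun x => u x a b)
    (h : ∀ (x : Fin N → ℝ) (t : ℝ), u (x + t • Pi.single j 1) = u x) (x : Fin N → ℝ) : ld u x j = 0 := by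
  have : (Matrix.of fun a b => pd j (fun y => u y a b) x) = 0 := by
    ext a b
    have := pd_eq_of_line (f' := fun _ : Fin N → ℝ => u x a b) (x' := x) (i' := j) (i := j)
      ((hs a b).differentiable (by simp) x) (differentiableAt_const _) fun t => by rw [h]
    rw [Matrix.of_apply, this]
    simp [pd]
  rw [ld, this, mul_zero]

theorem wind_const (A : Matrix ι ι ℂ) : wind (fun _ : X m => A) = 0 := by
  have : ∀ r : Fin (2 * m + 1) → ℝ, dens (ld (fun _ => A) r) = 0 := fun r =>
    dens_eq_zero _ 0 (ld_eq_zero (fun _ : Fin (2 * m + 1) → ℝ => A) 0 (fun _ _ => contDiff_const) (fun _ _ => rfl) r)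
  simp only [wind, winding, this]
  simp

theorem wind_fromBlocks (u : X m → Matrix ι ι ℂ) (v : X m → Matrix κ κ ℂ) (hsu : Smooth u) (hsv : Smooth v)
    (hu : ∀ x, IsUnit (u x)) (hv : ∀ x, IsUnit (v x)) :
    wind (fun x => Matrix.fromBlocks (u x) 0 0 (v x)) = wind u + wind v := by
  have h1 := contDiff_dens (fun r => u (En m r)) hsu fun r => det_ne_zero_of_isUnit (hu _)
  have h2 := contDiff_dens (fun r => v (En m r)) hsv fun r => det_ne_zero_of_isUnit (hv _)
  rw [wind, wind, wind, winding, winding, winding, ← integral_add]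
  · refine integral_congr_ae (Filter.Eventually.of_forall fun r => ?_)
    change dens (ld (fun r => Matrix.fromBlocks (u (En m r)) 0 0 (v (En m r))) r) =
      dens (ld (fun r => u (En m r)) r) + dens (ld (fun r => v (En m r)) r)
    rw [← dens_dsum]
    congr 1
    funext j
    exact ld_fromBlocks _ _ (fun _ => hu _) (fun _ => hv _) r j
  · exact h1.continuous.continuousOn.integrableOn_compact isCompact_Icc
  · exact h2.continuous.continuousOn.integrableOn_compact isCompact_Icc

theorem wind_submatrix (e : ι ≃ κ) (u : X m → Matrix ι ι ℂ) : wind (fun x => (u x).submatrix e.symm e.symm) = wind u := by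
  rw [wind, wind, winding, winding]
  congr 1
  funext r
  rw [← dens_reindex e]
  congr 1
  funext j
  exact ld_submatrix e _ r j

/-- The winding invariant. -/
noncomputable def windInv (m : ℕ) : Inv (X m) where
  val f := windVal f
  homotopy := windVal_homotopy
  sum f g hf hg := by
    obtain ⟨ε, hε, h⟩ := hasVal_windVal _ (continuous_dsum hf hg)
    obtain ⟨u, hsu, hdu, hu, hu'⟩ := (hasVal_windVal f hf).witness hf ε hε
    obtain ⟨v, hsv, hdv, hv, hv'⟩ := (hasVal_windVal g hg).witness hg ε hε
    rw [← hu', ← hv', ← wind_fromBlocks u v hsu hsv hu hv]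
    refine (h _ ?_ ?_).2.symm
    · rintro (a | a) (b | b)
      · exact hsu a b
      · exact contDiff_const
      · exact contDiff_const
      · exact hsv a b
    · rintro x (a | a) (b | b)
      · exact hdu x a b
      · simpa [dsum_val] using hε
      · simpa [dsum_val] using hε
      · exact hdv x a b
  reindex e f hf := by
    obtain ⟨ε, hε, h⟩ := hasVal_windVal _ (continuous_reix e hf)
    obtain ⟨u, hsu, hdu, hu, hu'⟩ := (hasVal_windVal f hf).witness hf ε hε
    rw [← hu', ← wind_submatrix e u]
    refine (h _ (fun a b => hsu _ _) fun x i j => ?_).2.symm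
    rw [reix_val]
    exact hdu x _ _
  one {ι} _ _ := by
    refine (windVal_smooth _ continuous_const fun a b => contDiff_const).trans (wind_const _)

theorem windVal_eq_zero_of_card (h : 2 * Fintype.card ι ≤ 2 * m + 1) (f : X m → G ι) (hf : Continuous f) : windVal f = 0 := by
  obtain ⟨u, -, -, -, hu'⟩ := (hasVal_windVal f hf).witness hf 1 one_pos
  have : ∀ r, dens (ld (fun r => u (En m r)) r) = 0 := fun r => dens_eq_zero_of_card _ h
  rw [← hu']
  simp only [wind, winding, this]
  simp

theorem coll_windInv (m : ℕ) : Coll m (windInv m) := by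
  intro j hj κ _ _ f hf hi
  have hj' : j < 2 * m + 1 := by omega
  obtain ⟨ε, hε, h⟩ := hasVal_windVal f hf
  obtain ⟨u, hsu, hdu, -, -⟩ := (hasVal_windVal f hf).witness hf ε hε
  have h2 : ∀ r, mkX m (Function.update (crd m (En m r)) ⟨j, hj'⟩ 1) = En m (Function.update r ⟨j, hj'⟩ 0) := by
    intro r
    simp only [En, crd_mkX]
    congr 1
    funext i
    by_cases hi : i = ⟨j, hj'⟩
    · subst hi
      simp
    · simp [Function.update_of_ne hi]
  have h3 : Smooth fun x => u (mkX m (Function.update (crd m x) ⟨j, hj'⟩ 1)) := by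
    intro a b
    simp only [h2]
    refine (hsu a b).comp ?_
    rw [contDiff_pi]
    intro i
    by_cases hi : i = ⟨j, hj'⟩
    · subst hi
      simpa using contDiff_const
    · simpa [Function.update_of_ne hi] using contDiff_apply ℝ ℝ i
  have h4 : (windInv m).val f = wind fun x => u (mkX m (Function.update (crd m x) ⟨j, hj'⟩ 1)) := by
    refine (h _ h3 fun x a b => ?_).2.symm
    have := hi.update m ⟨j, hj'⟩ f (crd m x) 1
    rw [mkX_crd] at this
    rw [← this]
    exact hdu _ a b
  rw [h4]
  have h5 : ∀ r, dens (ld (fun r => u (mkX m (Function.update (crd m (En m r)) ⟨j, hj'⟩ 1))) r) = 0 := by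
    intro r
    refine dens_eq_zero _ ⟨j, hj'⟩ (ld_eq_zero _ _ h3 (fun x t => ?_) r)
    simp only [h2]
    congr 2
    funext i
    by_cases hi : i = ⟨j, hj'⟩
    · subst hi
      simp
    · simp [Function.update_of_ne hi, Pi.single_apply, hi]
  simp only [wind, winding, h5]
  simp

theorem top_windInv_ne_zero_of_exists {g : X m → G ι} (hg : Continuous g) (h : windVal g ≠ 0) : top m (windInv m) ≠ 0 := by
  intro h0
  obtain ⟨k, hk⟩ := (coll_windInv m).generated g hg
  rw [h0, mul_zero] at hk
  exact h hk

end Value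

end UnitaryCommutator

open scoped Matrix ContDiff

namespace UnitaryCommutator

section OddPower
variable {R : Type} [Ring R]

theorem odd_pow (q u v w f : R) (hqq : q * q = q) (hqu : q * u = u) (huq : u * q = 0) (hqv : q * v = 0) (hvq : v * q = v)
    (huv : u * v = f * q) (hfq : Commute f q) (hfu : Commute f u) (hfv : Commute f v) (hfw : Commute f w) (hqw : q * w = w * q)
    (huw : u * w = -(w * u)) (hvw : v * w = -(w * v)) (hww : w * w = 0) (n : ℕ) :
    (w * q + u + v) ^ (2 * n + 1) = f ^ n * (u + v) + (n + 1) • (w * (f ^ n * q)) - n • (w * (f ^ (n - 1) * (v * u))) := by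
  have huu : u * u = 0 := by rw [← hqu, ← mul_assoc, mul_assoc q u q, huq, mul_zero, zero_mul]
  have hvv : v * v = 0 := by
    have : v * v = v * (q * v) := by rw [← mul_assoc, hvq]
    rw [this, hqv, mul_zero]
  have lift : ∀ {a b c : R}, a * b = c → ∀ x, a * (b * x) = c * x := fun h x => by rw [← mul_assoc, h]
  have lift2 : ∀ {a b c d : R}, a * b = c * d → ∀ x, a * (b * x) = c * (d * x) := fun h x => by rw [← mul_assoc, h, mul_assoc]
  have lift3 : ∀ {a b c d : R}, a * b = -(c * d) → ∀ x, a * (b * x) = -(c * (d * x)) := fun h x => by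
    rw [← mul_assoc, h, neg_mul, mul_assoc]
  have lift0 : ∀ {a b : R}, a * b = 0 → ∀ x, a * (b * x) = 0 := fun h x => by rw [← mul_assoc, h, zero_mul]
  have sq : (w * q + u + v) ^ 2 = w * u - w * v + f * q + v * u := by
    rw [pow_two]
    simp only [mul_add, add_mul, mul_assoc, lift hqq, hqq, hqu, lift hqu, huq, lift0 huq, hqv, lift0 hqv, hvq, lift hvq, huv,
      lift2 huv, hqw, lift2 hqw, huw, lift3 huw, hvw, lift3 hvw, lift0 hww, huu, hvv, mul_neg, mul_zero]
    abel
  induction n with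
  | zero => simp; abel
  | succ n ih =>
    rw [show 2 * (n + 1) + 1 = (2 * n + 1) + 2 by ring, pow_add, ih, sq]
    have gen : ∀ g : R, Commute g q → Commute g u → Commute g v → Commute g w → Commute f g →
        (g * (u + v) + (n + 1) • (w * (g * q))) * (w * u - w * v + f * q + v * u) =
        (f * g) * (u + v) + (n + 2) • (w * ((f * g) * q)) - w * (g * (v * u)) := by
      intro g hgq hgu hgv hgw hfg
      simp only [mul_add, add_mul, mul_sub, mul_assoc, lift hqq, hqq, hqu, lift hqu, huq, lift0 huq, hqv, lift0 hqv, hvq, lift hvq, huv,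
        lift2 huv, hqw, lift2 hqw, huw, lift3 huw, hvw, lift3 hvw, lift0 hww, huu, hvv, lift0 huu, lift0 hvv, mul_neg, mul_zero,
        hfq.symm.eq, lift2 hfq.symm.eq, lift2 hfu.symm.eq, lift2 hfv.symm.eq, lift2 hgw.eq, smul_mul_assoc, lift2 hfg.symm.eq, lift2 hfw.eq, neg_zero, smul_zero]
      module
    have hp : ∀ k, Commute (f ^ k) q ∧ Commute (f ^ k) u ∧ Commute (f ^ k) v ∧ Commute (f ^ k) w ∧ Commute f (f ^ k) := fun k =>
      ⟨hfq.pow_left k, hfu.pow_left k, hfv.pow_left k, hfw.pow_left k, Commute.pow_right rfl k⟩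
    obtain ⟨h1, h2, h3, h4, h5⟩ := hp n
    rw [sub_mul, gen _ h1 h2 h3 h4 h5, ← pow_succ', Nat.add_sub_cancel]
    cases n with
    | zero => simp
    | succ k =>
      obtain ⟨k1, k2, k3, k4, k5⟩ := hp k
      have : w * (f ^ k * (v * u)) * (w * u - w * v + f * q + v * u) = w * (f ^ (k + 1) * (v * u)) := by
        rw [pow_succ']
        generalize f ^ k = g at *
        simp only [mul_add, mul_sub, mul_assoc, lift hqq, hqq, hqu, lift hqu, huq, lift0 huq, hqv, lift0 hqv, hvq, lift hvq, huv,
          lift2 huv, hqw, lift2 hqw, huw, lift3 huw, hvw, lift3 hvw, lift0 hww, huu, hvv, lift0 huu, lift0 hvv, mul_neg, mul_zero,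
          hfq.symm.eq, lift2 hfq.symm.eq, lift2 hfu.symm.eq, lift2 hfv.symm.eq, lift2 k4.eq, lift2 k5.symm.eq, lift2 hfw.eq, neg_zero]
        abel
      rw [Nat.add_sub_cancel, smul_mul_assoc, this]
      module

end OddPower

end UnitaryCommutator

open scoped Matrix ContDiff

namespace UnitaryCommutator

section IdempotentForm
variable {κ : Type} [Fintype κ] [DecidableEq κ] {N : ℕ}

/-- Complex matrices as matrices with entries in the operators on Fock space. -/
noncomputable def cst (N : ℕ) : Matrix κ κ ℂ →+* Matrix κ κ (FM ℂ N) := (algebraMap ℂ (FM ℂ N)).mapMatrix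

theorem cst_apply (M : Matrix κ κ ℂ) (a b : κ) : cst N M a b = M a b • (1 : FM ℂ N) :=
  Algebra.algebraMap_eq_smul_one (A := FM ℂ N) (M a b)

theorem Th_apply (w : Fin N → Matrix κ κ ℂ) (a b : κ) : Th w a b = ∑ i, w i a b • fc ℂ N i := rfl

theorem cst_mul_Th (M : Matrix κ κ ℂ) (w : Fin N → Matrix κ κ ℂ) : cst N M * Th w = Th fun i => M * w i := by
  ext1 a b
  simp only [Matrix.mul_apply (M := cst N M), cst_apply, Th_apply, Finset.mul_sum, Matrix.mul_apply (M := M), Finset.sum_smul]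
  rw [Finset.sum_comm]
  simp [smul_smul, mul_comm]

theorem Th_mul_cst (M : Matrix κ κ ℂ) (w : Fin N → Matrix κ κ ℂ) : Th w * cst N M = Th fun i => w i * M := by
  ext1 a b
  simp only [Matrix.mul_apply (M := Th w), cst_apply, Th_apply, Finset.sum_mul, Matrix.mul_apply (N := M), Finset.sum_smul]
  rw [Finset.sum_comm]
  simp [smul_smul, mul_comm]

theorem Th_add (w v : Fin N → Matrix κ κ ℂ) : Th (fun i => w i + v i) = Th w + Th v := by
  ext1 a b
  simp [Th_apply, add_smul, Finset.sum_add_distrib]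

theorem Th_smul (z : ℂ) (w : Fin N → Matrix κ κ ℂ) : Th (fun i => z • w i) = z • Th w := by
  ext1 a b
  simp [Th_apply, Finset.smul_sum, smul_smul]

theorem Th_anticomm (w v : Fin N → Matrix κ κ ℂ) (a b c d : κ) : Th w a b * Th v c d = -(Th v c d * Th w a b) := by
  simp only [Th_apply, Finset.sum_mul, Finset.mul_sum, ← Finset.sum_neg_distrib]
  rw [Finset.sum_comm]
  refine Finset.sum_congr rfl fun i _ => Finset.sum_congr rfl fun j _ => ?_
  rw [smul_mul_smul_comm, smul_mul_smul_comm, fc_anticomm, smul_neg, mul_comm]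

/-- The scalar one-form with components `b`. -/
noncomputable def form (b : Fin N → ℂ) : FM ℂ N := ∑ i, b i • fc ℂ N i

theorem form_anticomm (b b' : Fin N → ℂ) : form b * form b' = -(form b' * form b) := by
  have := Th_anticomm (κ := Unit) (fun i => Matrix.of fun _ _ => b i) (fun i => Matrix.of fun _ _ => b' i) () () () ()
  exact this

theorem eq_zero_of_eq_neg {x : FM ℂ N} (h : x = -x) : x = 0 := by
  have h2 : (2 : ℂ) • x = 0 := by
    rw [two_smul]
    nth_rewrite 1 [h]
    exact neg_add_cancel _
  have := congrArg (fun s => (2 : ℂ)⁻¹ • s) h2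
  simpa [smul_smul] using this

theorem form_Th (b : Fin N → ℂ) (v : Fin N → Matrix κ κ ℂ) :
    Th v * Matrix.scalar κ (form b) = -(Matrix.scalar κ (form b) * Th v) := by
  ext1 a c
  rw [Matrix.neg_apply, Matrix.scalar_apply, Matrix.diagonal_mul, Matrix.mul_diagonal]
  exact Th_anticomm (κ := κ) v (fun i => Matrix.of fun _ _ => b i) _ _ a a

theorem scalar_cst (x : FM ℂ N) (M : Matrix κ κ ℂ) : Commute (Matrix.scalar κ x) (cst N M) := by
  ext1 a c
  rw [Matrix.scalar_apply, Matrix.diagonal_mul, Matrix.mul_diagonal, cst_apply]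
  simp

theorem scalar_Th {F : FM ℂ N} (hF : ∀ i, Commute F (fc ℂ N i)) (v : Fin N → Matrix κ κ ℂ) :
    Commute (Matrix.scalar κ F) (Th v) := by
  ext1 a c
  rw [Matrix.scalar_apply, Matrix.diagonal_mul, Matrix.mul_diagonal, Th_apply]
  exact Commute.sum_right _ _ _ fun i _ => (hF i).smul_right _

theorem trace_scalar_mul (x : FM ℂ N) (M : Matrix κ κ (FM ℂ N)) : (Matrix.scalar κ x * M).trace = x * M.trace := by
  simp [Matrix.trace, Finset.mul_sum]

theorem trace_Th_mul (w v : Fin N → Matrix κ κ ℂ) : (Th w * Th v).trace = -(Th v * Th w).trace := by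
  simp only [Matrix.trace, Matrix.diag_apply, Matrix.mul_apply, ← Finset.sum_neg_distrib]
  rw [Finset.sum_comm]
  exact Finset.sum_congr rfl fun i _ => Finset.sum_congr rfl fun j _ => Th_anticomm _ _ _ _ _ _

theorem trace_Th (w : Fin N → Matrix κ κ ℂ) (h : ∀ i, (w i).trace = 0) : (Th w).trace = 0 := by
  simp only [Matrix.trace, Matrix.diag_apply, Th_apply]
  rw [Finset.sum_comm]
  refine Finset.sum_eq_zero fun i _ => ?_
  rw [← Finset.sum_smul]
  exact (congrArg (· • _) (h i)).trans (zero_smul _ _)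

theorem trace_pow_idempotent {Q : Matrix κ κ ℂ} {D : Fin N → Matrix κ κ ℂ} (hQ : Q * Q = Q) (hD : ∀ i, D i = D i * Q + Q * D i)
    (α β : ℂ) (b : Fin N → ℂ) {F : FM ℂ N} (hF : ∀ i, Commute F (fc ℂ N i))
    (hQF : Th (fun i => Q * D i) * Th (fun i => D i * Q) = Matrix.scalar κ F * cst N Q) (n : ℕ) :
    (Th (fun i => b i • Q + α • (Q * D i) + β • (D i * Q)) ^ (2 * n + 1)).trace =
      ((2 * n + 1) * Q.trace * (α * β) ^ n) • (form b * F ^ n) := by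
  have hQDQ : ∀ i, Q * D i * Q = 0 := fun i => by
    have := congrArg (fun M => Q * M * Q) (hD i)
    simp only [mul_add, add_mul, mul_assoc, hQ] at this
    simp only [← mul_assoc, hQ] at this
    exact left_eq_add.1 this
  have htr1 : ∀ i, (Q * D i).trace = 0 := fun i => by
    rw [← hQ, mul_assoc, Matrix.trace_mul_comm, hQDQ, Matrix.trace_zero]
  set u := Th fun i => α • (Q * D i) with hu
  set v := Th fun i => β • (D i * Q) with hv
  have hθ : Th (fun i => b i • Q + α • (Q * D i) + β • (D i * Q)) = Matrix.scalar κ (form b) * cst N Q + u + v := by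
    rw [Th_add, Th_add]
    congr 2
    ext1 a c
    rw [Matrix.scalar_apply, Matrix.diagonal_mul, cst_apply, Th_apply, form]
    simp [Finset.smul_sum, smul_smul, mul_comm]
  have huv : u * v = Matrix.scalar κ ((α * β) • F) * cst N Q := by
    rw [hu, hv, Th_smul, Th_smul, smul_mul_smul_comm, hQF]
    ext1 a c
    simp [Matrix.scalar_apply]
  have hfF : ∀ i, Commute ((α * β) • F) (fc ℂ N i) := fun i => (hF i).smul_left _
  have hfw : Commute ((α * β) • F) (form b) := Commute.sum_right _ _ _ fun i _ => (hfF i).smul_right _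
  rw [hθ, odd_pow (cst N Q) u v (Matrix.scalar κ (form b)) (Matrix.scalar κ ((α * β) • F)) (by rw [← map_mul, hQ])
    (by rw [hu, cst_mul_Th]; simp [← mul_assoc, hQ]) (by rw [hu, Th_mul_cst]; simp [hQDQ, Th]; rfl)
    (by rw [hv, cst_mul_Th]; simp [← mul_assoc, hQDQ, Th]; rfl) (by rw [hv, Th_mul_cst]; simp [mul_assoc, hQ])
    huv (scalar_cst _ _) (scalar_Th hfF _) (scalar_Th hfF _) (by rw [Commute, SemiconjBy, ← map_mul, hfw.eq, map_mul])
    (scalar_cst _ _).symm.eq (form_Th _ _) (form_Th _ _)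
    (by rw [← map_mul, eq_zero_of_eq_neg (form_anticomm b b), map_zero])]
  have tQ : (cst N Q).trace = Q.trace • (1 : FM ℂ N) := by
    simp [Matrix.trace, cst_apply, Finset.sum_smul]
  have tuv : (u + v).trace = 0 := by
    rw [Matrix.trace_add, hu, hv, Th_smul, Th_smul, Matrix.trace_smul, Matrix.trace_smul, trace_Th _ htr1,
      trace_Th _ fun i => (Matrix.trace_mul_comm _ _).trans (htr1 i)]
    simp
  have tvu : (v * u).trace = -(((α * β) • F) * (Q.trace • 1)) := by
    rw [hv, hu, trace_Th_mul, ← hu, ← hv, huv, trace_scalar_mul, tQ]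
  rw [← map_pow, ← map_pow, Matrix.trace_sub, Matrix.trace_add, Matrix.trace_smul, Matrix.trace_smul]
  simp only [trace_scalar_mul, tuv, tvu, tQ]
  cases n with
  | zero => simp
  | succ n =>
    simp only [Nat.add_sub_cancel, smul_pow, smul_mul_assoc, mul_smul_comm, mul_one, mul_neg, smul_smul, mul_zero, zero_add, ← pow_succ]
    push_cast
    module

end IdempotentForm

end UnitaryCommutator

open scoped Matrix ContDiff Kronecker

namespace UnitaryCommutator

section TwoModes
variable {N : ℕ}

/-- The action on Fock space with two more modes of an operator which is diagonal in them. -/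
def lft (x : FM ℂ N) : FM ℂ (N + 1 + 1) := fblk ℂ (fblk ℂ x 0 0 x) 0 0 (fblk ℂ x 0 0 x)

/-- The action on Fock space with two more modes of an odd operator. -/
def lodd (x : FM ℂ N) : FM ℂ (N + 1 + 1) := fblk ℂ (fblk ℂ x 0 0 (-x)) 0 0 (fblk ℂ (-x) 0 0 x)

/-- The product of the first two creation operators. -/
def pair (N : ℕ) : FM ℂ (N + 1 + 1) := fc ℂ (N + 1 + 1) 0 * fc ℂ (N + 1 + 1) 1

theorem fc_one : fc ℂ (N + 1 + 1) 1 = fblk ℂ (fblk ℂ 0 0 1 0) 0 0 (-fblk ℂ 0 0 1 0) := rfl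

theorem fc_succ_succ (i : Fin N) : fc ℂ (N + 1 + 1) i.succ.succ = lodd (fc ℂ N i) := by
  rw [fc_succ, fc_succ, fblk_neg, neg_zero, neg_neg, lodd]

theorem fc_zero' : fc ℂ (N + 1 + 1) 0 = fblk ℂ 0 0 (fblk ℂ 1 0 0 1) 0 := by
  rw [fc_zero]
  congr 1
  exact (Matrix.fromBlocks_one (l := Fock N) (m := Fock N)).symm

theorem pair_eq : pair N = fblk ℂ 0 0 (fblk ℂ 0 0 1 0) 0 := by
  rw [pair, fc_zero', fc_one, fblk_mul, fblk_mul]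
  simp

theorem fblk_add (a b c d a' b' c' d' : FM ℂ N) : fblk ℂ a b c d + fblk ℂ a' b' c' d' =
    fblk ℂ (a + a') (b + b') (c + c') (d + d') := Matrix.fromBlocks_add _ _ _ _ _ _ _ _

theorem fblk_smul (z : ℂ) (a b c d : FM ℂ N) : z • fblk ℂ a b c d = fblk ℂ (z • a) (z • b) (z • c) (z • d) :=
  Matrix.fromBlocks_smul _ _ _ _ _

theorem lft_mul (x y : FM ℂ N) : lft x * lft y = lft (x * y) := by
  simp [lft, fblk_mul]

theorem lft_smul (z : ℂ) (x : FM ℂ N) : lft (z • x) = z • lft x := by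
  simp [lft, fblk_smul]

theorem lft_zero : lft (0 : FM ℂ N) = 0 := by
  simp [lft, fblk_zero]

theorem lft_add (x y : FM ℂ N) : lft (x + y) = lft x + lft y := by
  simp [lft, fblk_add]

theorem lft_sum {J : Type} (s : Finset J) (f : J → FM ℂ N) : lft (∑ j ∈ s, f j) = ∑ j ∈ s, lft (f j) :=
  map_sum (⟨⟨lft, lft_zero⟩, lft_add⟩ : FM ℂ N →+ FM ℂ (N + 1 + 1)) f s

theorem lft_one : lft (1 : FM ℂ N) = 1 := by
  have h : ∀ N, fblk ℂ (1 : FM ℂ N) 0 0 1 = 1 := fun N => Matrix.fromBlocks_one (l := Fock N) (m := Fock N)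
  rw [lft, h, h]

theorem lodd_mul (x y : FM ℂ N) : lodd x * lodd y = lft (x * y) := by
  simp [lodd, lft, fblk_mul]

theorem lodd_zero : lodd (0 : FM ℂ N) = 0 := by
  simp [lodd, fblk_zero]

theorem lodd_add (x y : FM ℂ N) : lodd (x + y) = lodd x + lodd y := by
  simp [lodd, fblk_add, add_comm]

theorem lodd_smul (z : ℂ) (x : FM ℂ N) : lodd (z • x) = z • lodd x := by
  simp [lodd, fblk_smul]

theorem lodd_sum {J : Type} (s : Finset J) (f : J → FM ℂ N) : lodd (∑ j ∈ s, f j) = ∑ j ∈ s, lodd (f j) :=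
  map_sum (⟨⟨lodd, lodd_zero⟩, lodd_add⟩ : FM ℂ N →+ FM ℂ (N + 1 + 1)) f s

theorem pair_sq : pair N * pair N = 0 := by
  simp [pair_eq, fblk_mul, fblk_zero]

theorem commute_pair_lft (x : FM ℂ N) : Commute (pair N) (lft x) := by
  rw [Commute, SemiconjBy]
  simp [pair_eq, lft, fblk_mul]

theorem commute_pair_fc (i : Fin (N + 1 + 1)) : Commute (pair N) (fc ℂ _ i) := by
  rw [Commute, SemiconjBy, pair, mul_assoc, fc_anticomm _ 1 i, mul_neg, ← mul_assoc, fc_anticomm _ 0 i, neg_mul, neg_neg, mul_assoc]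

theorem commute_lft_fc {x : FM ℂ N} (hx : ∀ i, Commute x (fc ℂ N i)) (i : Fin (N + 1 + 1)) : Commute (lft x) (fc ℂ _ i) := by
  rw [Commute, SemiconjBy]
  refine Fin.cases ?_ (fun i => Fin.cases ?_ (fun i => ?_) i) i
  · rw [fc_zero', lft, fblk_mul, fblk_mul]
    simp [fblk_mul]
  · change _ * fc ℂ (N + 1 + 1) 1 = fc ℂ (N + 1 + 1) 1 * _
    rw [fc_one, lft, fblk_mul, fblk_mul]
    simp [fblk_mul]
  · rw [fc_succ_succ, lft, lodd]
    simp [fblk_mul, (hx i).eq]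

theorem form_succ_succ (b : Fin (N + 1 + 1) → ℂ) (h0 : b 0 = 0) (h1 : b (Fin.succ 0) = 0) :
    form b = lodd (form fun i => b i.succ.succ) := by
  rw [form, form, Fin.sum_univ_succ, Fin.sum_univ_succ, h0, h1, lodd_sum]
  simp only [zero_smul, zero_add, lodd_smul, fc_succ_succ]

/-- The curvature form of an iterated product of idempotents with curvatures `k`. -/
def curv : ∀ n, (Fin n → ℂ) → FM ℂ (2 * n + 1)
  | 0, _ => 0
  | n + 1, k => (k 0 • pair (2 * n + 1) + lft (curv n fun i => k i.succ) : FM ℂ (2 * n + 1 + 1 + 1))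

theorem commute_curv_fc : ∀ (n : ℕ) (k : Fin n → ℂ) (i), Commute (curv n k) (fc ℂ _ i)
  | 0, _, _ => Commute.zero_left _
  | n + 1, k, i => ((commute_pair_fc (N := 2 * n + 1) i).smul_left (k 0)).add_left
      (commute_lft_fc (fun i => commute_curv_fc n _ i) i)

theorem pow_curv (z : ℂ) (x : FM ℂ N) (m : ℕ) :
    (z • pair N + lft x) ^ (m + 1) = lft (x ^ (m + 1)) + ((m + 1) * z) • (pair N * lft (x ^ m)) := by
  induction m with
  | zero => simp [lft_one, add_comm]
  | succ m ih =>
    have hp : ∀ k, lft x * lft (x ^ k) = lft (x ^ (k + 1)) := fun k => by rw [lft_mul, pow_succ']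
    have h1 : ∀ y, pair N * (pair N * y) = 0 := fun y => by rw [← mul_assoc, pair_sq, zero_mul]
    have h2 : ∀ y, lft x * (pair N * y) = pair N * (lft x * y) := fun y => by
      rw [← mul_assoc, ← (commute_pair_lft x).eq, mul_assoc]
    rw [pow_succ', ih]
    simp only [add_mul, mul_add, smul_mul_assoc, mul_smul_comm, h1, h2, hp, smul_zero]
    push_cast
    module

theorem lodd_lft_apply (x y : FM ℂ N) : (lodd x * lft y) (hi (N + 1 + 1)) (lo (N + 1 + 1)) = 0 := by
  rw [lodd, lft, fblk_mul]
  simp only [zero_mul, mul_zero, add_zero]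
  rfl

theorem lodd_pair_lft_apply (x y : FM ℂ N) :
    (lodd x * (pair N * lft y)) (hi (N + 1 + 1)) (lo (N + 1 + 1)) = (x * y) (hi N) (lo N) := by
  have : lodd x * (pair N * lft y) = fblk ℂ 0 0 (fblk ℂ 0 0 (x * y) 0) 0 := by
    simp [lodd, pair_eq, lft, fblk_mul, fblk_zero]
  rw [this]
  rfl

theorem form_mul_curv_pow : ∀ (n : ℕ) (k : Fin n → ℂ) (b : Fin (2 * n + 1) → ℂ) (_ : ∀ i, i ≠ Fin.last _ → b i = 0),
    (form b * curv n k ^ n) (hi _) (lo _) = n.factorial * (∏ i, k i) * b (Fin.last _)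
  | 0, k, b, _ => by
    have : form b = (b 0 • fc ℂ (0 + 1) 0 : FM ℂ (0 + 1)) := Fin.sum_univ_one _
    rw [pow_zero, mul_one, this, fc_zero]
    simp
    exact mul_one _
  | n + 1, k, b, hb => by
    have hf : form b = lodd (form fun i => b i.succ.succ) := form_succ_succ (N := 2 * n + 1) b
      (hb _ (by simp [Fin.ext_iff])) (hb _ (by rw [Ne, Fin.ext_iff]; simp; omega))
    have ih := form_mul_curv_pow n (fun i => k i.succ) (fun i => b i.succ.succ) fun i hi => hb _ fun h => hi (by
      rw [Fin.ext_iff] at h ⊢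
      simp at h ⊢
      omega)
    have e : (form b * curv (n + 1) k ^ (n + 1)) (hi (2 * n + 1 + 1 + 1)) (lo (2 * n + 1 + 1 + 1)) =
        (lodd (form fun i => b i.succ.succ) * lft ((curv n fun i => k i.succ) ^ (n + 1))) (hi (2 * n + 1 + 1 + 1)) (lo (2 * n + 1 + 1 + 1))
        + ((n + 1) * k 0) * (lodd (form fun i : Fin (2 * n + 1) => b i.succ.succ) * (pair (2 * n + 1) * lft ((curv n fun i => k i.succ) ^ n)))
          (hi (2 * n + 1 + 1 + 1)) (lo (2 * n + 1 + 1 + 1)) := by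
      rw [hf]
      have h := congrArg (lodd (form fun i : Fin (2 * n + 1) => b i.succ.succ) * ·) (pow_curv (k 0) (curv n fun i => k i.succ) n)
      simp only [mul_add, mul_smul_comm] at h
      exact congrFun (congrFun h _) _
    refine e.trans ((congrArg₂ (· + ·) (lodd_lft_apply (N := 2 * n + 1) _ _)
      (congrArg (_ * ·) ((lodd_pair_lft_apply (N := 2 * n + 1) _ _).trans ih))).trans ?_)
    change 0 + (n + 1) * k 0 * (n.factorial * (∏ i : Fin n, k i.succ) * b (Fin.last (2 * n)).succ.succ) = _
    rw [Fin.prod_univ_succ, Nat.factorial_succ]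
    push_cast
    change _ = _ * b (Fin.last (2 * n)).succ.succ
    ring

end TwoModes

section Kronecker
variable {κ : Type} [Fintype κ] [DecidableEq κ] {N : ℕ}

theorem Th_mul_Th (w v : Fin N → Matrix κ κ ℂ) (a b : κ) :
    (Th w * Th v) a b = ∑ i, ∑ j, (w i * v j) a b • (fc ℂ N i * fc ℂ N j) := by
  simp only [Matrix.mul_apply (M := Th w), Th_apply, Finset.sum_mul, Finset.mul_sum, Matrix.mul_apply (α := ℂ) (n := κ) (m := κ) (l := κ), Finset.sum_smul]
  rw [Finset.sum_comm]
  conv_rhs => rw [Finset.sum_comm]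
  refine Finset.sum_congr rfl fun i _ => ?_
  rw [Finset.sum_comm]
  simp only [smul_mul_smul_comm]

theorem curv_kronecker {p d₀ d₁ : Matrix (Fin 2) (Fin 2) ℂ} {Q : Matrix κ κ ℂ} {D : Fin N → Matrix κ κ ℂ} {k : ℂ} {F : FM ℂ N}
    (hp : p * p = p) (hQ : Q * Q = Q) (h0 : p * d₀ * p = 0) (h1 : p * d₁ * p = 0) (hk : p * d₀ * d₁ * p - p * d₁ * d₀ * p = k • p)
    (hF : Th (fun i => Q * D i) * Th (fun i => D i * Q) = Matrix.scalar κ F * cst N Q)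
    (D' : Fin (N + 1 + 1) → Matrix (Fin 2 × κ) (Fin 2 × κ) ℂ) (hD0 : D' 0 = d₀ ⊗ₖ Q) (hD1 : D' (Fin.succ 0) = d₁ ⊗ₖ Q)
    (hD : ∀ i, D' (Fin.succ (Fin.succ i)) = p ⊗ₖ D i) :
    Th (fun i => (p ⊗ₖ Q) * D' i) * Th (fun i => D' i * (p ⊗ₖ Q)) =
      Matrix.scalar _ (k • pair N + lft F) * cst (N + 1 + 1) (p ⊗ₖ Q) := by
  ext1 ⟨a, c⟩ ⟨b, d⟩
  have hF' := congrFun (congrFun hF c) d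
  rw [Th_mul_Th, Matrix.scalar_apply, Matrix.diagonal_mul, cst_apply, mul_smul_comm, mul_one] at hF' ⊢
  have hk' := congrFun (congrFun hk a) b
  have hlft : ∀ i j, fc ℂ (N + 1 + 1) i.succ.succ * fc ℂ (N + 1 + 1) j.succ.succ = lft (fc ℂ N i * fc ℂ N j) := fun i j => by
    rw [fc_succ_succ, fc_succ_succ, lodd_mul]
  have h0' : ∀ M, p * d₀ * (p * M) = 0 := fun M => by rw [← mul_assoc, h0, zero_mul]
  have h1' : ∀ M, p * d₁ * (p * M) = 0 := fun M => by rw [← mul_assoc, h1, zero_mul]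
  have h0r : p * (d₀ * p) = 0 := by rw [← mul_assoc, h0]
  have h1r : p * (d₁ * p) = 0 := by rw [← mul_assoc, h1]
  simp only [Fin.sum_univ_succ (n := N + 1), Fin.sum_univ_succ (n := N), hD0, hD1, hD, ← Matrix.mul_kronecker_mul, h0', h0, h1, h1', h0r, h1r, hp, hQ,
    Matrix.zero_kronecker, Matrix.zero_apply, zero_smul, Finset.sum_const_zero, add_zero, zero_add, fc_sq, smul_zero, hlft]
  have e : ∀ i j, ((p ⊗ₖ (Q * D i * (D j * Q))) (a, c) (b, d)) • lft (fc ℂ N i * fc ℂ N j) =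
      p a b • lft ((Q * D i * (D j * Q)) c d • (fc ℂ N i * fc ℂ N j)) := fun i j => by
    rw [Matrix.kroneckerMap_apply, lft_smul, smul_smul]
  simp only [e, ← Finset.smul_sum, ← lft_sum, hF']
  rw [lft_smul]
  rw [fc_anticomm _ (Fin.succ 0) 0]
  change ((p * d₀ * (d₁ * p)) ⊗ₖ Q) (a, c) (b, d) • pair N + (((p * d₁ * (d₀ * p)) ⊗ₖ Q) (a, c) (b, d) • -pair N + _) = _
  simp only [Matrix.kroneckerMap_apply, Matrix.sub_apply, Matrix.smul_apply, mul_assoc, smul_eq_mul] at hk' ⊢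
  rw [smul_neg, ← add_assoc, ← sub_eq_add_neg, ← sub_smul, ← sub_mul, hk']
  module

end Kronecker

end UnitaryCommutator

open scoped Matrix ContDiff Kronecker

namespace UnitaryCommutator

section Bott
variable {e f h e' f' h' z zi c : ℂ}

/-- The entries of a family of projections of rank one. -/
def pmat (e f h z zi : ℂ) : Matrix (Fin 2) (Fin 2) ℂ := !![e, f * zi + h; f * z + h, 1 - e]

/-- The derivative of the family of projections in the first direction. -/
def dmat₀ (e' f' h' z zi : ℂ) : Matrix (Fin 2) (Fin 2) ℂ := !![e', f' * zi + h'; f' * z + h', -e']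

/-- The derivative of the family of projections in the second direction. -/
def dmat₁ (f z zi c : ℂ) : Matrix (Fin 2) (Fin 2) ℂ := !![0, -(c * f * zi); c * f * z, 0]

theorem pmat_sq (hz : z * zi = 1) (h0 : f * h = 0) (h1 : f ^ 2 + h ^ 2 = e * (1 - e)) : pmat e f h z zi * pmat e f h z zi = pmat e f h z zi := by
  ext i j
  fin_cases i <;> fin_cases j <;> simp [pmat]
  · linear_combination h1 + f ^ 2 * hz + (z + zi) * h0
  · ring
  · ring
  · linear_combination h1 + f ^ 2 * hz + (z + zi) * h0

theorem dmat₀_eq (hz : z * zi = 1) (h1 : f' * h + f * h' = 0) (h2 : 2 * f * f' + 2 * h * h' = e' - 2 * e * e') :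
    dmat₀ e' f' h' z zi = dmat₀ e' f' h' z zi * pmat e f h z zi + pmat e f h z zi * dmat₀ e' f' h' z zi := by
  ext i j
  fin_cases i <;> fin_cases j <;> simp [pmat, dmat₀]
  · linear_combination - h2 - 2 * f * f' * hz - (z + zi) * h1
  · ring
  · ring
  · linear_combination - h2 - 2 * f * f' * hz - (z + zi) * h1

theorem dmat₁_eq (h0 : f * h = 0) :
    dmat₁ f z zi c = dmat₁ f z zi c * pmat e f h z zi + pmat e f h z zi * dmat₁ f z zi c := by
  ext i j
  fin_cases i <;> fin_cases j <;> simp [pmat, dmat₁]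
  · linear_combination - c * (z - zi) * h0
  · ring
  · ring
  · linear_combination c * (zi - z) * h0

theorem mul_mul_of_det_eq_zero {p : Matrix (Fin 2) (Fin 2) ℂ} (hp : p.det = 0) (A : Matrix (Fin 2) (Fin 2) ℂ) :
    p * A * p = (p * A).trace • p := by
  rw [Matrix.det_fin_two] at hp
  ext i j
  fin_cases i <;> fin_cases j <;> simp [Matrix.mul_apply, Fin.sum_univ_two, Matrix.trace]
  · linear_combination (-(A 1 1)) * hp
  · linear_combination (A 0 1) * hp
  · linear_combination (A 1 0) * hp
  · linear_combination (-(A 0 0)) * hp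

theorem pmat_curvature (hz : z * zi = 1) (h0 : f * h = 0) (h1 : f ^ 2 + h ^ 2 = e * (1 - e)) (h2 : f * h' = 0) :
    pmat e f h z zi * dmat₀ e' f' h' z zi * dmat₁ f z zi c * pmat e f h z zi -
      pmat e f h z zi * dmat₁ f z zi c * dmat₀ e' f' h' z zi * pmat e f h z zi =
      (2 * c * f * ((2 * e - 1) * f' - 2 * e' * f)) • pmat e f h z zi := by
  have hdet : (pmat e f h z zi).det = 0 := by
    rw [Matrix.det_fin_two]
    simp [pmat]
    linear_combination - h1 - f ^ 2 * hz - (z + zi) * h0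
  have hc : ∀ p A B : Matrix (Fin 2) (Fin 2) ℂ, p * A * B * p - p * B * A * p = p * (A * B - B * A) * p := fun p A B => by
    noncomm_ring
  rw [hc, mul_mul_of_det_eq_zero hdet]
  congr 1
  simp [pmat, dmat₀, dmat₁, Matrix.trace, Matrix.mul_apply, Fin.sum_univ_two]
  linear_combination (2 * e - 1) * c * (2 * f * f' * hz + (z + zi) * h2) - 2 * c * e' * (2 * f ^ 2 * hz + (z + zi) * h0)

end Bott
end UnitaryCommutator

open scoped Matrix ContDiff Kronecker
open MeasureTheory

namespace UnitaryCommutator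

section Profile

/-- The latitude in a map from the circle to a meridian. -/
noncomputable def lat (x : ℂ) : ℝ := Real.pi * Real.smoothTransition (1 / 2 + x.re)

/-- A cutoff distinguishing the two halves of the circle. -/
noncomputable def cut (x : ℂ) : ℝ := Real.smoothTransition (1 / 2 + x.im)

/-- The diagonal entry of the projection. -/
noncomputable def diagE (x : ℂ) : ℝ := (1 + Real.cos (lat x)) / 2

/-- The coefficient of the non-constant part of the off-diagonal entry of the projection. -/
noncomputable def offF (x : ℂ) : ℝ := Real.sin (lat x) / 2 * cut x

/-- The constant part of the off-diagonal entry of the projection. -/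
noncomputable def offH (x : ℂ) : ℝ := Real.sin (lat x) / 2 * (1 - cut x)

theorem sin_lat_mul_cut (c : Circle) : Real.sin (lat c) * (cut c * (1 - cut c)) = 0 := by
  have h : (c : ℂ).re ^ 2 + (c : ℂ).im ^ 2 = 1 := by
    have := c.normSq_coe
    rw [Complex.normSq_apply] at this
    linarith
  rcases le_or_gt (c : ℂ).re (-(1 / 2)) with h1 | h1
  · rw [lat, Real.smoothTransition.zero_of_nonpos (by linarith)]; simp
  rcases le_or_gt (1 / 2) (c : ℂ).re with h2 | h2
  · rw [lat, Real.smoothTransition.one_of_one_le (by linarith)]; simp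
  rcases le_or_gt (1 / 2) (c : ℂ).im with h3 | h3
  · rw [cut, Real.smoothTransition.one_of_one_le (by linarith)]; simp
  rcases le_or_gt (c : ℂ).im (-(1 / 2)) with h4 | h4
  · rw [cut, Real.smoothTransition.zero_of_nonpos (by linarith)]; simp
  · nlinarith

theorem offF_mul_offH (c : Circle) : offF c * offH c = 0 := by
  rw [offF, offH]
  linear_combination Real.sin (lat c) / 4 * sin_lat_mul_cut c

theorem offF_sq_add (c : Circle) : offF c ^ 2 + offH c ^ 2 = diagE c * (1 - diagE c) := by
  rw [offF, offH, diagE]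
  linear_combination (-Real.sin (lat c) / 2) * sin_lat_mul_cut c + (1 / 4) * Real.sin_sq_add_cos_sq (lat c)

theorem contDiff_lat : ContDiff ℝ ∞ lat :=
  contDiff_const.mul (Real.smoothTransition.contDiff.comp (contDiff_const.add Complex.reCLM.contDiff))

theorem contDiff_cut : ContDiff ℝ ∞ cut :=
  Real.smoothTransition.contDiff.comp (contDiff_const.add Complex.imCLM.contDiff)

theorem contDiff_diagE : ContDiff ℝ ∞ diagE :=
  (contDiff_const.add (Real.contDiff_cos.comp contDiff_lat)).div_const 2

theorem contDiff_offF : ContDiff ℝ ∞ offF :=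
  ((Real.contDiff_sin.comp contDiff_lat).div_const 2).mul contDiff_cut

theorem contDiff_offH : ContDiff ℝ ∞ offH :=
  ((Real.contDiff_sin.comp contDiff_lat).div_const 2).mul (contDiff_const.sub contDiff_cut)

theorem contDiff_ex_one : ContDiff ℝ ∞ fun t : ℝ => (ex t : ℂ) := by
  simp only [ex, Circle.coe_exp]
  exact ((Complex.ofRealCLM.contDiff.comp (contDiff_const.mul contDiff_id)).mul contDiff_const).cexp

theorem hasDerivAt_along {φ : ℂ → ℝ} (h : ContDiff ℝ ∞ φ) (t : ℝ) :
    HasDerivAt (fun t : ℝ => φ (ex t)) (deriv (fun t : ℝ => φ (ex t)) t) t :=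
  ((h.comp contDiff_ex_one).differentiable (by simp) t).hasDerivAt

theorem offF_mul_deriv_offH (t : ℝ) :
    deriv (fun t : ℝ => offF (ex t)) t * offH (ex t) + offF (ex t) * deriv (fun t : ℝ => offH (ex t)) t = 0 ∧
      offF (ex t) * deriv (fun t : ℝ => offH (ex t)) t = 0 := by
  have h0 := offF_mul_offH (ex t)
  have h1 : deriv (fun t : ℝ => offF (ex t)) t * offH (ex t) + offF (ex t) * deriv (fun t : ℝ => offH (ex t)) t = 0 := by
    have := (hasDerivAt_along contDiff_offF t).mul (hasDerivAt_along contDiff_offH t)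
    refine this.unique ?_
    have e : ((fun t : ℝ => offF (ex t)) * fun t : ℝ => offH (ex t)) = fun _ => 0 := funext fun t => offF_mul_offH (ex t)
    rw [e]
    exact hasDerivAt_const _ _
  refine ⟨h1, ?_⟩
  rcases mul_eq_zero.1 h0 with h | h
  · rw [h, zero_mul]
  · rwa [h, mul_zero, zero_add] at h1

theorem deriv_diagE (t : ℝ) :
    2 * offF (ex t) * deriv (fun t : ℝ => offF (ex t)) t + 2 * offH (ex t) * deriv (fun t : ℝ => offH (ex t)) t =
      deriv (fun t : ℝ => diagE (ex t)) t - 2 * diagE (ex t) * deriv (fun t : ℝ => diagE (ex t)) t := by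
  have hF := hasDerivAt_along contDiff_offF t
  have hH := hasDerivAt_along contDiff_offH t
  have hE := hasDerivAt_along contDiff_diagE t
  have h1 := (hF.mul hF).add (hH.mul hH)
  have h2 := hE.sub (hE.mul hE)
  have e : (((fun t : ℝ => offF (ex t)) * fun t : ℝ => offF (ex t)) + (fun t : ℝ => offH (ex t)) * fun t : ℝ => offH (ex t)) =
      (fun t : ℝ => diagE (ex t)) - (fun t : ℝ => diagE (ex t)) * fun t : ℝ => diagE (ex t) := funext fun t => by
    have := offF_sq_add (ex t)
    simp only [Pi.add_apply, Pi.mul_apply, Pi.sub_apply]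
    linear_combination this
  rw [e] at h1
  have := h1.unique h2
  linear_combination this

/-- The curvature of the family of projections. -/
noncomputable def bottCurv (t : ℝ) : ℝ :=
  offF (ex t) * ((2 * diagE (ex t) - 1) * deriv (fun t : ℝ => offF (ex t)) t - 2 * deriv (fun t : ℝ => diagE (ex t)) t * offF (ex t))

theorem bottCurv_eq (t : ℝ) : bottCurv t = deriv (fun t : ℝ => lat (ex t)) t * Real.sin (lat (ex t)) * cut (ex t) ^ 2 / 4 := by
  have ha := hasDerivAt_along contDiff_lat t
  have hc := hasDerivAt_along contDiff_cut t
  have hF : deriv (fun t : ℝ => offF (ex t)) t = _ := ((ha.sin.div_const 2).mul hc).deriv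
  have hE : deriv (fun t : ℝ => diagE (ex t)) t = _ := ((ha.cos.const_add 1).div_const 2).deriv
  have h0 := sin_lat_mul_cut (ex t)
  have h1 : Real.sin (lat (ex t)) ^ 2 * deriv (fun t : ℝ => cut (ex t)) t = 0 := by
    have h2 := ha.sin.mul (hc.mul (hc.const_sub 1))
    have e : ((fun t : ℝ => Real.sin (lat (ex t))) * ((fun t : ℝ => cut (ex t)) * fun t : ℝ => 1 - cut (ex t))) = fun _ => 0 :=
      funext fun t => sin_lat_mul_cut (ex t)
    rw [e] at h2
    have h3 := h2.unique (hasDerivAt_const _ _)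
    simp only [Pi.mul_apply] at h3
    generalize deriv (fun t : ℝ => cut (ex t)) t = c' at *
    generalize deriv (fun t : ℝ => lat (ex t)) t = a' at *
    generalize Real.sin (lat (ex t)) = s at *
    generalize Real.cos (lat (ex t)) = u at *
    generalize cut (ex t) = x at *
    linear_combination s * (1 - 2 * x) * h3 + (4 * s * c' - u * a' * (1 - 2 * x)) * h0
  rw [bottCurv, hF, hE, offF, diagE]
  have h4 := Real.sin_sq_add_cos_sq (lat (ex t))
  generalize deriv (fun t : ℝ => cut (ex t)) t = c' at *
  generalize deriv (fun t : ℝ => lat (ex t)) t = a' at *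
  generalize Real.sin (lat (ex t)) = s at *
  generalize Real.cos (lat (ex t)) = u at *
  generalize cut (ex t) = x at *
  linear_combination (u * x / 4) * h1 + (a' * s * x ^ 2 / 4) * h4

theorem ex_re (t : ℝ) : (ex t : ℂ).re = Real.cos (2 * Real.pi * t) := by
  rw [ex, Circle.coe_exp, Complex.exp_ofReal_mul_I_re]

theorem ex_im (t : ℝ) : (ex t : ℂ).im = Real.sin (2 * Real.pi * t) := by
  rw [ex, Circle.coe_exp, Complex.exp_ofReal_mul_I_im]

theorem sin_lat_cut_of_pos {c : Circle} (h : 0 ≤ (c : ℂ).im) : Real.sin (lat c) * cut c ^ 2 = Real.sin (lat c) := by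
  have h0 := sin_lat_mul_cut c
  have h1 : cut c ≠ 0 := (Real.smoothTransition.pos_of_pos (by linarith)).ne'
  rcases mul_eq_zero.1 h0 with h2 | h2
  · rw [h2, zero_mul]
  · have : cut c = 1 := by
      rcases mul_eq_zero.1 h2 with h3 | h3
      · exact absurd h3 h1
      · linarith
    rw [this]; ring

theorem sin_lat_cut_of_neg {c : Circle} (h : (c : ℂ).im ≤ 0) : Real.sin (lat c) * cut c ^ 2 = 0 := by
  have h0 := sin_lat_mul_cut c
  rcases mul_eq_zero.1 h0 with h2 | h2
  · rw [h2, zero_mul]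
  · have : cut c = 0 := by
      rcases mul_eq_zero.1 h2 with h3 | h3
      · exact h3
      · exfalso
        have h5 : (c : ℂ).re ^ 2 + (c : ℂ).im ^ 2 = 1 := by
          have := c.normSq_coe
          rw [Complex.normSq_apply] at this
          linarith
        have h6 : Real.smoothTransition (1 / 2 + (c : ℂ).im) < 1 := Real.smoothTransition.lt_one_of_lt_one (by linarith)
        rw [cut] at h3
        linarith
    rw [this]; ring

theorem integral_bottCurv : ∫ t in Set.Icc (0 : ℝ) 1, bottCurv t = -(1 / 2) := by
  rw [integral_Icc_eq_integral_Ioc, ← intervalIntegral.integral_of_le zero_le_one]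
  have hcont : Continuous (deriv fun t : ℝ => -Real.cos (lat (ex t))) := by
    have : ContDiff ℝ 1 fun t : ℝ => -Real.cos (lat (ex t)) :=
      ((Real.contDiff_cos.comp (contDiff_lat.comp contDiff_ex_one)).neg).of_le (by exact_mod_cast le_top)
    exact this.continuous_deriv le_rfl
  have hder : ∀ t, HasDerivAt (fun t : ℝ => -Real.cos (lat (ex t))) (deriv (fun t : ℝ => lat (ex t)) t * Real.sin (lat (ex t))) t := fun t => by
    have := (hasDerivAt_along contDiff_lat t).cos.neg
    rw [neg_mul, neg_neg, mul_comm] at this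
    exact this
  have hderiv : ∀ t, deriv (fun t : ℝ => -Real.cos (lat (ex t))) t = deriv (fun t : ℝ => lat (ex t)) t * Real.sin (lat (ex t)) :=
    fun t => (hder t).deriv
  have h1 : ∫ t in (0 : ℝ)..1 / 2, bottCurv t = ∫ t in (0 : ℝ)..1 / 2, deriv (fun t : ℝ => -Real.cos (lat (ex t))) t * (1 / 4) := by
    refine intervalIntegral.integral_congr fun t ht => ?_
    rw [Set.uIcc_of_le (by norm_num)] at ht
    rw [bottCurv_eq, hderiv, mul_assoc (deriv _ _), sin_lat_cut_of_pos]
    · ring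
    · rw [ex_im]
      exact Real.sin_nonneg_of_nonneg_of_le_pi (by have := ht.1; positivity) (by nlinarith [ht.2, Real.pi_pos])
  have h2 : ∫ t in (1 / 2 : ℝ)..1, bottCurv t = ∫ t in (1 / 2 : ℝ)..1, (0 : ℝ) := by
    refine intervalIntegral.integral_congr fun t ht => ?_
    rw [Set.uIcc_of_le (by norm_num)] at ht
    rw [bottCurv_eq, mul_assoc (deriv _ _), sin_lat_cut_of_neg]
    · ring
    · rw [ex_im, ← Real.sin_sub_two_pi]
      exact Real.sin_nonpos_of_nonpos_of_neg_pi_le (by nlinarith [ht.2, Real.pi_pos]) (by nlinarith [ht.1, Real.pi_pos])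
  have hcont' : Continuous bottCurv := by
    have : bottCurv = fun t => deriv (fun t : ℝ => -Real.cos (lat (ex t))) t * cut (ex t) ^ 2 / 4 := funext fun t => by
      rw [bottCurv_eq, hderiv]
    rw [this]
    have := contDiff_cut.continuous.comp contDiff_ex_one.continuous
    exact (hcont.mul (this.pow 2)).div_const 4
  rw [← intervalIntegral.integral_add_adjacent_intervals (b := 1 / 2) (hcont'.intervalIntegrable _ _) (hcont'.intervalIntegrable _ _),
    h1, h2, intervalIntegral.integral_mul_const, intervalIntegral.integral_deriv_eq_sub (fun t _ => (hder t).differentiableAt)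
      (hcont.intervalIntegrable _ _)]
  have e0 : lat (ex 0) = Real.pi := by
    rw [lat, Real.smoothTransition.one_of_one_le (by simp)]; simp
  have e1 : lat (ex (1 / 2)) = 0 := by
    rw [lat, ex_re, show 2 * Real.pi * (1 / 2) = Real.pi by ring, Real.cos_pi, Real.smoothTransition.zero_of_nonpos (by norm_num)]; simp
  rw [e0, e1]
  norm_num

end Profile
end UnitaryCommutator

open scoped Matrix ContDiff Kronecker
open MeasureTheory

namespace UnitaryCommutator

section IteratedBott

/-- Index types of iterated products of `2 × 2` matrices. -/
def Kap : ℕ → Type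
  | 0 => Unit
  | n + 1 => Fin 2 × Kap n

instance fintypeKap : ∀ n, Fintype (Kap n)
  | 0 => inferInstanceAs (Fintype Unit)
  | n + 1 =>
    have := fintypeKap n
    inferInstanceAs (Fintype (Fin 2 × Kap n))

instance decEqKap : ∀ n, DecidableEq (Kap n)
  | 0 => inferInstanceAs (DecidableEq Unit)
  | n + 1 =>
    have := decEqKap n
    inferInstanceAs (DecidableEq (Fin 2 × Kap n))

/-- A family of projections of rank one on the torus. -/
noncomputable def bott (x w : Circle) : Matrix (Fin 2) (Fin 2) ℂ :=
  pmat (diagE x) (offF x) (offH x) w (w⁻¹ : Circle)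

/-- The first derivative of the family of projections. -/
noncomputable def bott₀ (s t : ℝ) : Matrix (Fin 2) (Fin 2) ℂ :=
  dmat₀ (deriv (fun t : ℝ => diagE (ex t)) s : ℝ) (deriv (fun t : ℝ => offF (ex t)) s : ℝ) (deriv (fun t : ℝ => offH (ex t)) s : ℝ)
    (ex t) ((ex t)⁻¹ : Circle)

/-- The second derivative of the family of projections. -/
noncomputable def bott₁ (s t : ℝ) : Matrix (Fin 2) (Fin 2) ℂ :=
  dmat₁ (offF (ex s)) (ex t) ((ex t)⁻¹ : Circle) (2 * Real.pi * Complex.I)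

theorem circle_mul_inv (w : Circle) : (w : ℂ) * (w⁻¹ : Circle) = 1 := by
  rw [← Circle.coe_mul, mul_inv_cancel, Circle.coe_one]

theorem bott_sq (x w : Circle) : bott x w * bott x w = bott x w :=
  pmat_sq (circle_mul_inv w) (by exact_mod_cast offF_mul_offH x) (by exact_mod_cast offF_sq_add x)

theorem bott_trace (x w : Circle) : (bott x w).trace = 1 := by
  simp [bott, pmat, Matrix.trace, Fin.sum_univ_two]

theorem bott₀_eq (s t : ℝ) : bott₀ s t = bott₀ s t * bott (ex s) (ex t) + bott (ex s) (ex t) * bott₀ s t :=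
  dmat₀_eq (circle_mul_inv _) (by exact_mod_cast (offF_mul_deriv_offH s).1) (by exact_mod_cast deriv_diagE s)

theorem bott₁_eq (s t : ℝ) : bott₁ s t = bott₁ s t * bott (ex s) (ex t) + bott (ex s) (ex t) * bott₁ s t :=
  dmat₁_eq (by exact_mod_cast offF_mul_offH (ex s))

theorem bott_curvature (s t : ℝ) : bott (ex s) (ex t) * bott₀ s t * bott₁ s t * bott (ex s) (ex t) -
    bott (ex s) (ex t) * bott₁ s t * bott₀ s t * bott (ex s) (ex t) = (4 * Real.pi * Complex.I * bottCurv s) • bott (ex s) (ex t) := by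
  refine (pmat_curvature (circle_mul_inv _) (by exact_mod_cast offF_mul_offH (ex s)) (by exact_mod_cast offF_sq_add (ex s))
    (by exact_mod_cast (offF_mul_deriv_offH s).2)).trans ?_
  rw [bottCurv]
  push_cast
  congr 1
  ring

theorem hasDerivAt_ex (t : ℝ) : HasDerivAt (fun t : ℝ => (ex t : ℂ)) (2 * Real.pi * Complex.I * ex t) t := by
  simp only [ex, Circle.coe_exp]
  have h : HasDerivAt (fun t : ℝ => ((2 * Real.pi * t : ℝ) : ℂ) * Complex.I) (2 * Real.pi * Complex.I) t := by
    have := ((hasDerivAt_id t).const_mul (2 * Real.pi)).ofReal_comp.mul_const Complex.I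
    simpa using this
  convert h.cexp using 1
  ring

theorem hasDerivAt_ex_inv (t : ℝ) : HasDerivAt (fun t : ℝ => (((ex t)⁻¹ : Circle) : ℂ)) (-(2 * Real.pi * Complex.I * ((ex t)⁻¹ : Circle))) t := by
  have e : ∀ t, (ex t)⁻¹ = ex (-t) := fun t => by rw [ex, ex, ← Circle.exp_neg, mul_neg]
  simp only [e]
  have := (hasDerivAt_ex (-t)).scomp t (hasDerivAt_neg t)
  exact this.congr_deriv (neg_one_smul _ _)

theorem hasDerivAt_bott₀ (s t : ℝ) (a b : Fin 2) : HasDerivAt (fun s : ℝ => bott (ex s) (ex t) a b) (bott₀ s t a b) s := by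
  have hE := (hasDerivAt_along contDiff_diagE s).ofReal_comp
  have hF := (hasDerivAt_along contDiff_offF s).ofReal_comp
  have hH := (hasDerivAt_along contDiff_offH s).ofReal_comp
  fin_cases a <;> fin_cases b
  · exact hE
  · exact (hF.mul_const _).add hH
  · exact (hF.mul_const _).add hH
  · exact hE.const_sub 1

theorem hasDerivAt_bott₁ (s t : ℝ) (a b : Fin 2) : HasDerivAt (fun t : ℝ => bott (ex s) (ex t) a b) (bott₁ s t a b) t := by
  fin_cases a <;> fin_cases b
  · exact hasDerivAt_const _ _
  · refine (((hasDerivAt_ex_inv t).const_mul (offF (ex s) : ℂ)).add_const (offH (ex s) : ℂ)).congr_deriv ?_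
    change _ = -(2 * Real.pi * Complex.I * offF (ex s) * ((ex t)⁻¹ : Circle))
    ring
  · refine (((hasDerivAt_ex t).const_mul (offF (ex s) : ℂ)).add_const (offH (ex s) : ℂ)).congr_deriv ?_
    change _ = 2 * Real.pi * Complex.I * offF (ex s) * ex t
    ring
  · exact hasDerivAt_const _ _

theorem continuous_bott : Continuous fun p : Circle × Circle => bott p.1 p.2 := by
  have hc : Continuous fun x : Circle => (x : ℂ) := by fun_prop
  have hE : Continuous fun x : Circle => (diagE x : ℂ) := Complex.continuous_ofReal.comp (contDiff_diagE.continuous.comp hc)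
  have hF : Continuous fun x : Circle => (offF x : ℂ) := Complex.continuous_ofReal.comp (contDiff_offF.continuous.comp hc)
  have hH : Continuous fun x : Circle => (offH x : ℂ) := Complex.continuous_ofReal.comp (contDiff_offH.continuous.comp hc)
  refine continuous_matrix fun a b => ?_
  have h1 : Continuous fun p : Circle × Circle => (p.2 : ℂ) := by fun_prop
  have h2 : Continuous fun p : Circle × Circle => ((p.2⁻¹ : Circle) : ℂ) := by fun_prop
  fin_cases a <;> fin_cases b
  · exact hE.comp continuous_fst
  · exact ((hF.comp continuous_fst).mul h2).add (hH.comp continuous_fst)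
  · exact ((hF.comp continuous_fst).mul h1).add (hH.comp continuous_fst)
  · exact continuous_const.sub (hE.comp continuous_fst)

theorem contDiff_bott {N : ℕ} {u v : (Fin N → ℝ) → ℝ} (hu : ContDiff ℝ ∞ u) (hv : ContDiff ℝ ∞ v) (a b : Fin 2) :
    ContDiff ℝ ∞ fun r => bott (ex (u r)) (ex (v r)) a b := by
  have h : ∀ {φ : ℂ → ℝ}, ContDiff ℝ ∞ φ → ContDiff ℝ ∞ fun r => (φ (ex (u r)) : ℂ) := fun hφ =>
    Complex.ofRealCLM.contDiff.comp (hφ.comp (contDiff_ex hu))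
  have e : ∀ t, (ex t)⁻¹ = ex (-t) := fun t => by rw [ex, ex, ← Circle.exp_neg, mul_neg]
  have hi : ContDiff ℝ ∞ fun r => (((ex (v r))⁻¹ : Circle) : ℂ) := by
    simp only [e]
    exact contDiff_ex hv.neg
  fin_cases a <;> fin_cases b
  · exact h contDiff_diagE
  · exact ((h contDiff_offF).mul hi).add (h contDiff_offH)
  · exact ((h contDiff_offF).mul (contDiff_ex hv)).add (h contDiff_offH)
  · exact contDiff_const.sub (h contDiff_diagE)

/-- The iterated exterior product of the projections. -/
noncomputable def proj : ∀ n, X n → Matrix (Kap n) (Kap n) ℂ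
  | 0 => fun _ => 1
  | n + 1 => fun x : Circle × (Circle × X n) => (bott x.1 x.2.1 ⊗ₖ proj n x.2.2 : Matrix (Fin 2 × Kap n) (Fin 2 × Kap n) ℂ)

/-- The derivatives of the iterated exterior product of the projections. -/
noncomputable def dproj : ∀ n, (Fin (2 * n + 1) → ℝ) → Fin (2 * n + 1) → Matrix (Kap n) (Kap n) ℂ
  | 0 => fun _ _ => 0
  | n + 1 => fun r =>
    (Fin.cons (bott₀ (r 0) (r 1) ⊗ₖ proj n (En n fun i => r i.succ.succ))
      (Fin.cons (bott₁ (r 0) (r 1) ⊗ₖ proj n (En n fun i => r i.succ.succ))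
        fun i => bott (ex (r 0)) (ex (r 1)) ⊗ₖ dproj n (fun i => r i.succ.succ) i) :
      Fin (2 * n + 1 + 1 + 1) → Matrix (Fin 2 × Kap n) (Fin 2 × Kap n) ℂ)

/-- The curvatures of the factors. -/
noncomputable def kap : ∀ n, (Fin (2 * n + 1) → ℝ) → Fin n → ℂ
  | 0 => fun _ => Fin.elim0
  | n + 1 => fun r => (Fin.cons (4 * Real.pi * Complex.I * bottCurv (r 0)) (kap n fun i => r i.succ.succ) : Fin (n + 1) → ℂ)

theorem proj_sq : ∀ (n : ℕ) (x : X n), proj n x * proj n x = proj n x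
  | 0, _ => one_mul _
  | n + 1, x => (Matrix.mul_kronecker_mul _ _ _ _).symm.trans (by
      rw [bott_sq, proj_sq n]
      rfl)

theorem proj_trace : ∀ (n : ℕ) (x : X n), (proj n x).trace = 1
  | 0, _ => (Matrix.trace_one (n := Unit) (R := ℂ)).trans (by simp)
  | n + 1, x => (Matrix.trace_kronecker _ _).trans (by rw [bott_trace, proj_trace n, one_mul])

theorem continuous_bott_kronecker {Y κ : Type} [TopologicalSpace Y] {P : Y → Matrix κ κ ℂ} (h : Continuous P) :
    Continuous fun x : Circle × (Circle × Y) => bott x.1 x.2.1 ⊗ₖ P x.2.2 := by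
  have h1 : Continuous ((fun p : Circle × Circle => bott p.1 p.2) ∘ fun x : Circle × (Circle × Y) => (x.1, x.2.1)) :=
    continuous_bott.comp (by fun_prop)
  simp only [Function.comp_def] at h1
  have h2 : Continuous fun x : Circle × (Circle × Y) => P x.2.2 :=
    h.comp (by fun_prop : Continuous fun x : Circle × (Circle × Y) => x.2.2)
  refine continuous_matrix fun a b => ?_
  simp only [Matrix.kroneckerMap_apply]
  exact (h1.matrix_elem a.1 b.1).mul (h2.matrix_elem a.2 b.2)

theorem continuous_proj : ∀ n, Continuous (proj n)
  | 0 => continuous_const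
  | n + 1 => continuous_bott_kronecker (continuous_proj n)

theorem contDiff_proj : ∀ (n : ℕ) {N : ℕ} (u : (Fin N → ℝ) → Fin (2 * n + 1) → ℝ), (∀ i, ContDiff ℝ ∞ fun r => u r i) →
    ∀ a b, ContDiff ℝ ∞ fun r => proj n (En n (u r)) a b
  | 0, _, _, _, _, _ => contDiff_const
  | n + 1, N, u, hu, a, b => by
    have ih := contDiff_proj n (fun r i => u r (Fin.succ (Fin.succ i))) (fun i => hu _)
    have h : ∀ a b : Fin 2 × Kap n, ContDiff ℝ ∞ fun r : Fin N → ℝ =>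
        bott (ex (u r 0)) (ex (u r 1)) a.1 b.1 * proj n (En n fun i => u r (Fin.succ (Fin.succ i))) a.2 b.2 :=
      fun a b => (contDiff_bott (hu 0) (hu 1) a.1 b.1).mul (ih a.2 b.2)
    exact h a b

theorem dproj_eq : ∀ (n : ℕ) (r : Fin (2 * n + 1) → ℝ) (i),
    dproj n r i = dproj n r i * proj n (En n r) + proj n (En n r) * dproj n r i
  | 0, _, _ => by simp [dproj]
  | n + 1, r, i => by
    have key : ∀ D : Matrix (Fin 2 × Kap n) (Fin 2 × Kap n) ℂ, dproj (n + 1) r i = D →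
        D = D * (bott (ex (r 0)) (ex (r 1)) ⊗ₖ proj n (En n fun i => r i.succ.succ)) +
          (bott (ex (r 0)) (ex (r 1)) ⊗ₖ proj n (En n fun i => r i.succ.succ)) * D →
        dproj (n + 1) r i = dproj (n + 1) r i * proj (n + 1) (En (n + 1) r) + proj (n + 1) (En (n + 1) r) * dproj (n + 1) r i := by
      intro D h1 h2
      rw [h1]
      exact h2
    revert key
    refine Fin.cases (fun key => ?_) (fun i => Fin.cases (fun key => ?_) (fun i key => ?_) i) (i : Fin (2 * n + 1 + 1 + 1))
    · refine key (bott₀ (r 0) (r 1) ⊗ₖ proj n (En n fun i => r i.succ.succ)) rfl ?_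
      rw [← Matrix.mul_kronecker_mul, ← Matrix.mul_kronecker_mul, proj_sq, ← Matrix.add_kronecker, ← bott₀_eq]
    · refine key (bott₁ (r 0) (r 1) ⊗ₖ proj n (En n fun i => r i.succ.succ)) rfl ?_
      rw [← Matrix.mul_kronecker_mul, ← Matrix.mul_kronecker_mul, proj_sq, ← Matrix.add_kronecker, ← bott₁_eq]
    · refine key (bott (ex (r 0)) (ex (r 1)) ⊗ₖ dproj n (fun i => r i.succ.succ) i) rfl ?_
      rw [← Matrix.mul_kronecker_mul, ← Matrix.mul_kronecker_mul, bott_sq, ← Matrix.kronecker_add, ← dproj_eq n]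

theorem mul_mul_of_eq {κ : Type} [Fintype κ] [DecidableEq κ] {Q D : Matrix κ κ ℂ} (hQ : Q * Q = Q) (hD : D = D * Q + Q * D) : Q * D * Q = 0 := by
  have := congrArg (fun M => Q * M * Q) hD
  simp only [mul_add, add_mul, mul_assoc, hQ] at this
  simp only [← mul_assoc, hQ] at this
  exact left_eq_add.1 this

theorem curv_proj : ∀ (n : ℕ) (r : Fin (2 * n + 1) → ℝ),
    Th (fun i => proj n (En n r) * dproj n r i) * Th (fun i => dproj n r i * proj n (En n r)) =
      Matrix.scalar _ (curv n (kap n r)) * cst _ (proj n (En n r))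
  | 0, r => by
    have e : (fun i => proj 0 (En 0 r) * dproj 0 r i) = fun _ => 0 := funext fun i => mul_zero _
    have e' : curv 0 (kap 0 r) = 0 := rfl
    have h : Th (fun _ : Fin (2 * 0 + 1) => (0 : Matrix (Kap 0) (Kap 0) ℂ)) = 0 := by
      ext1 a b
      simp [Th]
    rw [e, e', h, zero_mul, map_zero, zero_mul]
  | n + 1, r =>
    curv_kronecker (N := 2 * n + 1) (bott_sq _ _) (proj_sq n _) (mul_mul_of_eq (bott_sq _ _) (bott₀_eq _ _))
      (mul_mul_of_eq (bott_sq _ _) (bott₁_eq _ _)) (bott_curvature _ _) (curv_proj n fun i => r i.succ.succ)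
      (dproj (n + 1) r) rfl rfl fun i => rfl

end IteratedBott
end UnitaryCommutator

open scoped Matrix ContDiff Kronecker
open MeasureTheory

namespace UnitaryCommutator

section BottWinding

theorem hasDerivAt_line {f : ℝ → ℂ} {f' : ℂ} {x : ℝ} (h : HasDerivAt f f' x) : HasDerivAt (fun s => f (x + s)) f' 0 := by
  have h' : HasDerivAt f f' (x + 0) := by rwa [add_zero]
  exact h'.comp_const_add x 0

theorem hasDerivAt_proj : ∀ (n : ℕ) (r : Fin (2 * n + 1) → ℝ) (j : Fin (2 * n + 1)) (a b : Kap n),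
    HasDerivAt (fun s : ℝ => proj n (En n fun i => r i + s * Pi.single (M := fun _ => ℝ) j 1 i) a b) (dproj n r j a b) 0
  | 0, _, _, _, _ => hasDerivAt_const _ _
  | n + 1, r, j, a, b => by
    have ih := hasDerivAt_proj n fun i => r i.succ.succ
    have key : ∀ (j : Fin (2 * n + 1 + 1 + 1)) (a b : Fin 2 × Kap n), HasDerivAt (fun s : ℝ =>
        bott (ex (r 0 + s * Pi.single (M := fun _ => ℝ) j 1 0)) (ex (r 1 + s * Pi.single (M := fun _ => ℝ) j 1 1)) a.1 b.1 *
          proj n (En n fun i => r i.succ.succ + s * Pi.single (M := fun _ => ℝ) j 1 i.succ.succ) a.2 b.2)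
        ((Fin.cons (bott₀ (r 0) (r 1) ⊗ₖ proj n (En n fun i => r i.succ.succ))
      (Fin.cons (bott₁ (r 0) (r 1) ⊗ₖ proj n (En n fun i => r i.succ.succ))
        fun i => bott (ex (r 0)) (ex (r 1)) ⊗ₖ dproj n (fun i => r i.succ.succ) i) :
      Fin (2 * n + 1 + 1 + 1) → Matrix (Fin 2 × Kap n) (Fin 2 × Kap n) ℂ) j a b) 0 := by
      intro j a b
      refine Fin.cases ?_ (fun j => Fin.cases ?_ (fun j => ?_) j) j
      · have e (i : Fin (2 * n + 1)) : Pi.single (M := fun _ => ℝ) (0 : Fin (2 * n + 1 + 1 + 1)) 1 i.succ.succ = 0 :=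
          Pi.single_eq_of_ne (Fin.succ_ne_zero _) _
        have e1 : Pi.single (M := fun _ => ℝ) (0 : Fin (2 * n + 1 + 1 + 1)) 1 1 = 0 :=
          Pi.single_eq_of_ne (Fin.succ_ne_zero 0) _
        simp only [e, e1, Pi.single_eq_same, mul_one, mul_zero, add_zero]
        exact (hasDerivAt_line (hasDerivAt_bott₀ (r 0) (r 1) a.1 b.1)).mul_const _
      · have e (i : Fin (2 * n + 1)) : Pi.single (M := fun _ => ℝ) (Fin.succ 0 : Fin (2 * n + 1 + 1 + 1)) 1 i.succ.succ = 0 :=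
          Pi.single_eq_of_ne (fun h => Fin.succ_ne_zero _ (Fin.succ_injective _ h)) _
        have e0 : Pi.single (M := fun _ => ℝ) (Fin.succ 0 : Fin (2 * n + 1 + 1 + 1)) 1 0 = 0 :=
          Pi.single_eq_of_ne (Fin.succ_ne_zero 0).symm _
        have e1 : Pi.single (M := fun _ => ℝ) (Fin.succ 0 : Fin (2 * n + 1 + 1 + 1)) 1 1 = 1 := Pi.single_eq_same _ _
        simp only [e, e0, e1, mul_one, mul_zero, add_zero]
        exact (hasDerivAt_line (hasDerivAt_bott₁ (r 0) (r 1) a.1 b.1)).mul_const _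
      · have e (i : Fin (2 * n + 1)) : Pi.single (M := fun _ => ℝ) (j.succ.succ : Fin (2 * n + 1 + 1 + 1)) 1 i.succ.succ =
            Pi.single (M := fun _ => ℝ) j 1 i := by
          simp [Pi.single_apply]
        have e0 : Pi.single (M := fun _ => ℝ) (j.succ.succ : Fin (2 * n + 1 + 1 + 1)) 1 0 = 0 :=
          Pi.single_eq_of_ne (Fin.succ_ne_zero _).symm _
        have e1 : Pi.single (M := fun _ => ℝ) (j.succ.succ : Fin (2 * n + 1 + 1 + 1)) 1 1 = 0 :=
          Pi.single_eq_of_ne (fun h : Fin.succ 0 = _ => Fin.succ_ne_zero _ (Fin.succ_injective _ h).symm) _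
        simp only [e, e0, e1, mul_zero, add_zero]
        exact (ih j a.2 b.2).const_mul _
    exact key j a b

theorem pd_eq_of_hasDerivAt {N : ℕ} {f : (Fin N → ℝ) → ℂ} (hf : ContDiff ℝ ∞ f) {r : Fin N → ℝ} {j : Fin N} {f' : ℂ}
    (h : HasDerivAt (fun s : ℝ => f fun i => r i + s * Pi.single (M := fun _ => ℝ) j 1 i) f' 0) : pd j f r = f' := by
  rw [pd, ← ((hf.differentiable (by simp)) r).lineDeriv_eq_fderiv]
  exact h.deriv

theorem pd_proj (n : ℕ) (r : Fin (2 * n + 1) → ℝ) (j : Fin (2 * n + 1)) (a b : Kap n) :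
    pd j (fun y => proj n (En n y) a b) r = dproj n r j a b :=
  pd_eq_of_hasDerivAt (contDiff_proj n (fun r => r) (fun i => contDiff_apply ℝ ℝ i) a b) (hasDerivAt_proj n r j a b)

theorem wc_En : ∀ (n : ℕ) (r : Fin (2 * n + 1) → ℝ), wc n (En n r) = ex (r (Fin.last _))
  | 0, _ => rfl
  | n + 1, r => wc_En n fun i => r i.succ.succ

theorem pd_wc (n : ℕ) (r : Fin (2 * n + 1) → ℝ) (j : Fin (2 * n + 1)) :
    pd j (fun y => (ex (y (Fin.last _)) : ℂ)) r =
      (if j = Fin.last _ then 2 * Real.pi * Complex.I else 0) * ex (r (Fin.last _)) := by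
  refine pd_eq_of_hasDerivAt (contDiff_ex (contDiff_apply ℝ ℝ _)) ?_
  split_ifs with h
  · subst h
    simp only [Pi.single_eq_same, mul_one]
    exact hasDerivAt_line (hasDerivAt_ex _)
  · simp only [Pi.single_eq_of_ne (Ne.symm h), mul_zero, add_zero, zero_mul]
    exact hasDerivAt_const _ _

/-- A generator of the top cohomology of the torus. -/
noncomputable def gen (n : ℕ) (x : X n) : G (Kap n) := idU (proj n x) (proj_sq n x) (wc n x)

theorem continuous_gen (n : ℕ) : Continuous (gen n) := continuous_idU (continuous_proj n) (continuous_wc n)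

theorem gen_apply (n : ℕ) (r : Fin (2 * n + 1) → ℝ) (a b : Kap n) : (gen n (En n r) : Matrix (Kap n) (Kap n) ℂ) a b =
    (1 : Matrix (Kap n) (Kap n) ℂ) a b + ((ex (r (Fin.last _)) : ℂ) - 1) * proj n (En n r) a b := by
  rw [gen, idU_val, wc_En]
  rfl

theorem smooth_gen (n : ℕ) : Smooth fun x => (gen n x : Matrix (Kap n) (Kap n) ℂ) := by
  intro a b
  simp only [gen_apply]
  exact contDiff_const.add (((contDiff_ex (contDiff_apply ℝ ℝ _)).sub contDiff_const).mul
    (contDiff_proj n (fun r => r) (fun i => contDiff_apply ℝ ℝ i) a b))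

theorem pd_gen (n : ℕ) (r : Fin (2 * n + 1) → ℝ) (j : Fin (2 * n + 1)) (a b : Kap n) :
    pd j (fun y => (gen n (En n y) : Matrix (Kap n) (Kap n) ℂ) a b) r =
      (((if j = Fin.last _ then 2 * Real.pi * Complex.I else 0) * ex (r (Fin.last _))) • proj n (En n r) +
        ((ex (r (Fin.last _)) : ℂ) - 1) • dproj n r j) a b := by
  simp only [gen_apply]
  have hw : ContDiff ℝ ∞ fun r : Fin (2 * n + 1) → ℝ => (ex (r (Fin.last _)) : ℂ) := contDiff_ex (contDiff_apply ℝ ℝ _)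
  have hp := contDiff_proj n (fun r => r) (fun i => contDiff_apply ℝ ℝ i) a b
  have hw' := (hw.differentiable (by simp)) r
  have hp' := (hp.differentiable (by simp)) r
  have h := (((hw'.hasFDerivAt.sub_const 1).mul hp'.hasFDerivAt).const_add ((1 : Matrix (Kap n) (Kap n) ℂ) a b)).fderiv
  have h1 := pd_wc n r j
  have h2 := pd_proj n r j a b
  rw [pd] at h1 h2 ⊢
  have h3 := congrArg (fun L => L (Pi.single j 1)) h
  refine h3.trans ?_
  simp only [_root_.add_apply, _root_.smul_apply, h1, h2, Matrix.add_apply, Matrix.smul_apply, smul_eq_mul]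
  ring

theorem ld_gen (n : ℕ) (r : Fin (2 * n + 1) → ℝ) (j : Fin (2 * n + 1)) :
    ld (fun y => (gen n (En n y) : Matrix (Kap n) (Kap n) ℂ)) r j =
      (if j = Fin.last _ then 2 * Real.pi * Complex.I else 0) • proj n (En n r) +
      (((ex (r (Fin.last _)) : ℂ) - 1) * ((ex (r (Fin.last _)))⁻¹ : Circle)) • (proj n (En n r) * dproj n r j) +
      ((ex (r (Fin.last _)) : ℂ) - 1) • (dproj n r j * proj n (En n r)) := by
  have hi : ((gen n (En n r) : Matrix (Kap n) (Kap n) ℂ))⁻¹ =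
      1 + (((ex (r (Fin.last _)))⁻¹ : Circle) - 1 : ℂ) • proj n (En n r) := by
    rw [← inv_val_eq, ← wc_En]
    rfl
  have hm : (Matrix.of fun a b => pd j (fun y => (gen n (En n y) : Matrix (Kap n) (Kap n) ℂ) a b) r) =
      ((if j = Fin.last _ then 2 * Real.pi * Complex.I else 0) * (ex (r (Fin.last _)) : ℂ)) • proj n (En n r) +
        ((ex (r (Fin.last _)) : ℂ) - 1) • dproj n r j := by
    ext a b
    exact pd_gen n r j a b
  have hD := dproj_eq n r j
  have hQ := proj_sq n (En n r)
  have hw := circle_mul_inv (ex (r (Fin.last _)))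
  rw [ld, hi, hm]
  generalize (if j = Fin.last _ then 2 * Real.pi * Complex.I else 0 : ℂ) = β
  generalize (((ex (r (Fin.last _)))⁻¹ : Circle) : ℂ) = v at hw ⊢
  generalize (ex (r (Fin.last _)) : ℂ) = w at hw ⊢
  generalize dproj n r j = D at hD ⊢
  generalize proj n (En n r) = Q at hQ hD ⊢
  have hv : v * (w - 1) = 1 - v := by linear_combination hw
  simp only [add_mul, mul_add, one_mul, smul_mul_smul_comm, hQ]
  have e1 : (v - 1) * (β * w) = β - β * w := by linear_combination β * hw
  have e2 : (v - 1) * (w - 1) = (w - 1) * v - (w - 1) := by ring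
  rw [e1, e2]
  nth_rewrite 1 [hD]
  module

theorem dens_gen (n : ℕ) (r : Fin (2 * n + 1) → ℝ) :
    dens (ld (fun y => (gen n (En n y) : Matrix (Kap n) (Kap n) ℂ)) r) =
      ((2 * n + 1) * n.factorial * (2 * Real.pi * Complex.I)) *
        ((∏ i, kap n r i) * (2 * Real.cos (2 * Real.pi * r (Fin.last _)) - 2 : ℝ) ^ n) := by
  have e : ld (fun y => (gen n (En n y) : Matrix (Kap n) (Kap n) ℂ)) r = _ := funext fun j => ld_gen n r j
  have h := trace_pow_idempotent (proj_sq n (En n r)) (dproj_eq n r)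
    (((ex (r (Fin.last _)) : ℂ) - 1) * ((ex (r (Fin.last _)))⁻¹ : Circle)) ((ex (r (Fin.last _)) : ℂ) - 1)
    (fun j => if j = Fin.last _ then 2 * Real.pi * Complex.I else 0) (commute_curv_fc n (kap n r)) (curv_proj n r) n
  have hf := form_mul_curv_pow n (kap n r) (fun j => if j = Fin.last _ then 2 * Real.pi * Complex.I else 0)
    fun i hi => if_neg hi
  rw [dens, e, h, Matrix.smul_apply, hf, proj_trace, if_pos rfl, smul_eq_mul]
  have hw := circle_mul_inv (ex (r (Fin.last _)))
  have hc : ((2 * Real.cos (2 * Real.pi * r (Fin.last _)) - 2 : ℝ) : ℂ) =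
      ((ex (r (Fin.last _)) : ℂ) - 1) * ((ex (r (Fin.last _)))⁻¹ : Circle) * ((ex (r (Fin.last _)) : ℂ) - 1) := by
    have h2 : ((2 * Real.cos (2 * Real.pi * r (Fin.last _)) : ℝ) : ℂ) = (ex (r (Fin.last _)) : ℂ) + ((ex (r (Fin.last _)))⁻¹ : Circle) := by
      rw [ex, ← Circle.exp_neg, Circle.coe_exp, Circle.coe_exp, Complex.ofReal_mul, Complex.ofReal_cos, Complex.ofReal_ofNat,
        Complex.two_cos, Complex.ofReal_neg]
    rw [Complex.ofReal_sub, h2, Complex.ofReal_ofNat]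
    linear_combination (2 - (ex (r (Fin.last _)) : ℂ)) * hw
  rw [hc]
  ring

end BottWinding
end UnitaryCommutator

open scoped Matrix ContDiff
open MeasureTheory

namespace UnitaryCommutator

section GeneratorDegree

/-- The factors of the top-degree density. -/
noncomputable def fac (ψ : ℝ → ℂ) : ∀ n, Fin (2 * n + 1) → ℝ → ℂ
  | 0 => fun _ => ψ
  | n + 1 => (Fin.cons (fun t => 4 * Real.pi * Complex.I * bottCurv t) (Fin.cons (fun _ => 1) (fac ψ n)) :
      Fin (2 * n + 1 + 1 + 1) → ℝ → ℂ)

theorem prod_fac (ψ : ℝ → ℂ) : ∀ (n : ℕ) (r : Fin (2 * n + 1) → ℝ),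
    ∏ i, fac ψ n i (r i) = (∏ i, kap n r i) * ψ (r (Fin.last _))
  | 0, r => by
    refine (Fin.prod_univ_one _).trans ?_
    rw [Fin.prod_univ_zero, one_mul]
    rfl
  | n + 1, r => by
    have ih := prod_fac ψ n fun i => r i.succ.succ
    refine (Fin.prod_univ_succ (n := 2 * n + 1 + 1) _).trans ?_
    rw [Fin.prod_univ_succ (n := 2 * n + 1), Fin.prod_univ_succ (n := n)]
    refine (congrArg (fun z => 4 * Real.pi * Complex.I * bottCurv (r 0) * (1 * z)) ih).trans ?_
    rw [one_mul, ← mul_assoc]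
    rfl

theorem integral_fac_ne_zero {ψ : ℝ → ℂ} (h : ∫ t in Set.Icc (0 : ℝ) 1, ψ t ≠ 0) :
    ∀ (n : ℕ) (i : Fin (2 * n + 1)), ∫ t in Set.Icc (0 : ℝ) 1, fac ψ n i t ≠ 0
  | 0, _ => h
  | n + 1, i => by
    refine Fin.cases ?_ (fun i => Fin.cases ?_ (fun i => ?_) i) (i : Fin (2 * n + 1 + 1 + 1))
    · change ∫ t in Set.Icc (0 : ℝ) 1, (4 * Real.pi * Complex.I * bottCurv t : ℂ) ≠ 0
      rw [integral_const_mul, integral_complex_ofReal, integral_bottCurv]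
      simp [Real.pi_ne_zero]
    · change ∫ t in Set.Icc (0 : ℝ) 1, (1 : ℂ) ≠ 0
      simp
    · exact integral_fac_ne_zero h n i

theorem integral_cos_pow_ne_zero (n : ℕ) :
    ∫ t in Set.Icc (0 : ℝ) 1, (((2 * Real.cos (2 * Real.pi * t) - 2 : ℝ) : ℂ) ^ n) ≠ 0 := by
  have e : (fun t : ℝ => ((2 * Real.cos (2 * Real.pi * t) - 2 : ℝ) : ℂ) ^ n) =
      fun t => (((-1) ^ n * (2 - 2 * Real.cos (2 * Real.pi * t)) ^ n : ℝ) : ℂ) := by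
    funext t
    rw [← mul_pow, ← Complex.ofReal_pow]
    congr 2
    ring
  rw [e, integral_complex_ofReal, Complex.ofReal_ne_zero, integral_const_mul]
  refine mul_ne_zero (by simp) ?_
  rw [integral_Icc_eq_integral_Ioc, ← intervalIntegral.integral_of_le zero_le_one]
  refine (intervalIntegral.integral_pos zero_lt_one (by fun_prop)
    (fun t _ => pow_nonneg (by linarith [Real.cos_le_one (2 * Real.pi * t)]) n) ⟨1 / 2, by norm_num, ?_⟩).ne'
  have : 2 * Real.pi * (1 / 2) = Real.pi := by ring
  rw [this, Real.cos_pi]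
  positivity

theorem wind_gen_ne_zero (n : ℕ) : windVal (gen n) ≠ 0 := by
  rw [windVal_smooth _ (continuous_gen n) (smooth_gen n), wind, winding]
  simp only [dens_gen]
  rw [integral_const_mul]
  refine mul_ne_zero (mul_ne_zero (mul_ne_zero ?_ (by exact_mod_cast n.factorial_ne_zero)) (by simp [Real.pi_ne_zero])) ?_
  · exact_mod_cast (2 * n).succ_ne_zero
  · have h := prod_fac (fun t => ((2 * Real.cos (2 * Real.pi * t) - 2 : ℝ) : ℂ) ^ n) n
    simp only [← h]
    rw [← Set.pi_univ_Icc, volume_pi, Measure.restrict_pi_pi, integral_fintype_prod_eq_prod]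
    exact Finset.prod_ne_zero_iff.2 fun i _ => integral_fac_ne_zero (integral_cos_pow_ne_zero n) n i

theorem top_windInv_ne_zero (m : ℕ) : top m (windInv m) ≠ 0 :=
  top_windInv_ne_zero_of_exists (continuous_gen m) (wind_gen_ne_zero m)

end GeneratorDegree
end UnitaryCommutator

/-- For `n ≥ 2`, the commutator map `c(x, y) = xyx⁻¹y⁻¹` on the unitary group `U(n)` is not
homotopic to the constant map with value the identity: `U(n)` is not homotopy-abelian. -/
theorem unitaryGroup_commutator_not_nullhomotopic (n : ℕ) (hn : 2 ≤ n) :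
    ¬ ContinuousMap.Homotopic
      (⟨fun p : Matrix.unitaryGroup (Fin n) ℂ × Matrix.unitaryGroup (Fin n) ℂ =>
          p.1 * p.2 * p.1⁻¹ * p.2⁻¹, by
        have hinv : Continuous (fun x : Matrix.unitaryGroup (Fin n) ℂ => x⁻¹) :=
          continuous_induced_rng.2 (continuous_star.comp continuous_subtype_val)
        have hmul : Continuous
            (fun p : Matrix.unitaryGroup (Fin n) ℂ × Matrix.unitaryGroup (Fin n) ℂ =>
              p.1 * p.2) := continuous_mul
        fun_prop⟩ :
        C(Matrix.unitaryGroup (Fin n) ℂ × Matrix.unitaryGroup (Fin n) ℂ,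
          Matrix.unitaryGroup (Fin n) ℂ))
      (ContinuousMap.const _ 1) := by
  rintro ⟨H⟩
  obtain ⟨m, rfl⟩ := Nat.exists_eq_add_of_le' hn
  refine UnitaryCommutator.commutator_not_nullhomotopic_of_inv (UnitaryCommutator.windInv (m + 2))
    (UnitaryCommutator.coll_windInv (m + 2))
    (fun f hf => UnitaryCommutator.windVal_eq_zero_of_card (by simp) f hf) (UnitaryCommutator.top_windInv_ne_zero (m + 2))
    (K := fun t p => H (unitInterval.symm t, p)) (by fun_prop) (fun p => ?_) (fun p => ?_)
  · simp
  · simp [UnitaryCommutator.cm]
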